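/- For every integer d ≥ 3 there is a constant C = C(d) with the following property. Let P be a set of n points in ℝ^d in general position, all of whose points are k-shallow in P, where k is an integer with 2 ≤ k ≤ n/2. Then there exists a straight-edge spanning tree T of P such that every hyperplane in ℝ^d crosses at most C · n^{1−1/(d−1)} · k^{1/(d(d−1))} · (log₂(n/k))^{2/(d−1)} edges of T. -/

import Mathlib

open scoped RealInnerProductSpace
open scoped Classical

noncomputable section

/-- A closed halfspace in `ℝ^d`. -/
def halfspace {d : ℕ} (a : EuclideanSpace ℝ (Fin d)) (b : ℝ) : Set (EuclideanSpace ℝ (Fin d)) :=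
  {x | ⟪x, a⟫ ≤ b}

/-- A hyperplane in `ℝ^d`. -/
def hyperplane {d : ℕ} (a : EuclideanSpace ℝ (Fin d)) (b : ℝ) : Set (EuclideanSpace ℝ (Fin d)) :=
  {x | ⟪x, a⟫ = b}

/-- A point `p` of a finite set `P` is `k`-shallow if some closed halfspace contains `p`
and at most `k` points of `P` (including `p`). -/
def IsShallowPt {d : ℕ} (P : Finset (EuclideanSpace ℝ (Fin d))) (k : ℕ)
    (p : EuclideanSpace ℝ (Fin d)) : Prop :=
  ∃ a b, a ≠ 0 ∧ p ∈ halfspace a b ∧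
    ((P : Set (EuclideanSpace ℝ (Fin d))) ∩ halfspace a b).ncard ≤ k

/-- `P` is in general position: no `d+1` points of `P` lie on a common hyperplane. -/
def GenPos {d : ℕ} (P : Finset (EuclideanSpace ℝ (Fin d))) : Prop :=
  ∀ (a : EuclideanSpace ℝ (Fin d)) (b : ℝ), a ≠ 0 →
    ((P : Set (EuclideanSpace ℝ (Fin d))) ∩ hyperplane a b).ncard ≤ d

/-- A hyperplane `{x | ⟪x, a⟫ = b}` crosses the segment `[p, q]` if it meets the segment
but does not contain it. -/
def CrossesSeg {d : ℕ} (a : EuclideanSpace ℝ (Fin d)) (b : ℝ)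
    (p q : EuclideanSpace ℝ (Fin d)) : Prop :=
  (hyperplane a b ∩ segment ℝ p q).Nonempty ∧ ¬ segment ℝ p q ⊆ hyperplane a b

/-- The `j`-dimensional subcubes (with base set `R`) all of whose vertices lie in `V`. -/
def cubes {ι : Type*} [DecidableEq ι] (V : Finset (Finset ι)) (R : Finset ι) (j : ℕ) :
    Finset (Finset ι × Finset ι) :=
  (R.powersetCard j ×ˢ R.powerset).filter
    fun p => Disjoint p.1 p.2 ∧ ∀ ε ⊆ p.1, ε ∪ p.2 ∈ V

theorem mem_cubes {ι : Type*} [DecidableEq ι] {V : Finset (Finset ι)} {R : Finset ι} {j : ℕ}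
    {J β : Finset ι} : (J, β) ∈ cubes V R j ↔
      J ⊆ R ∧ J.card = j ∧ β ⊆ R ∧ Disjoint J β ∧ ∀ ε ⊆ J, ε ∪ β ∈ V := by
  simp [cubes, Finset.mem_powersetCard, and_assoc]

theorem card_cubes_add_le {ι : Type*} [DecidableEq ι] (A B : Finset (Finset ι)) (R : Finset ι)
    (j : ℕ) : (cubes A R j).card + (cubes B R j).card
      ≤ (cubes (A ∪ B) R j).card + (cubes (A ∩ B) R j).card := by
  rw [← Finset.card_union_add_card_inter]
  refine Nat.add_le_add (Finset.card_le_card ?_) (Finset.card_le_card ?_)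
  · rintro ⟨J, β⟩ h
    simp only [Finset.mem_union, mem_cubes] at h ⊢
    rcases h with h | h
    · exact ⟨h.1, h.2.1, h.2.2.1, h.2.2.2.1, fun ε hε => Or.inl (h.2.2.2.2 ε hε)⟩
    · exact ⟨h.1, h.2.1, h.2.2.1, h.2.2.2.1, fun ε hε => Or.inr (h.2.2.2.2 ε hε)⟩
  · rintro ⟨J, β⟩ h
    simp only [Finset.mem_inter, mem_cubes] at h ⊢
    exact ⟨h.1.1, h.1.2.1, h.1.2.2.1, h.1.2.2.2.1,
      fun ε hε => ⟨h.1.2.2.2.2 ε hε, h.2.2.2.2.2 ε hε⟩⟩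

theorem card_cubes_insert_le {ι : Type*} [DecidableEq ι] (V : Finset (Finset ι)) (R : Finset ι)
    (h : ι) (j : ℕ) :
    (cubes V (insert h R) (j + 1)).card ≤ (cubes (V.nonMemberSubfamily h) R (j + 1)).card +
      (cubes (V.memberSubfamily h) R (j + 1)).card +
      (cubes (V.memberSubfamily h ∩ V.nonMemberSubfamily h) R j).card := by
  have key : cubes V (insert h R) (j + 1) ⊆ (cubes (V.nonMemberSubfamily h) R (j + 1) ∪
      (cubes (V.memberSubfamily h) R (j + 1)).image (fun p => (p.1, insert h p.2))) ∪
      (cubes (V.memberSubfamily h ∩ V.nonMemberSubfamily h) R j).image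
        (fun p => (insert h p.1, p.2)) := by
    rintro ⟨J, β⟩ hJ
    rw [mem_cubes] at hJ
    obtain ⟨h1, h2, h3, h4, h5⟩ := hJ
    simp only [Finset.mem_union, Finset.mem_image, Prod.exists, Prod.mk.injEq, mem_cubes,
      Finset.mem_inter, Finset.mem_memberSubfamily, Finset.mem_nonMemberSubfamily]
    rw [Finset.subset_insert_iff] at h1 h3
    by_cases hJ : h ∈ J
    · right
      have hβ : h ∉ β := Finset.disjoint_left.1 h4 hJ
      rw [Finset.erase_eq_of_notMem hβ] at h3
      refine ⟨J.erase h, β, ⟨h1, by rw [Finset.card_erase_of_mem hJ, h2]; rfl, h3,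
        h4.mono_left (Finset.erase_subset _ _), fun ε hε => ?_⟩, Finset.insert_erase hJ, rfl⟩
      have he : h ∉ ε := fun hh => Finset.notMem_erase h J (hε hh)
      have hε' : ε ⊆ J := hε.trans (Finset.erase_subset _ _)
      have hn : ¬ (h ∈ ε ∨ h ∈ β) := by simp [he, hβ]
      refine ⟨⟨?_, hn⟩, h5 ε hε', hn⟩
      rw [← Finset.insert_union]
      exact h5 _ (Finset.insert_subset hJ hε')
    · left
      rw [Finset.erase_eq_of_notMem hJ] at h1
      by_cases hβ : h ∈ β
      · right
        refine ⟨J, β.erase h, ⟨h1, h2, h3, h4.mono_right (Finset.erase_subset _ _),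
          fun ε hε => ?_⟩, rfl, Finset.insert_erase hβ⟩
        have he : h ∉ ε := fun hh => hJ (hε hh)
        refine ⟨?_, by simp [he]⟩
        rw [← Finset.union_insert, Finset.insert_erase hβ]
        exact h5 ε hε
      · left
        rw [Finset.erase_eq_of_notMem hβ] at h3
        exact ⟨h1, h2, h3, h4, fun ε hε =>
          ⟨h5 ε hε, by simp only [hβ, or_false]; exact fun hh => hJ (hε hh)⟩⟩
  refine (Finset.card_le_card key).trans ((Finset.card_union_le _ _).trans
    (Nat.add_le_add ((Finset.card_union_le _ _).trans (Nat.add_le_add le_rfl ?_)) ?_)) <;>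
  exact Finset.card_image_le

theorem card_cubes_zero_le {ι : Type*} [DecidableEq ι] (V : Finset (Finset ι)) (R : Finset ι) :
    (cubes V R 0).card ≤ V.card := by
  refine Finset.card_le_card_of_injOn (fun p => p.2) ?_ ?_
  · rintro ⟨J, β⟩ h
    have h := mem_cubes.1 h
    simpa using h.2.2.2.2 ∅ (by simp)
  · rintro ⟨J, β⟩ h ⟨J', β'⟩ h' e
    have h := mem_cubes.1 h
    have h' := mem_cubes.1 h'
    rw [Finset.card_eq_zero] at h h'
    simp only at e
    rw [h.2.1, h'.2.1, e]

theorem shatters_insert_of_inter {ι : Type*} [DecidableEq ι] {V : Finset (Finset ι)} {h : ι}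
    {T : Finset ι} (hT : (V.memberSubfamily h ∩ V.nonMemberSubfamily h).Shatters T) :
    h ∉ T ∧ V.Shatters (insert h T) := by
  have hh : h ∉ T := by
    obtain ⟨u, hu, hTu⟩ := hT (Finset.Subset.refl T)
    intro hhT
    have : h ∈ u := Finset.inter_eq_left.1 hTu hhT
    simp only [Finset.mem_inter, Finset.mem_nonMemberSubfamily] at hu
    exact hu.2.2 this
  refine ⟨hh, fun t ht => ?_⟩
  obtain ⟨u, hu, hTu⟩ := hT (t := t.erase h) (by rwa [Finset.subset_insert_iff] at ht)
  simp only [Finset.mem_inter, Finset.mem_nonMemberSubfamily, Finset.mem_memberSubfamily] at hu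
  by_cases hht : h ∈ t
  · refine ⟨insert h u, hu.1.1, ?_⟩
    rw [← Finset.insert_inter_distrib, hTu, Finset.insert_erase hht]
  · refine ⟨u, hu.2.1, ?_⟩
    rw [Finset.insert_inter_of_notMem hu.2.2, hTu, Finset.erase_eq_of_notMem hht]

/-- A family of VC dimension at most `D` contains at most `C(D,j)` times as many
`j`-dimensional subcubes as members. -/
theorem card_cubes_le {ι : Type*} [DecidableEq ι] (R : Finset ι) :
    ∀ (V : Finset (Finset ι)) (D j : ℕ), (∀ T, V.Shatters T → T.card ≤ D) →
      (cubes V R j).card ≤ D.choose j * V.card := by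
  induction R using Finset.induction_on with
  | empty =>
    intro V D j _
    rcases j with _ | j
    · simpa using card_cubes_zero_le V ∅
    · have : cubes V ∅ (j + 1) = ∅ := by
        ext ⟨J, β⟩
        simp only [mem_cubes, Finset.subset_empty, Finset.notMem_empty, iff_false]
        rintro ⟨rfl, h, -⟩
        simp at h
      simp [this]
  | insert h R hR ih =>
    intro V D j hV
    rcases j with _ | j
    · simpa using card_cubes_zero_le V _
    set N := V.nonMemberSubfamily h with hN
    set M := V.memberSubfamily h with hM
    have h1 := card_cubes_insert_le V R h j
    rw [← hN, ← hM] at h1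
    have h2 := card_cubes_add_le N M R (j + 1)
    have hcard : (N ∪ M).card + (N ∩ M).card = V.card := by
      rw [Finset.card_union_add_card_inter, add_comm]
      exact Finset.card_memberSubfamily_add_card_nonMemberSubfamily h V
    have hU : ∀ T, (N ∪ M).Shatters T → T.card ≤ D := by
      intro T hT
      have hhT : h ∉ T := by
        intro hh
        obtain ⟨u, hu, hTu⟩ := hT (Finset.Subset.refl T)
        have : h ∈ u := Finset.inter_eq_left.1 hTu hh
        simp only [hN, hM, Finset.mem_union, Finset.mem_nonMemberSubfamily,
          Finset.mem_memberSubfamily] at hu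
        tauto
      apply hV
      intro t ht
      obtain ⟨u, hu, hTu⟩ := hT ht
      rcases Finset.mem_union.1 hu with hu | hu
      · exact ⟨u, (Finset.mem_nonMemberSubfamily.1 hu).1, hTu⟩
      · exact ⟨insert h u, (Finset.mem_memberSubfamily.1 hu).1, by
          rw [Finset.inter_insert_of_notMem hhT, hTu]⟩
    have hI : ∀ T, (N ∩ M).Shatters T → T.card + 1 ≤ D := by
      intro T hT
      rw [Finset.inter_comm] at hT
      obtain ⟨a, b⟩ := shatters_insert_of_inter hT
      simpa [Finset.card_insert_of_notMem a] using hV _ b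
    have i1 := ih (N ∪ M) D (j + 1) hU
    rw [Finset.inter_comm M N] at h1
    rcases D with _ | D
    · have hem : N ∩ M = ∅ := by
        by_contra hne
        obtain ⟨u, hu⟩ := Finset.nonempty_iff_ne_empty.2 hne
        have := hI ∅ (fun t ht => ⟨u, hu, by rw [Finset.subset_empty.1 ht]; simp⟩)
        omega
      have e1 : ∀ i, (cubes (N ∩ M) R i).card = 0 := by
        intro i
        rw [hem, Finset.card_eq_zero]
        ext ⟨J, β⟩
        simp only [mem_cubes, Finset.notMem_empty, iff_false]
        rintro ⟨_, _, _, _, h⟩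
        exact h ∅ (by simp)
      rw [e1] at h1 h2
      rw [Nat.choose_zero_succ, zero_mul] at i1 ⊢
      omega
    · have i2 := ih (N ∩ M) D (j + 1) (fun T hT => by have := hI T hT; omega)
      have i3 := ih (N ∩ M) D j (fun T hT => by have := hI T hT; omega)
      rw [Nat.choose_succ_succ'] at i1 ⊢
      rw [← hcard]
      nlinarith

theorem sum_min_le {ι : Type*} [DecidableEq ι] (R : Finset ι) (w : Finset ι → ℕ) (D : ℕ)
    (hD : ∀ T, (R.powerset.filter fun A => 0 < w A).Shatters T → T.card ≤ D) :
    ∑ i ∈ R, ∑ A ∈ (R.erase i).powerset, min (w A) (w (insert i A))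
      ≤ D * ∑ A ∈ R.powerset, w A := by
  obtain ⟨M, hM⟩ : ∃ M, ∀ A ∈ R.powerset, w A ≤ M :=
    ⟨∑ A ∈ R.powerset, w A, fun A hA => Finset.single_le_sum (fun _ _ => Nat.zero_le _) hA⟩
  have layer : ∀ x ≤ M, x = ∑ t ∈ Finset.range M, if t < x then 1 else 0 := by
    intro x hx
    rw [Finset.sum_boole]
    have : (Finset.range M).filter (fun t => t < x) = Finset.range x := by
      ext t; simp; omega
    simp [this]
  have hVt : ∀ t, ∀ T, (R.powerset.filter fun A => t < w A).Shatters T → T.card ≤ D := by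
    intro t T hT
    refine hD T (hT.mono_left ?_)
    intro A hA
    simp only [Finset.mem_filter] at hA ⊢
    exact ⟨hA.1, by omega⟩
  have e1 : ∑ i ∈ R, ∑ A ∈ (R.erase i).powerset, min (w A) (w (insert i A))
      = ∑ t ∈ Finset.range M, ∑ i ∈ R, ∑ A ∈ (R.erase i).powerset,
          if t < min (w A) (w (insert i A)) then 1 else 0 := by
    rw [Finset.sum_comm]
    refine Finset.sum_congr rfl fun i hi => ?_
    rw [Finset.sum_comm]
    refine Finset.sum_congr rfl fun A hA => layer _ ?_
    refine (min_le_left _ _).trans (hM A ?_)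
    rw [Finset.mem_powerset] at hA ⊢
    exact hA.trans (Finset.erase_subset _ _)
  have e2 : ∑ A ∈ R.powerset, w A = ∑ t ∈ Finset.range M, ∑ A ∈ R.powerset,
      if t < w A then 1 else 0 := by
    rw [Finset.sum_comm]
    exact Finset.sum_congr rfl fun A hA => layer _ (hM A hA)
  rw [e1, e2, Finset.mul_sum]
  refine Finset.sum_le_sum fun t _ => ?_
  have := card_cubes_le R _ D 1 (hVt t)
  rw [Nat.choose_one_right] at this
  refine le_trans ?_ (this.trans_eq ?_)
  · simp_rw [Finset.sum_boole]
    simp only [Nat.cast_id]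
    rw [← Finset.card_sigma]
    refine Finset.card_le_card_of_injOn (fun p => ({p.1}, p.2)) ?_ ?_
    · rintro ⟨i, A⟩ h
      simp only [Finset.coe_sigma, Set.mem_sigma_iff, Finset.mem_coe, Finset.mem_filter,
        Finset.mem_powerset, lt_min_iff] at h
      obtain ⟨hi, hA, h1, h2⟩ := h
      have hiA : i ∉ A := fun hh => Finset.notMem_erase i R (hA hh)
      have hAR := hA.trans (Finset.erase_subset _ _)
      rw [Finset.mem_coe, mem_cubes]
      refine ⟨by simpa using hi, by simp, hAR, by simpa using hiA, fun ε hε => ?_⟩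
      rcases Finset.subset_singleton_iff.1 hε with rfl | rfl
      · simpa using ⟨hAR, h1⟩
      · rw [Finset.mem_filter, Finset.mem_powerset, ← Finset.insert_eq]
        exact ⟨Finset.insert_subset hi hAR, h2⟩
    · rintro ⟨i, A⟩ _ ⟨i', A'⟩ _ e
      simp only [Prod.mk.injEq, Finset.singleton_inj] at e
      obtain ⟨rfl, rfl⟩ := e
      rfl
  · rw [Finset.sum_boole]
    simp

/-- Sign patterns of vectors in a `D`-dimensional space have VC dimension at most `D`. -/
theorem card_le_of_shatters_signs {ι α E : Type*} [DecidableEq ι] [AddCommGroup E] [Module ℝ E]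
    [FiniteDimensional ℝ E] (y : ι → E) (φ : α → Module.Dual ℝ E) (R : Finset ι)
    (V : Finset (Finset ι))
    (hV : ∀ A ∈ V, A ⊆ R ∧ ∃ x, ∀ i ∈ R, φ x (y i) ≠ 0 ∧ (i ∈ A ↔ 0 < φ x (y i)))
    (T : Finset ι) (hT : V.Shatters T) : T.card ≤ Module.finrank ℝ E := by
  have hTR : T ⊆ R := by
    obtain ⟨u, hu, hTu⟩ := hT (Finset.Subset.refl T)
    exact (Finset.inter_eq_left.1 hTu).trans (hV u hu).1
  by_contra hcard
  have hli : ¬ LinearIndependent ℝ (fun i : T => y i) := by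
    intro h
    have := h.fintype_card_le_finrank
    rw [Fintype.card_coe] at this
    exact hcard this
  have main : ∀ c : T → ℝ, ∑ i, c i • y i = 0 → ∀ i, ¬ 0 < c i := by
    intro c hc i0 hi0
    obtain ⟨u, hu, hTu⟩ := hT (t := (Finset.univ.filter fun i : T => 0 < c i).image Subtype.val)
      (fun i hi => by
        obtain ⟨j, -, rfl⟩ := Finset.mem_image.1 hi
        exact j.2)
    obtain ⟨-, x, hx⟩ := hV u hu
    have hmem : ∀ i : T, (i : ι) ∈ u ↔ 0 < c i := by
      intro i
      have : (i : ι) ∈ T ∩ u ↔ 0 < c i := by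
        rw [hTu]; simp
      rw [← this, Finset.mem_inter]
      exact ⟨fun h => ⟨i.2, h⟩, fun h => h.2⟩
    have h0 : ∑ i, c i * φ x (y i) = 0 := by
      have := congrArg (φ x) hc
      simpa [map_sum] using this
    have hnn : ∀ i : T, 0 ≤ c i * φ x (y i) := by
      intro i
      by_cases hci : 0 < c i
      · exact (mul_pos hci ((hx i (hTR i.2)).2.1 ((hmem i).2 hci))).le
      · have : ¬ 0 < φ x (y i) := fun h => hci ((hmem i).1 ((hx i (hTR i.2)).2.2 h))
        exact mul_nonneg_of_nonpos_of_nonpos (not_lt.1 hci) (not_lt.1 this)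
    have := (Finset.sum_eq_zero_iff_of_nonneg (fun i _ => hnn i)).1 h0 i0 (Finset.mem_univ _)
    exact absurd this (mul_pos hi0 ((hx i0 (hTR i0.2)).2.1 ((hmem i0).2 hi0))).ne'
  obtain ⟨c, hc, i, hi⟩ := Fintype.not_linearIndependent_iff.1 hli
  rcases lt_or_gt_of_ne hi with h | h
  · refine main (fun i => - c i)
      (by simp only [neg_smul, Finset.sum_neg_distrib, hc, neg_zero]) i (by simpa using h)
  · exact main c hc i h

theorem min_ge_of_pairs {α : Type*} (K : Finset α) (s : α → Prop) :
    ((K ×ˢ K).filter fun p => ¬ (s p.1 ↔ s p.2)).card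
      ≤ 2 * K.card * min (K.filter fun x => ¬ s x).card (K.filter fun x => s x).card := by
  set a := (K.filter fun x => ¬ s x).card
  set b := (K.filter fun x => s x).card
  have hab : b + a = K.card := Finset.card_filter_add_card_filter_not s
  have h1 : ((K ×ˢ K).filter fun p => ¬ (s p.1 ↔ s p.2)).card ≤ a * b + b * a := by
    have : ((K ×ˢ K).filter fun p => ¬ (s p.1 ↔ s p.2)) ⊆
      ((K.filter fun x => ¬ s x) ×ˢ (K.filter fun x => s x)) ∪
      ((K.filter fun x => s x) ×ˢ (K.filter fun x => ¬ s x)) := by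
      intro p hp
      simp only [Finset.mem_filter, Finset.mem_product, Finset.mem_union] at hp ⊢
      tauto
    refine (Finset.card_le_card this).trans ((Finset.card_union_le _ _).trans ?_)
    rw [Finset.card_product, Finset.card_product]
  refine h1.trans ?_
  rw [← hab]
  rcases le_total a b with h | h
  · rw [min_eq_left h]; nlinarith
  · rw [min_eq_right h]; nlinarith

/-- Packing lemma: if all pairs are separated by a `δ`-fraction of `κ`, then `m` elements of `κ`
suffice to split the points into at least half as many classes. -/
theorem exists_many_classes {α κ : Type*} [Fintype κ] (P : Finset α) (μ : κ → ℝ)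
    (hμ : ∀ h, 0 ≤ μ h) (hμ1 : ∑ h, μ h = 1) (side : κ → α → Prop) (D m : ℕ)
    (hVC : ∀ (m : ℕ) (g : Fin m → κ) (T : Finset (Fin m)),
      (P.image fun x => Finset.univ.filter fun i => side (g i) x).Shatters T → T.card ≤ D)
    (δ : ℝ) (hδ0 : 0 < δ)
    (hδ : ∀ x ∈ P, ∀ y ∈ P, x ≠ y →
      δ ≤ ∑ h ∈ Finset.univ.filter (fun h => ¬ (side h x ↔ side h y)), μ h)
    (hm : 4 * (D : ℝ) ≤ (m + 1) * δ) :
    ∃ g : Fin m → κ,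
      P.card ≤ 2 * (P.image fun x => Finset.univ.filter fun i => side (g i) x).card := by
  by_contra hcon
  push Not at hcon
  have hn : 0 < P.card := by
    have : Nonempty κ := by
      by_contra h
      rw [not_nonempty_iff] at h
      simp at hμ1
    have := hcon (fun _ => Classical.arbitrary κ)
    omega
  let w : ∀ {m : ℕ}, (Fin m → κ) → Finset (Fin m) → ℕ := fun g A =>
    (P.filter fun x => (Finset.univ.filter fun i => side (g i) x) = A).card
  let S : Fin (m + 1) → (Fin (m + 1) → κ) → ℕ := fun i g =>
    ∑ A ∈ (Finset.univ.erase i).powerset, min (w g A) (w g (insert i A))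
  have upper : ∀ g, ∑ i, S i g ≤ D * P.card := by
    intro g
    have h := sum_min_le (Finset.univ : Finset (Fin (m + 1))) (w g) D ?_
    · refine h.trans_eq ?_
      congr 1
      rw [Finset.powerset_univ]
      exact (Finset.card_eq_sum_card_fiberwise (fun x _ => Finset.mem_coe.2
        (Finset.mem_univ _))).symm
    · intro T hT
      refine hVC _ g T (hT.mono_left ?_)
      intro A hA
      simp only [Finset.mem_filter, w, Finset.card_pos] at hA
      obtain ⟨x, hx⟩ := hA.2
      rw [Finset.mem_filter] at hx
      exact Finset.mem_image.2 ⟨x, hx.1, hx.2⟩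
  have split : ∀ (i : Fin (m + 1)) (h : κ) (g : Fin m → κ),
      ∑ B ∈ P.image (fun x => Finset.univ.filter fun j => side (g j) x),
        min ((P.filter fun x => (Finset.univ.filter fun j => side (g j) x) = B).filter
              fun x => ¬ side h x).card
          ((P.filter fun x => (Finset.univ.filter fun j => side (g j) x) = B).filter
              fun x => side h x).card
      ≤ S i (Fin.insertNth i h g) := by
    intro i h g
    set g' : Fin (m + 1) → κ := Fin.insertNth i h g with hg'
    have hi : g' i = h := by simp [hg']
    have hj : ∀ j, g' (i.succAbove j) = g j := by simp [hg']
    have t1 : ∀ B x, ((Finset.univ.filter fun j => side (g' j) x) = B.map i.succAboveEmb) ↔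
        ((Finset.univ.filter fun j => side (g j) x) = B ∧ ¬ side h x) := by
      intro B x
      simp only [Finset.ext_iff, Finset.mem_filter, Finset.mem_univ, true_and,
        Fin.forall_iff_succAbove i, hi, hj]
      simp [Fin.succAbove_ne]
      tauto
    have t2 : ∀ B x, ((Finset.univ.filter fun j => side (g' j) x) =
        insert i (B.map i.succAboveEmb)) ↔
        ((Finset.univ.filter fun j => side (g j) x) = B ∧ side h x) := by
      intro B x
      simp only [Finset.ext_iff, Finset.mem_filter, Finset.mem_univ, true_and,
        Fin.forall_iff_succAbove i, hi, hj]
      simp [Fin.succAbove_ne]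
      tauto
    have e : ∀ B, min ((P.filter fun x => (Finset.univ.filter fun j => side (g j) x) = B).filter
              fun x => ¬ side h x).card
          ((P.filter fun x => (Finset.univ.filter fun j => side (g j) x) = B).filter
              fun x => side h x).card
          = min (w g' (B.map i.succAboveEmb)) (w g' (insert i (B.map i.succAboveEmb))) := by
      intro B
      simp only [w, t1, t2, Finset.filter_filter]
    simp_rw [e]
    rw [← Finset.sum_image (f := fun A => min (w g' A) (w g' (insert i A)))
      (g := fun B : Finset (Fin m) => B.map i.succAboveEmb)
      (fun B _ B' _ h => Finset.map_injective _ h)]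
    refine Finset.sum_le_sum_of_subset ?_
    intro A hA
    obtain ⟨B, -, rfl⟩ := Finset.mem_image.1 hA
    rw [Finset.mem_powerset]
    intro j hj
    obtain ⟨l, -, rfl⟩ := Finset.mem_map.1 hj
    simp [Fin.succAbove_ne]
  have lower1 : ∀ (K : Finset α), K ⊆ P → K.Nonempty →
      δ / 2 * ((K.card : ℝ) - 1) ≤ ∑ h, μ h *
        ((min (K.filter fun x => ¬ side h x).card (K.filter fun x => side h x).card : ℕ) : ℝ) := by
    intro K hK hne
    have hc : (0 : ℝ) < K.card := by exact_mod_cast hne.card_pos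
    have h1 : δ * ((K.card : ℝ) * (K.card - 1)) ≤
        ∑ p ∈ K.offDiag, ∑ h ∈ Finset.univ.filter (fun h => ¬ (side h p.1 ↔ side h p.2)), μ h := by
      have : δ * ((K.card : ℝ) * (K.card - 1)) = ∑ p ∈ K.offDiag, δ := by
        rw [Finset.sum_const, Finset.offDiag_card, nsmul_eq_mul,
          Nat.cast_sub (Nat.le_mul_self _)]
        push_cast; ring
      rw [this]
      refine Finset.sum_le_sum fun p hp => ?_
      rw [Finset.mem_offDiag] at hp
      exact hδ _ (hK hp.1) _ (hK hp.2.1) hp.2.2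
    have h2 : ∑ p ∈ K.offDiag, ∑ h ∈ Finset.univ.filter (fun h => ¬ (side h p.1 ↔ side h p.2)), μ h
        ≤ ∑ h, μ h * (2 * K.card *
          ((min (K.filter fun x => ¬ side h x).card (K.filter fun x => side h x).card : ℕ) : ℝ)) := by
      simp_rw [Finset.sum_filter]
      rw [Finset.sum_comm]
      refine Finset.sum_le_sum fun h _ => ?_
      rw [← Finset.sum_filter, Finset.sum_const, nsmul_eq_mul, mul_comm]
      refine mul_le_mul_of_nonneg_left ?_ (hμ h)
      have := min_ge_of_pairs K (side h)
      rw [← Nat.cast_ofNat, ← Nat.cast_mul, ← Nat.cast_mul, Nat.cast_le]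
      refine le_trans (Finset.card_le_card ?_) this
      intro p hp
      simp only [Finset.mem_filter, Finset.mem_offDiag, Finset.mem_product] at hp ⊢
      exact ⟨⟨hp.1.1, hp.1.2.1⟩, hp.2⟩
    have h3 := h1.trans h2
    have e : ∑ h, μ h * (2 * K.card *
          ((min (K.filter fun x => ¬ side h x).card (K.filter fun x => side h x).card : ℕ) : ℝ))
        = (2 * K.card) * ∑ h, μ h *
          ((min (K.filter fun x => ¬ side h x).card (K.filter fun x => side h x).card : ℕ) : ℝ) := by
      rw [Finset.mul_sum]
      exact Finset.sum_congr rfl fun h _ => by ring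
    rw [e] at h3
    have h4 : (2 * (K.card : ℝ)) * (δ / 2 * (K.card - 1)) ≤ (2 * K.card) * ∑ h, μ h *
          ((min (K.filter fun x => ¬ side h x).card (K.filter fun x => side h x).card : ℕ) : ℝ) := by
      linarith
    exact le_of_mul_le_mul_left h4 (by positivity)
  have lower : ∀ (i : Fin (m + 1)) (g : Fin m → κ),
      δ / 4 * P.card < ∑ h, μ h * (S i (Fin.insertNth i h g) : ℝ) := by
    intro i g
    have h1 := hcon g
    set I := P.image (fun x => Finset.univ.filter fun j => side (g j) x) with hI
    have h2 : ∑ B ∈ I, δ / 2 *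
        (((P.filter fun x => (Finset.univ.filter fun j => side (g j) x) = B).card : ℝ) - 1)
        = δ / 2 * (P.card - I.card) := by
      rw [← Finset.mul_sum, Finset.sum_sub_distrib]
      congr 2
      · rw [Finset.card_eq_sum_card_image (fun x => Finset.univ.filter fun j => side (g j) x) P]
        push_cast; rfl
      · simp
    have h3 : δ / 4 * P.card < δ / 2 * (P.card - I.card) := by
      have : (2 : ℝ) * I.card < P.card := by exact_mod_cast h1
      nlinarith
    refine h3.trans_le (h2.symm.trans_le ?_)
    refine (Finset.sum_le_sum (fun B hB => lower1 _ (Finset.filter_subset _ _) ?_)).trans ?_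
    · obtain ⟨x, hx, rfl⟩ := Finset.mem_image.1 hB
      exact ⟨x, Finset.mem_filter.2 ⟨hx, rfl⟩⟩
    · rw [Finset.sum_comm]
      refine Finset.sum_le_sum fun h _ => ?_
      rw [← Finset.mul_sum]
      exact mul_le_mul_of_nonneg_left (by exact_mod_cast split i h g) (hμ h)
  have tot : ∀ m, ∑ g : Fin m → κ, ∏ i, μ (g i) = 1 := by
    intro m
    have := Finset.prod_univ_sum (fun _ : Fin m => (Finset.univ : Finset κ)) (fun _ j => μ j)
    rw [Fintype.piFinset_univ] at this
    rw [← this]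
    simp [hμ1]
  have hW : ∀ m (g : Fin m → κ), 0 ≤ ∏ i, μ (g i) := fun m g =>
    Finset.prod_nonneg fun i _ => hμ _
  have up2 : ∑ i, ∑ g : Fin (m + 1) → κ, (∏ j, μ (g j)) * (S i g : ℝ) ≤ D * P.card := by
    rw [Finset.sum_comm]
    calc _ = ∑ g : Fin (m + 1) → κ, (∏ j, μ (g j)) * ((∑ i, S i g : ℕ) : ℝ) := by
          refine Finset.sum_congr rfl fun g _ => ?_
          rw [← Finset.mul_sum]; push_cast; rfl
      _ ≤ ∑ g : Fin (m + 1) → κ, (∏ j, μ (g j)) * (D * P.card : ℝ) :=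
          Finset.sum_le_sum fun g _ =>
            mul_le_mul_of_nonneg_left (by exact_mod_cast upper g) (hW _ g)
      _ = _ := by rw [← Finset.sum_mul, tot, one_mul]
  have low2 : ∀ i : Fin (m + 1), δ / 4 * P.card < ∑ g : Fin (m + 1) → κ,
      (∏ j, μ (g j)) * (S i g : ℝ) := by
    intro i
    rw [← (Fin.insertNthEquiv (fun _ => κ) i).sum_comp, Fintype.sum_prod_type, Finset.sum_comm]
    have e : ∀ (g : Fin m → κ), ∑ h, (∏ j, μ ((Fin.insertNthEquiv (fun _ => κ) i (h, g)) j)) *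
        (S i (Fin.insertNthEquiv (fun _ => κ) i (h, g)) : ℝ)
        = (∏ j, μ (g j)) * ∑ h, μ h * (S i (Fin.insertNth i h g) : ℝ) := by
      intro g
      rw [Finset.mul_sum]
      refine Finset.sum_congr rfl fun h _ => ?_
      rw [Fin.prod_univ_succAbove _ i]
      simp only [Fin.insertNthEquiv_apply, Fin.insertNth_apply_same,
        Fin.insertNth_apply_succAbove]
      change (μ h * ∏ x, μ (g x)) * (S i (Fin.insertNth i h g) : ℝ) = _
      ring
    simp_rw [e]
    calc δ / 4 * P.card = ∑ g : Fin m → κ, (∏ j, μ (g j)) * (δ / 4 * P.card) := by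
          rw [← Finset.sum_mul, tot, one_mul]
      _ < _ := by
          refine Finset.sum_lt_sum (fun g _ => mul_le_mul_of_nonneg_left (lower i g).le (hW _ g)) ?_
          by_contra hno
          push Not at hno
          have hz : ∀ g : Fin m → κ, ∏ j, μ (g j) = 0 := by
            intro g
            by_contra h0
            have hp := lt_of_le_of_ne (hW _ g) (Ne.symm h0)
            exact absurd (hno g (Finset.mem_univ _))
              (not_le.2 (mul_lt_mul_of_pos_left (lower i g) hp))
          have := tot m
          simp [hz] at this
  have h5 : (m + 1 : ℝ) * (δ / 4 * P.card) <
      ∑ i, ∑ g : Fin (m + 1) → κ, (∏ j, μ (g j)) * (S i g : ℝ) := by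
    have : (m + 1 : ℝ) * (δ / 4 * P.card) = ∑ _i : Fin (m + 1), (δ / 4 * P.card : ℝ) := by
      simp
    rw [this]
    exact Finset.sum_lt_sum_of_nonempty Finset.univ_nonempty fun i _ => low2 i
  have hn' : (0 : ℝ) < P.card := by exact_mod_cast hn
  nlinarith

theorem exists_mem_open_notMem_submodules {W κ : Type*} [NormedAddCommGroup W] [NormedSpace ℝ W]
    [FiniteDimensional ℝ W] (U : Set W) (hU : IsOpen U) (hne : U.Nonempty) (s : Finset κ)
    (L : κ → Submodule ℝ W) (hL : ∀ i ∈ s, L i ≠ ⊤) : ∃ v ∈ U, ∀ i ∈ s, v ∉ L i := by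
  let : MeasurableSpace W := borel W
  have : BorelSpace W := ⟨rfl⟩
  let μ : MeasureTheory.Measure W := MeasureTheory.Measure.addHaar
  by_contra hcon
  push Not at hcon
  have h0 : μ (⋃ i ∈ s, (L i : Set W)) = 0 := by
    refine (MeasureTheory.measure_biUnion_null_iff s.countable_toSet).2 ?_
    exact fun i hi => MeasureTheory.Measure.addHaar_submodule μ (L i) (hL i hi)
  have h1 : U ⊆ ⋃ i ∈ s, (L i : Set W) := by
    intro v hv
    obtain ⟨i, hi, h⟩ := hcon v hv
    exact Set.mem_biUnion hi h
  exact (hU.measure_pos μ hne).ne' (MeasureTheory.measure_mono_null h1 h0)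

theorem span_image_ne_top {W ι : Type*} [AddCommGroup W] [Module ℝ W]
    (y : ι → W) (T : Finset ι) (hT : T.card < Module.finrank ℝ W) :
    Submodule.span ℝ (y '' T) ≠ ⊤ := by
  intro h
  have h1 := finrank_span_finset_le_card (R := ℝ) (T.image y)
  rw [Finset.coe_image, Set.finrank, h, finrank_top] at h1
  have := Finset.card_image_le (s := T) (f := y)
  omega

theorem span_image_eq_top {W ι : Type*} [AddCommGroup W] [Module ℝ W] [FiniteDimensional ℝ W]
    (y : ι → W) (T : Finset ι) (h : LinearIndepOn ℝ y (T : Set ι))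
    (hT : T.card = Module.finrank ℝ W) : Submodule.span ℝ (y '' T) = ⊤ := by
  rw [Set.image_eq_range]
  exact LinearIndependent.span_eq_top_of_card_eq_finrank' h (by simpa using hT)

theorem exists_generic_family {W ι : Type*} [DecidableEq ι] [NormedAddCommGroup W] [NormedSpace ℝ W]
    [FiniteDimensional ℝ W] (i0 : ι) (w0 : W) (hw0 : w0 ≠ 0) (U : ι → Set W)
    (hU : ∀ i, IsOpen (U i)) (hne : ∀ i, (U i).Nonempty) (s : Finset ι) (hs : i0 ∉ s) :
    ∃ y : ι → W, y i0 = w0 ∧ (∀ i ∈ s, y i ∈ U i) ∧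
      ∀ T ⊆ insert i0 s, T.card ≤ Module.finrank ℝ W → LinearIndepOn ℝ y (T : Set ι) := by
  induction s using Finset.induction_on with
  | empty =>
    refine ⟨fun _ => w0, rfl, by simp, fun T hT _ => ?_⟩
    have : LinearIndepOn ℝ (fun _ : ι => w0) {i0} := LinearIndepOn.singleton (v := fun _ : ι => w0) hw0
    exact this.mono (by simpa [Set.subset_def] using fun i hi => Finset.mem_singleton.1 (hT hi))
  | insert j s hj ih =>
    have hs' : i0 ∉ s := fun h => hs (Finset.mem_insert_of_mem h)
    have hij : i0 ≠ j := fun h => hs (h ▸ Finset.mem_insert_self _ _)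
    obtain ⟨y, h0, h1, h2⟩ := ih hs'
    obtain ⟨v, hv, hvL⟩ := exists_mem_open_notMem_submodules (U j) (hU j) (hne j)
      ((insert i0 s).powerset.filter fun T => T.card < Module.finrank ℝ W)
      (fun T => Submodule.span ℝ (y '' T)) (by
        intro T hT
        exact span_image_ne_top y T (Finset.mem_filter.1 hT).2)
    have heq : Set.EqOn y (Function.update y j v) ((insert i0 s : Finset ι) : Set ι) := by
      intro i hi
      rw [Function.update_of_ne]
      rintro rfl
      rcases Finset.mem_insert.1 hi with h | h
      · exact hij h.symm
      · exact hj h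
    refine ⟨Function.update y j v, by rw [Function.update_of_ne hij, h0], ?_, ?_⟩
    · intro i hi
      rcases Finset.mem_insert.1 hi with rfl | h
      · simpa using hv
      · rw [← heq (Finset.mem_insert_of_mem h)]
        exact h1 i h
    · intro T hT hcard
      rw [Finset.insert_comm, Finset.subset_insert_iff] at hT
      by_cases hjT : j ∈ T
      · have hc : (T.erase j).card < Module.finrank ℝ W := by
          rw [Finset.card_erase_of_mem hjT]
          have := Finset.card_pos.2 ⟨j, hjT⟩
          omega
        rw [← Finset.insert_erase hjT, Finset.coe_insert, linearIndepOn_insert (by simp)]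
        have heq' : Set.EqOn y (Function.update y j v) (T.erase j : Finset ι) :=
          heq.mono (by exact_mod_cast hT)
        refine ⟨(linearIndepOn_congr heq').1 (h2 _ hT hc.le), ?_⟩
        rw [← heq'.image_eq, Function.update_self]
        exact hvL _ (Finset.mem_filter.2 ⟨Finset.mem_powerset.2 hT, hc⟩)
      · rw [Finset.erase_eq_of_notMem hjT] at hT
        exact (linearIndepOn_congr (heq.mono (by exact_mod_cast hT))).1 (h2 _ hT hcard)

/-- Signed evaluation of the affine form with normal `y.1` and offset `y.2`. -/
def ev {d : ℕ} (y : EuclideanSpace ℝ (Fin d) × ℝ) (x : EuclideanSpace ℝ (Fin d)) : ℝ :=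
  ⟪x, y.1⟫ - y.2

/-- A family of hyperplanes is simple: any `d` normals are independent, and no point lies on more
than `d` hyperplanes. -/
def SimpleArr {d : ℕ} {ι : Type*} (y : ι → EuclideanSpace ℝ (Fin d) × ℝ) : Prop :=
  (∀ T : Finset ι, T.card ≤ d → LinearIndepOn ℝ (fun i => (y i).1) (T : Set ι)) ∧
    ∀ (T : Finset ι) (x : EuclideanSpace ℝ (Fin d)), (∀ i ∈ T, ev (y i) x = 0) → T.card ≤ d

/-- `x` as a linear functional on the space of hyperplanes. -/
def evDual {d : ℕ} (x : EuclideanSpace ℝ (Fin d)) :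
    Module.Dual ℝ (EuclideanSpace ℝ (Fin d) × ℝ) where
  toFun y := ev y x
  map_add' y z := by simp [ev, inner_add_right]; ring
  map_smul' c y := by simp [ev, inner_smul_right]; ring

theorem continuous_ev {d : ℕ} (x : EuclideanSpace ℝ (Fin d)) :
    Continuous fun y : EuclideanSpace ℝ (Fin d) × ℝ => ev y x := by
  unfold ev; fun_prop

theorem exists_simple_perturbation {d : ℕ} {ι : Type*} [Fintype ι]
    (P : Finset (EuclideanSpace ℝ (Fin d))) (y₀ : ι → EuclideanSpace ℝ (Fin d) × ℝ)
    (h₀ : ∀ i, ∀ p ∈ P, ev (y₀ i) p ≠ 0) :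
    ∃ y : ι → EuclideanSpace ℝ (Fin d) × ℝ, SimpleArr y ∧
      ∀ i, ∀ p ∈ P, ev (y i) p ≠ 0 ∧ (0 < ev (y i) p ↔ 0 < ev (y₀ i) p) := by
  let X := EuclideanSpace ℝ (Fin d)
  have hfr : Module.finrank ℝ (X × ℝ) = d + 1 := by simp [X]
  obtain ⟨y, hy0, hyU, hyL⟩ := exists_generic_family (W := X × ℝ) (none : Option ι) (0, 1)
    (by simp) (fun i => i.elim Set.univ
      fun i => ⋂ p ∈ P, {y | 0 < ev y p * ev (y₀ i) p})
    (by
      rintro (_ | i)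
      · exact isOpen_univ
      · refine P.finite_toSet.isOpen_biInter fun p _ => ?_
        exact isOpen_lt continuous_const ((continuous_ev p).mul continuous_const))
    (by
      rintro (_ | i)
      · exact Set.univ_nonempty
      · exact ⟨y₀ i, by
          simp only [Option.elim_some, Set.mem_iInter, Set.mem_ofPred_eq]
          exact fun p hp => mul_self_pos.2 (h₀ i p hp)⟩)
    (Finset.univ.image some) (by simp)
  have hall : ∀ T : Finset (Option ι), T ⊆ insert none (Finset.univ.image some) := by
    rintro T (_ | i) _ <;> simp
  refine ⟨fun i => y (some i), ⟨fun T hT => ?_, fun T x hx => ?_⟩, fun i p hp => ?_⟩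
  · have h := hyL (insert none (T.image some)) (hall _) (by
      rw [hfr]
      refine (Finset.card_insert_le _ _).trans (Nat.succ_le_succ ?_)
      exact Finset.card_image_le.trans hT)
    rw [Finset.coe_insert, linearIndepOn_insert (by simp), hy0] at h
    obtain ⟨h1, h2⟩ := h
    rw [linearIndepOn_iff']
    intro s g hs hg i hi
    have e : ∑ i ∈ s, g i • y (some i) = (∑ i ∈ s, g i * (y (some i)).2) • ((0, 1) : X × ℝ) := by
      ext1
      · simpa [Prod.fst_sum] using hg
      · simp [Prod.snd_sum]
    have hmem : ∑ i ∈ s, g i • y (some i) ∈ Submodule.span ℝ (y '' ↑(T.image some)) := by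
      refine Submodule.sum_mem _ fun i hi => Submodule.smul_mem _ _ (Submodule.subset_span ?_)
      exact ⟨some i, by simpa using hs hi, rfl⟩
    have hc : ∑ i ∈ s, g i * (y (some i)).2 = 0 := by
      by_contra hc
      rw [e, Submodule.smul_mem_iff _ hc] at hmem
      exact h2 hmem
    rw [hc, zero_smul] at e
    rw [Finset.coe_image] at h1
    have h4 : LinearIndepOn ℝ (fun i => y (some i)) (T : Set ι) :=
      h1.comp_of_image (Set.injOn_of_injective (Option.some_injective ι))
    rw [linearIndepOn_iff'] at h4
    exact h4 s g hs e i hi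
  · by_contra hc
    push Not at hc
    obtain ⟨T', hT', hc'⟩ := Finset.exists_subset_card_eq (Nat.succ_le_of_lt hc)
    have h := hyL (T'.image some) (hall _) (by
      rw [hfr]; exact Finset.card_image_le.trans hc'.le)
    have hspan : Submodule.span ℝ (y '' (T'.image some : Finset (Option ι))) = ⊤ := by
      refine span_image_eq_top y _ h ?_
      rw [hfr, Finset.card_image_of_injective _ (Option.some_injective ι), hc']
    have : ((0, 1) : X × ℝ) ∈ LinearMap.ker (evDual x) := by
      have hle : Submodule.span ℝ (y '' (T'.image some : Finset (Option ι))) ≤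
          LinearMap.ker (evDual x) := by
        rw [Submodule.span_le]
        rintro _ ⟨j, hj, rfl⟩
        obtain ⟨i, hi, rfl⟩ := Finset.mem_image.1 hj
        exact hx i (hT' hi)
      rw [hspan] at hle
      exact hle trivial
    have h6 : ev ((0, 1) : X × ℝ) x = 0 := this
    simp [ev] at h6
  · have := hyU (some i) (by simp)
    simp only [Option.elim_some, Set.mem_iInter, Set.mem_ofPred_eq] at this
    have := this p hp
    rcases pos_and_pos_or_neg_and_neg_of_mul_pos this with h | h
    · exact ⟨h.1.ne', by simp [h.1, h.2]⟩
    · exact ⟨h.1.ne, by simp [h.1.not_gt, h.2.not_gt]⟩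

theorem exists_orthogonal_inner_pos {X : Type*} [NormedAddCommGroup X] [InnerProductSpace ℝ X]
    [FiniteDimensional ℝ X] (L : Submodule ℝ X) (a : X) (ha : a ∉ L) :
    ∃ w, (∀ z ∈ L, ⟪w, z⟫ = 0) ∧ 0 < ⟪w, a⟫ := by
  by_contra hcon
  push Not at hcon
  apply ha
  rw [← Submodule.orthogonal_orthogonal L, Submodule.mem_orthogonal]
  intro w hw
  have hw' : ∀ z ∈ L, ⟪w, z⟫ = 0 := fun z hz => by
    rw [real_inner_comm]; exact (Submodule.mem_orthogonal L w).1 hw z hz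
  refine le_antisymm (hcon w hw') ?_
  have := hcon (-w) (fun z hz => by rw [inner_neg_left, hw' z hz, neg_zero])
  rw [inner_neg_left] at this
  linarith

theorem eq_zero_of_span_eq_top {X : Type*} [NormedAddCommGroup X] [InnerProductSpace ℝ X]
    (S : Set X) (hS : Submodule.span ℝ S = ⊤) (w : X) (hw : ∀ a ∈ S, ⟪w, a⟫ = 0) : w = 0 := by
  have h : Submodule.span ℝ S ≤ LinearMap.ker (innerSL ℝ w : X →L[ℝ] ℝ).toLinearMap :=
    Submodule.span_le.2 fun a ha => by simpa using hw a ha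
  rw [hS] at h
  have : ⟪w, w⟫ = 0 := by simpa using h (Submodule.mem_top (x := w))
  exact inner_self_eq_zero.1 this

theorem ev_add_smul {d : ℕ} (y : EuclideanSpace ℝ (Fin d) × ℝ) (v w : EuclideanSpace ℝ (Fin d))
    (t : ℝ) : ev y (v + t • w) = ev y v + t * ⟪w, y.1⟫ := by
  simp only [ev, inner_add_left, real_inner_smul_left]; ring

theorem continuous_ev_right {d : ℕ} (y : EuclideanSpace ℝ (Fin d) × ℝ) : Continuous (ev y) := by
  unfold ev; fun_prop

theorem SimpleArr.span_eq_top {d : ℕ} {ι : Type*} {y : ι → EuclideanSpace ℝ (Fin d) × ℝ}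
    (hy : SimpleArr y) (T : Finset ι) (hT : T.card = d) :
    Submodule.span ℝ ((fun i => (y i).1) '' T) = ⊤ :=
  span_image_eq_top _ T (hy.1 T hT.le) (by simpa using hT)

theorem exists_dual_direction {d : ℕ} {ι : Type*} [DecidableEq ι]
    {y : ι → EuclideanSpace ℝ (Fin d) × ℝ}
    (hy : SimpleArr y) (T : Finset ι) (hT : T.card ≤ d) (h : ι) (hh : h ∈ T) :
    ∃ w, (∀ i ∈ T, i ≠ h → ⟪w, (y i).1⟫ = 0) ∧ ⟪w, (y h).1⟫ = 1 := by
  have h1 := hy.1 T hT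
  rw [← Finset.insert_erase hh, Finset.coe_insert, linearIndepOn_insert (by simp)] at h1
  obtain ⟨w, hw, hw1⟩ := exists_orthogonal_inner_pos _ _ h1.2
  refine ⟨(⟪w, (y h).1⟫)⁻¹ • w, fun i hi hne => ?_, ?_⟩
  · rw [real_inner_smul_left, hw _ (Submodule.subset_span ⟨i, by simp [hi, hne], rfl⟩), mul_zero]
  · rw [real_inner_smul_left, inv_mul_cancel₀ hw1.ne']

theorem exists_generic_objective {d : ℕ} {ι : Type*} [Fintype ι]
    {y : ι → EuclideanSpace ℝ (Fin d) × ℝ} (hy : SimpleArr y) (box : Fin d ↪ ι) :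
    ∃ c : Fin d → ℝ, (∀ j, 0 < c j) ∧ ∀ J : Finset ι, J.card < d →
      ∑ j, c j • (y (box j)).1 ∉ Submodule.span ℝ ((fun i => (y i).1) '' J) := by
  have hspan := hy.span_eq_top (Finset.univ.map box) (by simp)
  rw [Finset.coe_map, Set.image_image, Finset.coe_univ, Set.image_univ] at hspan
  let Φ := Fintype.linearCombination ℝ (fun j => (y (box j)).1)
  have hΦ : LinearMap.range Φ = ⊤ := by rw [Fintype.range_linearCombination, hspan]
  obtain ⟨c, hc, hcL⟩ := exists_mem_open_notMem_submodules {c : Fin d → ℝ | ∀ j, 0 < c j}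
    (by
      simp only [Set.ofPred_forall]
      exact isOpen_iInter_of_finite fun j => isOpen_lt continuous_const (continuous_apply j))
    ⟨fun _ => 1, fun _ => one_pos⟩
    ((Finset.univ : Finset (Finset ι)).filter fun J => J.card < d)
    (fun J => (Submodule.span ℝ ((fun i => (y i).1) '' (J : Set ι))).comap Φ)
    (by
      intro J hJ h
      rw [← LinearMap.range_le_iff_comap, hΦ, top_le_iff] at h
      exact span_image_ne_top _ J (by simpa using (Finset.mem_filter.1 hJ).2) h)
  refine ⟨c, hc, fun J hJ hmem => hcL J (by simpa using hJ) ?_⟩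
  rw [Submodule.mem_comap]
  exact hmem

theorem exists_cell_minimizer {d : ℕ} {ι : Type*} [Fintype ι]
    {y : ι → EuclideanSpace ℝ (Fin d) × ℝ} (hy : SimpleArr y) (box : Fin d ↪ ι)
    (c : Fin d → ℝ) (hc : ∀ j, 0 < c j) (p : EuclideanSpace ℝ (Fin d))
    (hbox : ∀ j, 0 < ev (y (box j)) p) :
    ∃ v, (∀ i, 0 ≤ ev (y i) p * ev (y i) v) ∧ ∀ x, (∀ i, 0 ≤ ev (y i) p * ev (y i) x) →
      ⟪v, ∑ j, c j • (y (box j)).1⟫ ≤ ⟪x, ∑ j, c j • (y (box j)).1⟫ := by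
  set u := ∑ j, c j • (y (box j)).1 with hu
  let A : EuclideanSpace ℝ (Fin d) →ₗ[ℝ] (Fin d → ℝ) :=
    LinearMap.pi fun j => (innerSL ℝ (y (box j)).1 : _ →L[ℝ] ℝ).toLinearMap
  have hA : ∀ x j, A x j = ⟪x, (y (box j)).1⟫ := fun x j => by
    simp only [A, LinearMap.pi_apply]; exact real_inner_comm x (y (box j)).1
  have hker : LinearMap.ker A = ⊥ := by
    rw [LinearMap.ker_eq_bot']
    intro x hx
    have hspan := hy.span_eq_top (Finset.univ.map box) (by simp)
    refine eq_zero_of_span_eq_top _ hspan x ?_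
    rintro _ ⟨i, hi, rfl⟩
    obtain ⟨j, -, rfl⟩ := Finset.mem_map.1 (Finset.mem_coe.1 hi)
    rw [← hA, hx]; rfl
  have hux : ∀ x, ⟪x, u⟫ = ∑ j, c j * A x j := by
    intro x
    simp only [hu, inner_sum, real_inner_smul_right, hA]
  let C : Set (EuclideanSpace ℝ (Fin d)) := {x | (∀ i, 0 ≤ ev (y i) p * ev (y i) x)}
  have hCcl : IsClosed C := by
    simp only [C, Set.ofPred_forall]
    exact isClosed_iInter fun i =>
      isClosed_le continuous_const (continuous_const.mul (continuous_ev_right _))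
  let K : Set (EuclideanSpace ℝ (Fin d)) := C ∩ {x | ⟪x, u⟫ ≤ ⟪p, u⟫}
  have hKcl : IsClosed K := hCcl.inter (isClosed_le (by fun_prop) continuous_const)
  let lo : Fin d → ℝ := fun j => (y (box j)).2
  let hi : Fin d → ℝ := fun j => (⟪p, u⟫ - ∑ i ∈ Finset.univ.erase j, c i * lo i) / c j
  have hlo : ∀ x ∈ C, ∀ j, lo j ≤ A x j := by
    intro x hx j
    have := nonneg_of_mul_nonneg_right (hx (box j)) (hbox j)
    rw [ev] at this
    rw [hA]
    simp only [lo]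
    linarith
  have hsub : K ⊆ A ⁻¹' (Set.Icc lo hi) := by
    intro x hx
    refine ⟨fun j => hlo x hx.1 j, fun j => ?_⟩
    have h1 : ⟪x, u⟫ ≤ ⟪p, u⟫ := hx.2
    rw [hux x, ← Finset.add_sum_erase _ _ (Finset.mem_univ j)] at h1
    have h2 : ∑ i ∈ Finset.univ.erase j, c i * lo i ≤ ∑ i ∈ Finset.univ.erase j, c i * A x i :=
      Finset.sum_le_sum fun i _ => mul_le_mul_of_nonneg_left (hlo x hx.1 i) (hc i).le
    simp only [hi]
    rw [le_div_iff₀ (hc j)]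
    linarith
  have hK : IsCompact K :=
    ((LinearMap.isClosedEmbedding_of_injective hker).isCompact_preimage
      isCompact_Icc).of_isClosed_subset hKcl hsub
  have hpK : p ∈ K := ⟨fun i => mul_self_nonneg _, le_refl (⟪p, u⟫ : ℝ)⟩
  obtain ⟨v, hv, hmin⟩ := hK.exists_isMinOn ⟨p, hpK⟩ (f := fun x => ⟪x, u⟫)
    (Continuous.continuousOn (by fun_prop))
  refine ⟨v, hv.1, fun x hx => ?_⟩
  by_cases hxu : ⟪x, u⟫ ≤ ⟪p, u⟫
  · exact hmin ⟨hx, hxu⟩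
  · exact hv.2.trans (not_le.1 hxu).le

theorem exists_bottom_vertex {d : ℕ} {ι : Type*} [Fintype ι] [DecidableEq ι]
    {y : ι → EuclideanSpace ℝ (Fin d) × ℝ} (hy : SimpleArr y) (u : EuclideanSpace ℝ (Fin d))
    (hu : ∀ J : Finset ι, J.card < d → u ∉ Submodule.span ℝ ((fun i => (y i).1) '' J))
    (p v : EuclideanSpace ℝ (Fin d)) (hp : ∀ i, ev (y i) p ≠ 0)
    (hv : ∀ i, 0 ≤ ev (y i) p * ev (y i) v)
    (hmin : ∀ x, (∀ i, 0 ≤ ev (y i) p * ev (y i) x) → ⟪v, u⟫ ≤ ⟪x, u⟫) :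
    ∃ T : Finset ι, T.card = d ∧ (∀ i ∈ T, ev (y i) v = 0) ∧
      (∀ i, i ∉ T → ev (y i) v ≠ 0 ∧ (0 < ev (y i) v ↔ 0 < ev (y i) p)) ∧
      ∀ h ∈ T, ∀ w, (∀ i ∈ T, i ≠ h → ⟪w, (y i).1⟫ = 0) → 0 < ⟪w, (y h).1⟫ →
        (0 < ev (y h) p ↔ 0 < ⟪w, u⟫) := by
  set T : Finset ι := Finset.univ.filter fun i => ev (y i) v = 0 with hT
  have hmem : ∀ i, i ∈ T ↔ ev (y i) v = 0 := fun i => by simp [hT]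
  have hTd : T.card ≤ d := hy.2 T v fun i hi => (hmem i).1 hi
  have opt : ∀ w, (∀ i ∈ T, 0 ≤ ev (y i) p * ⟪w, (y i).1⟫) → 0 ≤ ⟪w, u⟫ := by
    intro w hw
    by_contra hneg
    push Not at hneg
    have hev : ∀ᶠ t in nhdsWithin (0 : ℝ) (Set.Ioi 0),
        ∀ i, 0 ≤ ev (y i) p * ev (y i) (v + t • w) := by
      rw [Filter.eventually_all]
      intro i
      by_cases hi : i ∈ T
      · filter_upwards [self_mem_nhdsWithin] with t ht
        rw [ev_add_smul, (hmem i).1 hi, zero_add, mul_left_comm]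
        exact mul_nonneg (le_of_lt ht) (hw i hi)
      · have hpos : 0 < ev (y i) p * ev (y i) v :=
          lt_of_le_of_ne (hv i) (mul_ne_zero (hp i) (fun h => hi ((hmem i).2 h))).symm
        have hcont : Continuous fun t : ℝ => ev (y i) p * ev (y i) (v + t • w) :=
          continuous_const.mul ((continuous_ev_right _).comp (by fun_prop))
        have h0 : 0 < ev (y i) p * ev (y i) (v + (0 : ℝ) • w) := by simpa using hpos
        exact ((hcont.tendsto 0).eventually (lt_mem_nhds h0)).filter_mono nhdsWithin_le_nhds
          |>.mono fun t ht => le_of_lt ht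
    obtain ⟨t, ht, ht0⟩ := (hev.and self_mem_nhdsWithin).exists
    have := hmin _ ht
    rw [inner_add_left, real_inner_smul_left] at this
    have h1 : t * ⟪w, u⟫ < 0 := mul_neg_of_pos_of_neg ht0 hneg
    linarith
  have hcard : T.card = d := by
    by_contra hne
    obtain ⟨w, hw, hw1⟩ := exists_orthogonal_inner_pos _ _ (hu T (lt_of_le_of_ne hTd hne))
    have := opt (-w) fun i hi => by
      rw [inner_neg_left, hw _ (Submodule.subset_span ⟨i, hi, rfl⟩)]; simp
    rw [inner_neg_left] at this
    linarith
  refine ⟨T, hcard, fun i hi => (hmem i).1 hi, fun i hi => ?_, ?_⟩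
  · have h0 : ev (y i) v ≠ 0 := fun h => hi ((hmem i).2 h)
    have hpos : 0 < ev (y i) p * ev (y i) v := lt_of_le_of_ne (hv i) (mul_ne_zero (hp i) h0).symm
    refine ⟨h0, ?_⟩
    rcases pos_and_pos_or_neg_and_neg_of_mul_pos hpos with h | h
    · simp [h.1, h.2]
    · simp [h.1.not_gt, h.2.not_gt]
  · intro h hh w hw hwh
    have hne : ⟪w, u⟫ ≠ 0 := by
      intro h0
      have hlt : (T.erase h).card < d := by
        rw [← hcard]; exact Finset.card_erase_lt_of_mem hh
      obtain ⟨w', hw', hw1⟩ := exists_orthogonal_inner_pos _ _ (hu (T.erase h) hlt)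
      have hz : ⟪w, (y h).1⟫ • w' - ⟪w', (y h).1⟫ • w = 0 := by
        refine eq_zero_of_span_eq_top _ (hy.span_eq_top T hcard) _ ?_
        rintro _ ⟨i, hi, rfl⟩
        rw [inner_sub_left, real_inner_smul_left, real_inner_smul_left]
        by_cases hih : i = h
        · subst hih; ring
        · rw [hw i hi hih, hw' _ (Submodule.subset_span ⟨i, by
            rw [Finset.mem_coe, Finset.mem_erase]; exact ⟨hih, hi⟩, rfl⟩)]
          simp
      have := congrArg (fun z => ⟪z, u⟫) hz
      simp only [inner_sub_left, real_inner_smul_left, h0, inner_zero_left, mul_zero,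
        sub_zero] at this
      exact (mul_pos hwh hw1).ne' this
    rcases lt_or_gt_of_ne (hp h) with hneg | hpos
    · have := opt (-w) fun i hi => by
        rw [inner_neg_left]
        by_cases hih : i = h
        · subst hih; nlinarith
        · rw [hw i hi hih]; simp
      rw [inner_neg_left] at this
      constructor
      · intro h'; linarith
      · intro h'; linarith
    · have := opt w fun i hi => by
        by_cases hih : i = h
        · subst hih; positivity
        · rw [hw i hi hih]; simp
      exact ⟨fun _ => lt_of_le_of_ne this hne.symm, fun _ => hpos⟩

/-- Every cell meeting the positive side of the box hyperplanes gets a bottom vertex, and distinct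
cells get distinct bottom vertices. -/
theorem exists_bottom_map {d : ℕ} {ι : Type*} [Fintype ι] [DecidableEq ι]
    {y : ι → EuclideanSpace ℝ (Fin d) × ℝ} (hy : SimpleArr y) (box : Fin d ↪ ι)
    (P : Finset (EuclideanSpace ℝ (Fin d))) (hP : ∀ p ∈ P, ∀ i, ev (y i) p ≠ 0)
    (hbox : ∀ p ∈ P, ∀ j, 0 < ev (y (box j)) p) :
    ∃ B : EuclideanSpace ℝ (Fin d) → Finset ι,
      (∀ p ∈ P, (B p).card = d ∧ ∃ v, (∀ i ∈ B p, ev (y i) v = 0) ∧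
        ∀ i, i ∉ B p → ev (y i) v ≠ 0 ∧ (0 < ev (y i) v ↔ 0 < ev (y i) p)) ∧
      ∀ p ∈ P, ∀ q ∈ P, B p = B q → ∀ i, (0 < ev (y i) p ↔ 0 < ev (y i) q) := by
  obtain ⟨c, hc, hu⟩ := exists_generic_objective hy box
  set u := ∑ j, c j • (y (box j)).1
  have key : ∀ p, ∃ T : Finset ι, p ∈ P → T.card = d ∧ ∃ v, (∀ i ∈ T, ev (y i) v = 0) ∧
      (∀ i, i ∉ T → ev (y i) v ≠ 0 ∧ (0 < ev (y i) v ↔ 0 < ev (y i) p)) ∧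
      ∀ h ∈ T, ∀ w, (∀ i ∈ T, i ≠ h → ⟪w, (y i).1⟫ = 0) → 0 < ⟪w, (y h).1⟫ →
        (0 < ev (y h) p ↔ 0 < ⟪w, u⟫) := by
    intro p
    by_cases hp : p ∈ P
    · obtain ⟨v, hv, hmin⟩ := exists_cell_minimizer hy box c hc p (hbox p hp)
      obtain ⟨T, h1, h2, h3, h4⟩ := exists_bottom_vertex hy u hu p v (hP p hp) hv hmin
      exact ⟨T, fun _ => ⟨h1, v, h2, h3, h4⟩⟩
    · exact ⟨∅, fun h => absurd h hp⟩
  choose B hB using key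
  refine ⟨B, fun p hp => ?_, fun p hp q hq hpq i => ?_⟩
  · obtain ⟨h1, v, h2, h3, -⟩ := hB p hp
    exact ⟨h1, v, h2, h3⟩
  · obtain ⟨h1, v, h2, h3, h4⟩ := hB p hp
    obtain ⟨h1', v', h2', h3', h4'⟩ := hB q hq
    rw [← hpq] at h2' h3' h4'
    by_cases hi : i ∈ B p
    · obtain ⟨w, hw, hw1⟩ := exists_dual_direction hy (B p) h1.le i hi
      have hw2 : 0 < ⟪w, (y i).1⟫ := by rw [hw1]; exact one_pos
      rw [h4 i hi w hw hw2, h4' i hi w hw hw2]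
    · have hvv : v = v' := by
        rw [← sub_eq_zero]
        refine eq_zero_of_span_eq_top _ (hy.span_eq_top (B p) h1) _ ?_
        rintro _ ⟨j, hj, rfl⟩
        have a1 := h2 j hj
        have a2 := h2' j hj
        rw [ev] at a1 a2
        rw [inner_sub_left]
        linarith
      subst hvv
      rw [← (h3 i hi).2, (h3' i hi).2]

/-- A finite indexed family of points each of which is strictly minimal for some functional. -/
def ConvexPos {V α : Type*} [AddCommGroup V] [Module ℝ V] (Q : Finset α) (pt : α → V) : Prop :=
  ∀ q ∈ Q, ∃ φ : Module.Dual ℝ V, ∀ q' ∈ Q, q' ≠ q → φ (pt q) < φ (pt q')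

theorem ConvexPos.exists_edge {V α : Type*} [AddCommGroup V] [Module ℝ V] [FiniteDimensional ℝ V]
    {Q : Finset α} {pt : α → V} (hQ : ConvexPos Q pt) (q : α) (hq : q ∈ Q) (hne : 1 < Q.card) :
    ∃ r ∈ Q, r ≠ q ∧ ∃ ψ : Module.Dual ℝ V, ψ (pt r) = ψ (pt q) ∧
      ∀ q' ∈ Q, q' ≠ q → q' ≠ r → ψ (pt q) < ψ (pt q') := by
  obtain ⟨φ, hφ⟩ := hQ q hq
  let x : α → V := fun q' => pt q' - pt q
  have hx : ∀ q' ∈ Q, q' ≠ q → 0 < φ (x q') := fun q' h1 h2 => by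
    simp only [x, map_sub]; linarith [hφ q' h1 h2]
  have notbetween : ∀ a ∈ Q, ∀ b ∈ Q, a ≠ q → a ≠ b → φ (x a) ≤ φ (x b) →
      φ (x a) • x b - φ (x b) • x a ≠ 0 := by
    intro a ha b hb haq hab hle h0
    obtain ⟨χ, hχ⟩ := hQ a ha
    have h1 := hχ q hq haq.symm
    have h2 := hχ b hb hab.symm
    have h3 := congrArg χ h0
    have ha0 := hx a ha haq
    simp only [map_sub, map_smul, smul_eq_mul, map_zero, x] at h3 ha0 hle
    nlinarith
  have hpar : ∀ a ∈ Q.erase q, ∀ b ∈ Q.erase q, a ≠ b → φ (x a) • x b - φ (x b) • x a ≠ 0 := by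
    intro a ha b hb hab
    rw [Finset.mem_erase] at ha hb
    rcases le_total (φ (x a)) (φ (x b)) with h | h
    · exact notbetween a ha.2 b hb.2 ha.1 hab h
    · have := notbetween b hb.2 a ha.2 hb.1 hab.symm h
      rwa [← neg_ne_zero, neg_sub] at this
  obtain ⟨c, hc⟩ := Module.exists_dual_forall_apply_ne_zero (K := ℝ)
    (fun i : {i : α × α // i ∈ ((Q.erase q) ×ˢ (Q.erase q)).filter fun i => i.1 ≠ i.2} =>
      φ (x i.1.1) • x i.1.2 - φ (x i.1.2) • x i.1.1)
    (fun i => by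
      have h1 := Finset.mem_filter.1 i.2
      have h2 := Finset.mem_product.1 h1.1
      exact hpar _ h2.1 _ h2.2 h1.2)
  have hQne : (Q.erase q).Nonempty := by
    rw [← Finset.card_pos, Finset.card_erase_of_mem hq]; omega
  obtain ⟨r, hr, hmin⟩ := Finset.exists_min_image (Q.erase q) (fun a => c (x a) / φ (x a)) hQne
  have hr' := Finset.mem_erase.1 hr
  have hr0 := hx r hr'.2 hr'.1
  refine ⟨r, hr'.2, hr'.1, φ (x r) • c - c (x r) • φ, ?_, fun q' hq' h1 h2 => ?_⟩
  · have : (φ (x r) • c - c (x r) • φ) (x r) = 0 := by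
      simp; ring
    have h4 : pt r = x r + pt q := by simp [x]
    rw [h4, map_add, this, zero_add]
  · have hm : q' ∈ Q.erase q := Finset.mem_erase.2 ⟨h1, hq'⟩
    have h0 := hx q' hq' h1
    have h3 := hmin q' hm
    rw [div_le_div_iff₀ hr0 h0] at h3
    have h5 := hc ⟨(r, q'),
      Finset.mem_filter.2 ⟨Finset.mem_product.2 ⟨hr, hm⟩, h2.symm⟩⟩
    simp only [map_sub, map_smul, smul_eq_mul] at h5
    have h6 : 0 < (φ (x r) • c - c (x r) • φ) (x q') := by
      simp only [LinearMap.sub_apply, LinearMap.smul_apply, smul_eq_mul]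
      refine lt_of_le_of_ne (by linarith) (Ne.symm ?_)
      intro h7; apply h5; linarith
    have h4 : pt q' = x q' + pt q := by simp [x]
    rw [h4, map_add]
    linarith

theorem exists_generic_offsets {V α ι : Type*} [AddCommGroup V] [Module ℝ V]
    [DecidableEq ι] (Q : Finset α) (pt : α → V) (φ : ι → Module.Dual ℝ V) (b : ι → ℝ)
    (R : Finset ι) (hoff : ∀ q ∈ Q, ∀ i ∈ R, φ i (pt q) ≠ b i) :
    ∃ b' : ι → ℝ, (∀ i ∈ R, ∀ q ∈ Q, φ i (pt q) ≠ b' i ∧ (b' i < φ i (pt q) ↔ b i < φ i (pt q))) ∧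
      ∀ i ∈ R, ∀ j ∈ R, i ≠ j → ∀ q ∈ Q, ∀ q' ∈ Q, φ i (pt q') ≠ φ i (pt q) →
        φ j (pt q') ≠ φ j (pt q) → ∀ t : ℝ,
        φ i (pt q) + t * (φ i (pt q') - φ i (pt q)) = b' i →
        φ j (pt q) + t * (φ j (pt q') - φ j (pt q)) ≠ b' j := by
  induction R using Finset.induction_on with
  | empty => exact ⟨b, by simp, by simp⟩
  | insert i s hi ih =>
    obtain ⟨b', h1, h2⟩ := ih fun q hq j hj => hoff q hq j (Finset.mem_insert_of_mem hj)
    let U : Set ℝ := ⋂ q ∈ Q, {x | 0 < (φ i (pt q) - b i) * (φ i (pt q) - x)}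
    have hU : IsOpen U := Q.finite_toSet.isOpen_biInter fun q _ =>
      isOpen_lt continuous_const (by fun_prop)
    have hbU : b i ∈ U := by
      simp only [U, Set.mem_iInter, Set.mem_ofPred_eq]
      exact fun q hq => mul_self_pos.2
        (sub_ne_zero.2 (hoff q hq i (Finset.mem_insert_self _ _)))
    let F : Finset ℝ := (s ×ˢ Q ×ˢ Q).image fun p =>
      φ i (pt p.2.1) + (b' p.1 - φ p.1 (pt p.2.1)) / (φ p.1 (pt p.2.2) - φ p.1 (pt p.2.1)) *
        (φ i (pt p.2.2) - φ i (pt p.2.1))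
    obtain ⟨x, hxU, hxF⟩ := (infinite_of_mem_nhds (b i) (hU.mem_nhds hbU)).exists_notMem_finset F
    have hxi : ∀ j ∈ s, Function.update b' i x j = b' j := fun j hj => by
      rw [Function.update_of_ne]; rintro rfl; exact hi hj
    have hself : Function.update b' i x i = x := Function.update_self ..
    have main : ∀ j ∈ s, ∀ q ∈ Q, ∀ q' ∈ Q, φ j (pt q') ≠ φ j (pt q) → ∀ t : ℝ,
        φ i (pt q) + t * (φ i (pt q') - φ i (pt q)) = x →
        φ j (pt q) + t * (φ j (pt q') - φ j (pt q)) ≠ b' j := by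
      intro j hj q hq q' hq' hne t ht htj
      apply hxF
      refine Finset.mem_image.2 ⟨(j, q, q'), by simp [hj, hq, hq'], ?_⟩
      have : (b' j - φ j (pt q)) / (φ j (pt q') - φ j (pt q)) = t := by
        rw [div_eq_iff (sub_ne_zero.2 hne)]; linarith
      simp only [this, ht]
    refine ⟨Function.update b' i x, fun j hj q hq => ?_, ?_⟩
    · rcases Finset.mem_insert.1 hj with rfl | hj
      · rw [hself]
        simp only [U, Set.mem_iInter, Set.mem_ofPred_eq] at hxU
        rcases pos_and_pos_or_neg_and_neg_of_mul_pos (hxU q hq) with h | h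
        · exact ⟨by intro h'; linarith, ⟨fun _ => by linarith, fun _ => by linarith⟩⟩
        · exact ⟨by intro h'; linarith, ⟨fun _ => by linarith, fun _ => by linarith⟩⟩
      · rw [hxi j hj]; exact h1 j hj q hq
    · intro j hj l hl hjl q hq q' hq' hnj hnl t ht
      rcases Finset.mem_insert.1 hj with hji | hjs <;>
        rcases Finset.mem_insert.1 hl with hli | hls
      · exact absurd (hji.trans hli.symm) hjl
      · rw [hji, hself] at ht
        rw [hxi l hls]
        exact main l hls q hq q' hq' hnl t ht
      · rw [hli, hself]
        rw [hxi j hjs] at ht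
        exact fun h => main j hjs q hq q' hq' hnj t h ht
      · rw [hxi l hls]
        rw [hxi j hjs] at ht
        exact h2 j hjs l hls hjl q hq q' hq' hnj hnl t ht

theorem ConvexPos.card_le_two {V α : Type*} [AddCommGroup V] [Module ℝ V]
    (hV : Module.finrank ℝ V = 1) {Q : Finset α} {pt : α → V} (hQ : ConvexPos Q pt) :
    Q.card ≤ 2 := by
  by_contra hc
  push Not at hc
  obtain ⟨v, -, hv⟩ := finrank_eq_one_iff'.1 hV
  choose c hcv using hv
  have key : ∀ q ∈ Q, (∀ q' ∈ Q, q' ≠ q → c (pt q) < c (pt q')) ∨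
      (∀ q' ∈ Q, q' ≠ q → c (pt q') < c (pt q)) := by
    intro q hq
    obtain ⟨φ, hφ⟩ := hQ q hq
    have e : ∀ x, φ x = c x * φ v := fun x => by
      calc φ x = φ (c x • v) := by rw [hcv x]
        _ = c x * φ v := by rw [map_smul, smul_eq_mul]
    have hφ : ∀ q' ∈ Q, q' ≠ q → c (pt q) * φ v < c (pt q') * φ v := fun q' h1 h2 => by
      rw [← e, ← e]; exact hφ q' h1 h2
    rcases lt_trichotomy (φ v) 0 with h | h | h
    · right; intro q' h1 h2; have := hφ q' h1 h2; nlinarith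
    · left; intro q' h1 h2; have := hφ q' h1 h2; simp [h] at this
    · left; intro q' h1 h2; have := hφ q' h1 h2; nlinarith
  obtain ⟨x, hx, y, hy, z, hz, hxy, hxz, hyz⟩ := Finset.two_lt_card.1 hc
  rcases key x hx with h1 | h1 <;> rcases key y hy with h2 | h2 <;> rcases key z hz with h3 | h3 <;>
  · have a1 := h1 y hy hxy.symm
    have a2 := h1 z hz hxz.symm
    have a3 := h2 x hx hxy
    have a4 := h2 z hz hyz.symm
    have a5 := h3 x hx hxz
    have a6 := h3 y hy hyz
    linarith

theorem ConvexPos.exists_first_crossing {V α ι : Type*} [AddCommGroup V] [Module ℝ V]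
    [FiniteDimensional ℝ V] {Q : Finset α} {pt : α → V} (hQ : ConvexPos Q pt)
    (R : Finset ι) (φ : ι → Module.Dual ℝ V) (b : ι → ℝ)
    (hoff : ∀ q ∈ Q, ∀ i ∈ R, φ i (pt q) ≠ b i)
    (hinj : ∀ q ∈ Q, ∀ q' ∈ Q, (∀ i ∈ R, (b i < φ i (pt q) ↔ b i < φ i (pt q'))) → q = q')
    (hgen : ∀ i ∈ R, ∀ j ∈ R, i ≠ j → ∀ q ∈ Q, ∀ q' ∈ Q, φ i (pt q') ≠ φ i (pt q) →
        φ j (pt q') ≠ φ j (pt q) → ∀ t : ℝ,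
        φ i (pt q) + t * (φ i (pt q') - φ i (pt q)) = b i →
        φ j (pt q) + t * (φ j (pt q') - φ j (pt q)) ≠ b j)
    (hcard : 1 < Q.card) (q : α) (hq : q ∈ Q) :
    ∃ h ∈ R, ∃ r ∈ Q, r ≠ q ∧ ∃ (ψ : Module.Dual ℝ V) (t : ℝ), 0 < t ∧ t < 1 ∧
      ψ (pt r) = ψ (pt q) ∧ (∀ q' ∈ Q, q' ≠ q → q' ≠ r → ψ (pt q) < ψ (pt q')) ∧
      φ h (pt q + t • (pt r - pt q)) = b h ∧ ¬ (b h < φ h (pt q) ↔ b h < φ h (pt r)) ∧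
      ∀ j ∈ R, j ≠ h → φ j (pt q + t • (pt r - pt q)) ≠ b j ∧
        (b j < φ j (pt q + t • (pt r - pt q)) ↔ b j < φ j (pt q)) := by
  obtain ⟨r, hr, hrq, ψ, hψ1, hψ2⟩ := hQ.exists_edge q hq hcard
  let τ : ι → ℝ := fun i => (b i - φ i (pt q)) / (φ i (pt r) - φ i (pt q))
  let S := R.filter fun i => ¬ (b i < φ i (pt q) ↔ b i < φ i (pt r))
  have hS : S.Nonempty := by
    by_contra hS
    rw [Finset.not_nonempty_iff_eq_empty, Finset.filter_eq_empty_iff] at hS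
    exact hrq (hinj q hq r hr fun i hi => not_not.1 (hS hi)).symm
  obtain ⟨h, hhS, hmin⟩ := Finset.exists_min_image S τ hS
  have hτ : ∀ i ∈ S, 0 < τ i ∧ τ i < 1 ∧ φ i (pt r) ≠ φ i (pt q) ∧
      b i - φ i (pt q) = τ i * (φ i (pt r) - φ i (pt q)) := by
    intro i hi
    obtain ⟨hiR, hi⟩ := Finset.mem_filter.1 hi
    have h1 := hoff q hq i hiR
    have h2 := hoff r hr i hiR
    by_cases h3 : b i < φ i (pt q)
    · have h4 : φ i (pt r) < b i := lt_of_le_of_ne (not_lt.1 (by tauto)) h2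
      refine ⟨div_pos_of_neg_of_neg (by linarith) (by linarith), ?_, by linarith, ?_⟩
      · rw [div_lt_one_of_neg (by linarith)]; linarith
      · rw [div_mul_cancel₀]; linarith
    · have h4 : φ i (pt q) < b i := lt_of_le_of_ne (not_lt.1 h3) h1
      have h5 : b i < φ i (pt r) := by tauto
      refine ⟨div_pos (by linarith) (by linarith), ?_, by linarith, ?_⟩
      · rw [div_lt_one (by linarith)]; linarith
      · rw [div_mul_cancel₀]; linarith
  obtain ⟨hhR, hhsep⟩ := Finset.mem_filter.1 hhS
  obtain ⟨t0, t1, hne, heq⟩ := hτ h hhS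
  have hval : ∀ j, φ j (pt q + τ h • (pt r - pt q))
      = φ j (pt q) + τ h * (φ j (pt r) - φ j (pt q)) := by
    intro j; simp
  refine ⟨h, hhR, r, hr, hrq, ψ, τ h, t0, t1, hψ1, hψ2, ?_, hhsep, fun j hj hjh => ?_⟩
  · rw [hval]; linarith
  · rw [hval]
    by_cases hjS : j ∈ S
    · obtain ⟨s0, s1, hnej, heqj⟩ := hτ j hjS
      have hle := hmin j hjS
      have hlt : τ h < τ j := by
        refine lt_of_le_of_ne hle fun he => ?_
        exact hgen h hhR j hj hjh.symm q hq r hr hne hnej (τ h) (by linarith)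
          (by rw [he]; linarith)
      rcases lt_or_gt_of_ne hnej with h5 | h5
      · have h6 : φ j (pt q) + τ h * (φ j (pt r) - φ j (pt q)) > b j := by nlinarith
        have h7 : b j < φ j (pt q) := by nlinarith
        exact ⟨h6.ne', by simp [h6, h7]⟩
      · have h6 : φ j (pt q) + τ h * (φ j (pt r) - φ j (pt q)) < b j := by nlinarith
        have h7 : φ j (pt q) < b j := by nlinarith
        exact ⟨h6.ne, by simp [h6.not_gt, h7.not_gt]⟩
    · have hsame : (b j < φ j (pt q) ↔ b j < φ j (pt r)) := by
        by_contra hc; exact hjS (Finset.mem_filter.2 ⟨hj, hc⟩)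
      have hq0 := hoff q hq j hj
      have hr0 := hoff r hr j hj
      by_cases h3 : b j < φ j (pt q)
      · have h4 := hsame.1 h3
        have h6 : φ j (pt q) + τ h * (φ j (pt r) - φ j (pt q)) > b j := by nlinarith
        exact ⟨h6.ne', by simp [h6, h3]⟩
      · have h3' : φ j (pt q) < b j := lt_of_le_of_ne (not_lt.1 h3) hq0
        have h4 : φ j (pt r) < b j := lt_of_le_of_ne (not_lt.1 (fun h => h3 (hsame.2 h))) hr0
        have h6 : φ j (pt q) + τ h * (φ j (pt r) - φ j (pt q)) < b j := by nlinarith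
        exact ⟨h6.ne, by simp [h6.not_gt, h3]⟩

/-- Points in convex position lying in distinct cells of `r` hyperplanes in dimension `e + 1`
number at most `2 ^ (e + 1) * (r + 1) ^ e`. -/
theorem ConvexPos.card_le {ι α : Type*} [DecidableEq ι] (e : ℕ) :
    ∀ {V : Type} [AddCommGroup V] [Module ℝ V] [FiniteDimensional ℝ V]
    (_ : Module.finrank ℝ V = e + 1) {Q : Finset α} {pt : α → V} (_ : ConvexPos Q pt)
    (R : Finset ι) (φ : ι → Module.Dual ℝ V) (b : ι → ℝ)
    (_ : ∀ q ∈ Q, ∀ i ∈ R, φ i (pt q) ≠ b i)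
    (_ : ∀ q ∈ Q, ∀ q' ∈ Q, (∀ i ∈ R, (b i < φ i (pt q) ↔ b i < φ i (pt q'))) → q = q'),
    Q.card ≤ 2 ^ (e + 1) * (R.card + 1) ^ e := by
  induction e with
  | zero => intro V _ _ _ hV Q pt hQ R φ b _ _; simpa using hQ.card_le_two hV
  | succ e ih =>
    intro V _ _ _ hV Q pt hQ R φ b₀ hoff₀ hinj₀
    obtain ⟨b, hb, hgen⟩ := exists_generic_offsets Q pt φ b₀ R hoff₀
    have hoff : ∀ q ∈ Q, ∀ i ∈ R, φ i (pt q) ≠ b i := fun q hq i hi => (hb i hi q hq).1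
    have hinj : ∀ q ∈ Q, ∀ q' ∈ Q, (∀ i ∈ R, (b i < φ i (pt q) ↔ b i < φ i (pt q'))) → q = q' :=
      fun q hq q' hq' h => hinj₀ q hq q' hq' fun i hi => by
        rw [← (hb i hi q hq).2, ← (hb i hi q' hq').2]; exact h i hi
    rcases le_or_gt Q.card 1 with hc | hc
    · exact hc.trans (Nat.succ_le_of_lt (by positivity))
    obtain ⟨q0, hq0⟩ : Q.Nonempty := Finset.card_pos.1 (by omega)
    obtain ⟨h0, -⟩ := hQ.exists_first_crossing R φ b hoff hinj hgen hc q0 hq0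
    have key := hQ.exists_first_crossing R φ b hoff hinj hgen hc
    have : Nonempty ι := ⟨h0⟩
    have : Nonempty α := ⟨q0⟩
    choose! h hR r hrQ hrq ψ t ht0 ht1 hψ1 hψ2 hh hsep hsgn using key
    let z : α → V := fun q => pt q + t q • (pt (r q) - pt q)
    have hmaps : ∀ q ∈ Q, (h q, decide (b (h q) < φ (h q) (pt q))) ∈
        R ×ˢ (Finset.univ : Finset Bool) := fun q hq =>
          Finset.mem_product.2 ⟨hR q hq, Finset.mem_univ _⟩
    refine (Finset.card_le_mul_card_image_of_maps_to hmaps (2 ^ (e + 1) * R.card ^ e) ?_).trans ?_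
    · rintro ⟨g, s⟩ hgs
      have hgR : g ∈ R := (Finset.mem_product.1 hgs).1
      set F := Q.filter fun q => (h q, decide (b (h q) < φ (h q) (pt q))) = (g, s) with hF
      have hmem : ∀ q ∈ F, q ∈ Q ∧ h q = g ∧ decide (b g < φ g (pt q)) = s := by
        intro q hq
        obtain ⟨h1, h2⟩ := Finset.mem_filter.1 hq
        rw [Prod.mk.injEq] at h2
        obtain ⟨h2, h3⟩ := h2
        rw [h2] at h3
        exact ⟨h1, h2, h3⟩
      rcases F.eq_empty_or_nonempty with hFe | ⟨f0, hf0⟩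
      · rw [hFe]; simp
      have hside : ∀ q ∈ F, ∀ q' ∈ F, (b g < φ g (pt q) ↔ b g < φ g (pt q')) := by
        intro q hq q' hq'
        have h1 := (hmem q hq).2.2
        rw [← (hmem q' hq').2.2, decide_eq_decide] at h1
        exact h1
      have hzg : ∀ q ∈ F, φ g (z q) = b g := fun q hq => by
        have := hh q (hmem q hq).1
        rw [(hmem q hq).2.1] at this
        exact this
      have hg0 : φ g ≠ 0 := by
        intro h0
        have := hsep f0 (hmem f0 hf0).1
        rw [(hmem f0 hf0).2.1, h0] at this
        simp at this
      have hker : Module.finrank ℝ (LinearMap.ker (φ g)) = e + 1 := by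
        have h1 := Module.Dual.finrank_ker_add_one_of_ne_zero hg0
        omega
      have hzk : ∀ q ∈ F, z q - z f0 ∈ LinearMap.ker (φ g) := fun q hq => by
        rw [LinearMap.mem_ker, map_sub, hzg q hq, hzg f0 hf0, sub_self]
      let pt' : α → LinearMap.ker (φ g) := fun q =>
        if hk : z q - z f0 ∈ LinearMap.ker (φ g) then ⟨z q - z f0, hk⟩ else 0
      have hpt' : ∀ q ∈ F, ((pt' q : LinearMap.ker (φ g)) : V) = z q - z f0 := fun q hq => by
        simp only [pt', dif_pos (hzk q hq)]
      have hsgn' : ∀ q ∈ F, ∀ j ∈ R.erase g, φ j (z q) ≠ b j ∧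
          (b j < φ j (z q) ↔ b j < φ j (pt q)) := by
        intro q hq j hj
        obtain ⟨h1, h2⟩ := Finset.mem_erase.1 hj
        exact hsgn q (hmem q hq).1 j h2 (by rw [(hmem q hq).2.1]; exact h1)
      have hres := ih hker (Q := F) (pt := pt') ?_ (R.erase g)
        (fun i => (φ i).comp (LinearMap.ker (φ g)).subtype) (fun i => b i - φ i (z f0)) ?_ ?_
      · refine hres.trans_eq ?_
        rw [Finset.card_erase_of_mem hgR, Nat.sub_add_cancel (Finset.card_pos.2 ⟨g, hgR⟩)]
      · intro q hq
        refine ⟨(ψ q).comp (LinearMap.ker (φ g)).subtype, fun q' hq' hne => ?_⟩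
        simp only [LinearMap.comp_apply, Submodule.subtype_apply, hpt' q hq, hpt' q' hq', map_sub]
        refine sub_lt_sub_right ?_ _
        obtain ⟨hqQ, hqg, -⟩ := hmem q hq
        obtain ⟨hqQ', hqg', -⟩ := hmem q' hq'
        have e1 : ψ q (z q) = ψ q (pt q) := by
          simp only [z, map_add, map_smul, map_sub, hψ1 q hqQ, sub_self, smul_zero, add_zero]
        have e2 : ψ q (z q') = ψ q (pt q') + t q' * (ψ q (pt (r q')) - ψ q (pt q')) := by
          simp [z]
        have hq'r : q' ≠ r q := by
          intro he
          have := hsep q hqQ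
          rw [hqg, ← he] at this
          exact this (hside q hq q' hq')
        have a1 := hψ2 q hqQ q' hqQ' hne hq'r
        have a2 : ψ q (pt q) ≤ ψ q (pt (r q')) := by
          by_cases hb1 : r q' = q
          · rw [hb1]
          by_cases hb2 : r q' = r q
          · rw [hb2, hψ1 q hqQ]
          exact (hψ2 q hqQ _ (hrQ q' hqQ') hb1 hb2).le
        rw [e1, e2]
        have := ht0 q' hqQ'
        have := ht1 q' hqQ'
        nlinarith
      · intro q hq j hj
        simp only [LinearMap.comp_apply, Submodule.subtype_apply, hpt' q hq, map_sub]
        intro he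
        exact (hsgn' q hq j hj).1 (by linarith)
      · intro q hq q' hq' hs
        simp only [LinearMap.comp_apply, Submodule.subtype_apply, hpt' q hq, hpt' q' hq', map_sub,
          sub_lt_sub_iff_right] at hs
        refine hinj q (hmem q hq).1 q' (hmem q' hq').1 fun j hj => ?_
        by_cases hjg : j = g
        · subst hjg; exact hside q hq q' hq'
        · have hj' := Finset.mem_erase.2 ⟨hjg, hj⟩
          rw [← (hsgn' q hq j hj').2, ← (hsgn' q' hq' j hj').2]
          exact hs j hj'
    · rw [Finset.card_product, Finset.card_univ, Fintype.card_bool]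
      calc 2 ^ (e + 1) * R.card ^ e * (R.card * 2) = 2 ^ (e + 1 + 1) * R.card ^ (e + 1) := by ring
        _ ≤ _ := Nat.mul_le_mul_left _ (Nat.pow_le_pow_left (Nat.le_succ _) _)

/-- The face of the arrangement `R` lying on exactly the hyperplanes of `T`, on the positive side
of exactly the others that belong to `β`, is nonempty. -/
def IsFace {d : ℕ} {ι : Type*} (y : ι → EuclideanSpace ℝ (Fin d) × ℝ) (R T β : Finset ι) : Prop :=
  ∃ x, (∀ i ∈ T, ev (y i) x = 0) ∧ ∀ i ∈ R, i ∉ T → ev (y i) x ≠ 0 ∧ (0 < ev (y i) x ↔ i ∈ β)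

/-- The sign vectors of the points of `Q` with respect to the hyperplanes of `R`. -/
def cells {d : ℕ} {ι : Type*} [DecidableEq ι] (y : ι → EuclideanSpace ℝ (Fin d) × ℝ)
    (Q : Finset (EuclideanSpace ℝ (Fin d))) (R : Finset ι) : Finset (Finset ι) :=
  Q.image fun q => R.filter fun i => 0 < ev (y i) q

/-- Faces on `t` hyperplanes together with a choice of `j` of them, such that all `2 ^ j` cells
obtained by switching sides of the chosen hyperplanes are marked by a point of `Q`. -/
def flags {d : ℕ} {ι : Type*} [DecidableEq ι] (y : ι → EuclideanSpace ℝ (Fin d) × ℝ)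
    (Q : Finset (EuclideanSpace ℝ (Fin d))) (t j : ℕ) (R : Finset ι) :
    Finset (Finset ι × Finset ι × Finset ι) :=
  (R.powersetCard t ×ˢ cubes (cells y Q R) R j).filter
    fun p => p.2.1 ⊆ p.1 ∧ IsFace y R p.1 p.2.2

theorem mem_flags {d : ℕ} {ι : Type*} [DecidableEq ι] {y : ι → EuclideanSpace ℝ (Fin d) × ℝ}
    {Q : Finset (EuclideanSpace ℝ (Fin d))} {t j : ℕ} {R T J β : Finset ι} :
    (T, J, β) ∈ flags y Q t j R ↔
      T ⊆ R ∧ T.card = t ∧ (J, β) ∈ cubes (cells y Q R) R j ∧ J ⊆ T ∧ IsFace y R T β := by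
  simp only [flags, Finset.mem_filter, Finset.mem_product, Finset.mem_powersetCard, and_assoc]

theorem erase_mem_cells {d : ℕ} {ι : Type*} [DecidableEq ι]
    {y : ι → EuclideanSpace ℝ (Fin d) × ℝ} {Q : Finset (EuclideanSpace ℝ (Fin d))}
    {R A : Finset ι} (hA : A ∈ cells y Q R) (h : ι) : A.erase h ∈ cells y Q (R.erase h) := by
  obtain ⟨q, hq, rfl⟩ := Finset.mem_image.1 hA
  refine Finset.mem_image.2 ⟨q, hq, ?_⟩
  ext i; simp [and_assoc]

theorem erase_mem_flags {d : ℕ} {ι : Type*} [DecidableEq ι]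
    {y : ι → EuclideanSpace ℝ (Fin d) × ℝ} {Q : Finset (EuclideanSpace ℝ (Fin d))} {t j : ℕ}
    {R T J β : Finset ι} (hf : (T, J, β) ∈ flags y Q t j R) {h : ι} (hT : h ∉ T) :
    (T, J, β.erase h) ∈ flags y Q t j (R.erase h) := by
  obtain ⟨h1, h2, h3, h4, x, hx1, hx2⟩ := mem_flags.1 hf
  obtain ⟨c1, c2, c3, c4, c5⟩ := mem_cubes.1 h3
  have hJ : h ∉ J := fun hh => hT (h4 hh)
  refine mem_flags.2 ⟨fun i hi => Finset.mem_erase.2 ⟨fun e => hT (e ▸ hi), h1 hi⟩, h2,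
    mem_cubes.2 ⟨fun i hi => Finset.mem_erase.2 ⟨fun e => hJ (e ▸ hi), c1 hi⟩, c2,
      Finset.erase_subset_erase _ c3, c4.mono_right (Finset.erase_subset _ _), fun ε hε => ?_⟩,
    h4, x, hx1, fun i hi hiT => ?_⟩
  · have := erase_mem_cells (c5 ε hε) h
    rwa [Finset.erase_union_distrib, Finset.erase_eq_of_notMem (fun hh => hJ (hε hh))] at this
  · obtain ⟨a, b⟩ := Finset.mem_erase.1 hi
    have := hx2 i b hiT
    simpa [a] using this

theorem ev_add_smul_sub {d : ℕ} (y : EuclideanSpace ℝ (Fin d) × ℝ)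
    (v w : EuclideanSpace ℝ (Fin d)) (t : ℝ) :
    ev y (v + t • (w - v)) = (1 - t) * ev y v + t * ev y w := by
  simp only [ev, inner_add_left, real_inner_smul_left, inner_sub_left]; ring

theorem IsFace.insert_of_both {d : ℕ} {ι : Type*} [DecidableEq ι]
    {y : ι → EuclideanSpace ℝ (Fin d) × ℝ} {R T β : Finset ι} {h : ι} (hR : h ∈ R) (hT : h ∉ T)
    (hβ : h ∉ β) (h1 : IsFace y R T β) (h2 : IsFace y R T (insert h β)) :
    IsFace y R (insert h T) β := by
  obtain ⟨x, hx, hx'⟩ := h1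
  obtain ⟨z, hz, hz'⟩ := h2
  have e1 : ev (y h) x < 0 := by
    obtain ⟨a, b⟩ := hx' h hR hT
    exact lt_of_le_of_ne (not_lt.1 fun hc => hβ (b.1 hc)) a
  have e2 : 0 < ev (y h) z := (hz' h hR hT).2.2 (Finset.mem_insert_self _ _)
  set s := (-ev (y h) x) / (ev (y h) z - ev (y h) x) with hs
  have hden : 0 < ev (y h) z - ev (y h) x := by linarith
  have s0 : 0 < s := div_pos (by linarith) hden
  have s1 : s < 1 := by rw [hs, div_lt_one hden]; linarith
  refine ⟨x + s • (z - x), fun i hi => ?_, fun i hi hiT => ?_⟩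
  · rw [ev_add_smul_sub]
    rcases Finset.mem_insert.1 hi with rfl | hi
    · rw [hs]; field_simp; ring
    · rw [hx i hi, hz i hi]; ring
  · rw [Finset.mem_insert, not_or] at hiT
    obtain ⟨a1, a2⟩ := hx' i hi hiT.2
    obtain ⟨b1, b2⟩ := hz' i hi hiT.2
    rw [Finset.mem_insert, or_iff_right hiT.1] at b2
    rw [ev_add_smul_sub]
    by_cases hi' : i ∈ β
    · have p1 := a2.2 hi'
      have p2 := b2.2 hi'
      have : 0 < (1 - s) * ev (y i) x + s * ev (y i) z :=
        add_pos (mul_pos (by linarith) p1) (mul_pos s0 p2)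
      exact ⟨this.ne', by simp [this, hi']⟩
    · have p1 : ev (y i) x < 0 := lt_of_le_of_ne (not_lt.1 fun hc => hi' (a2.1 hc)) a1
      have p2 : ev (y i) z < 0 := lt_of_le_of_ne (not_lt.1 fun hc => hi' (b2.1 hc)) b1
      have : (1 - s) * ev (y i) x + s * ev (y i) z < 0 :=
        add_neg (mul_neg_of_pos_of_neg (by linarith) p1) (mul_neg_of_pos_of_neg s0 p2)
      exact ⟨this.ne, by simp [this.le.not_gt, hi']⟩

theorem card_flags_notMem_le {d : ℕ} {ι : Type*} [DecidableEq ι]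
    (y : ι → EuclideanSpace ℝ (Fin d) × ℝ) (Q : Finset (EuclideanSpace ℝ (Fin d))) (t j : ℕ)
    (R : Finset ι) (h : ι) (hR : h ∈ R) :
    ((flags y Q t j R).filter fun p => h ∉ p.1).card ≤ (flags y Q t j (R.erase h)).card +
      ((flags y Q (t + 1) (j + 1) R).filter fun p => h ∈ p.2.1).card := by
  let A := (flags y Q t j R).filter fun p => h ∉ p.1 ∧ h ∉ p.2.2
  let B₀ := (flags y Q t j R).filter fun p => h ∉ p.1 ∧ h ∈ p.2.2
  let B := B₀.image fun p => (p.1, p.2.1, p.2.2.erase h)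
  have hB : B.card = B₀.card := by
    refine Finset.card_image_of_injOn ?_
    rintro ⟨T, J, β⟩ hp ⟨T', J', β'⟩ hp' he
    simp only [Prod.mk.injEq] at he
    have h1 : h ∈ β := (Finset.mem_filter.1 hp).2.2
    have h2 : h ∈ β' := (Finset.mem_filter.1 hp').2.2
    rw [he.1, he.2.1, ← Finset.insert_erase h1, he.2.2, Finset.insert_erase h2]
  have hAB : ((flags y Q t j R).filter fun p => h ∉ p.1).card = A.card + B.card := by
    rw [hB, ← Finset.card_filter_add_card_filter_not (s := (flags y Q t j R).filter fun p => h ∉ p.1)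
      (fun p => h ∉ p.2.2), Finset.filter_filter, Finset.filter_filter]
    simp only [not_not, A, B₀]
  have hA' : ∀ T J β, (T, J, β) ∈ A → (T, J, β) ∈ flags y Q t j R ∧ h ∉ T ∧ h ∉ β :=
    fun T J β hp => ⟨(Finset.mem_filter.1 hp).1, (Finset.mem_filter.1 hp).2⟩
  have hB' : ∀ T J β, (T, J, β) ∈ B → (T, J, insert h β) ∈ flags y Q t j R ∧ h ∉ T ∧ h ∉ β := by
    intro T J β hp
    obtain ⟨⟨T', J', β'⟩, hp', he⟩ := Finset.mem_image.1 hp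
    simp only [Prod.mk.injEq] at he
    obtain ⟨rfl, rfl, rfl⟩ := he
    obtain ⟨h1, h2, h3⟩ := Finset.mem_filter.1 hp'
    exact ⟨by rwa [Finset.insert_erase h3], h2, Finset.notMem_erase _ _⟩
  rw [hAB, ← Finset.card_union_add_card_inter]
  refine Nat.add_le_add (Finset.card_le_card ?_) ?_
  · rintro ⟨T, J, β⟩ hp
    rcases Finset.mem_union.1 hp with hp | hp
    · obtain ⟨h1, h2, h3⟩ := hA' _ _ _ hp
      rw [← Finset.erase_eq_of_notMem h3]
      exact erase_mem_flags h1 h2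
    · obtain ⟨h1, h2, h3⟩ := hB' _ _ _ hp
      rw [← Finset.erase_insert h3]
      exact erase_mem_flags h1 h2
  · refine Finset.card_le_card_of_injOn (fun p => (insert h p.1, insert h p.2.1, p.2.2)) ?_ ?_
    · rintro ⟨T, J, β⟩ hp
      obtain ⟨hpA, hpB⟩ := Finset.mem_inter.1 (Finset.mem_coe.1 hp)
      obtain ⟨hf, hT, hβ⟩ := hA' _ _ _ hpA
      obtain ⟨hf', -, -⟩ := hB' _ _ _ hpB
      obtain ⟨h1, h2, h3, h4, h5⟩ := mem_flags.1 hf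
      obtain ⟨-, -, g3, -, g5⟩ := mem_flags.1 hf'
      obtain ⟨c1, c2, c3, c4, c5⟩ := mem_cubes.1 h3
      have c5' := (mem_cubes.1 g3).2.2.2.2
      have hJ : h ∉ J := fun hh => hT (h4 hh)
      refine Finset.mem_coe.2 (Finset.mem_filter.2 ⟨mem_flags.2 ⟨?_, ?_, mem_cubes.2
        ⟨?_, ?_, c3, ?_, fun ε hε => ?_⟩, ?_, ?_⟩, Finset.mem_insert_self _ _⟩)
      · exact Finset.insert_subset hR h1
      · rw [Finset.card_insert_of_notMem hT, h2]
      · exact Finset.insert_subset hR c1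
      · rw [Finset.card_insert_of_notMem hJ, c2]
      · exact Finset.disjoint_insert_left.2 ⟨hβ, c4⟩
      · by_cases hhε : h ∈ ε
        · have := c5' (ε.erase h) (Finset.subset_insert_iff.1 hε)
          rwa [Finset.union_insert, ← Finset.insert_union, Finset.insert_erase hhε] at this
        · exact c5 ε ((Finset.subset_insert_iff_of_notMem hhε).1 hε)
      · exact Finset.insert_subset_insert _ h4
      · exact h5.insert_of_both hR hT hβ g5
    · rintro ⟨T, J, β⟩ hp ⟨T', J', β'⟩ hp' he
      obtain ⟨hf, hT, -⟩ := hA' _ _ _ (Finset.mem_inter.1 (Finset.mem_coe.1 hp)).1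
      obtain ⟨hf', hT', -⟩ := hA' _ _ _ (Finset.mem_inter.1 (Finset.mem_coe.1 hp')).1
      have hJ : h ∉ J := fun hh => hT ((mem_flags.1 hf).2.2.2.1 hh)
      have hJ' : h ∉ J' := fun hh => hT' ((mem_flags.1 hf').2.2.2.1 hh)
      simp only [Prod.mk.injEq] at he
      rw [← Finset.erase_insert hT, he.1, Finset.erase_insert hT', ← Finset.erase_insert hJ,
        he.2.1, Finset.erase_insert hJ', he.2.2]

theorem flags_recurrence {d : ℕ} {ι : Type*} [DecidableEq ι]
    (y : ι → EuclideanSpace ℝ (Fin d) × ℝ) (Q : Finset (EuclideanSpace ℝ (Fin d))) (t j : ℕ)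
    (R : Finset ι) :
    (R.card - t) * (flags y Q t j R).card ≤ ∑ h ∈ R, (flags y Q t j (R.erase h)).card +
      (j + 1) * (flags y Q (t + 1) (j + 1) R).card := by
  have e1 : (R.card - t) * (flags y Q t j R).card =
      ∑ h ∈ R, ((flags y Q t j R).filter fun p => h ∉ p.1).card := by
    simp_rw [Finset.card_filter]
    rw [Finset.sum_comm, mul_comm, ← smul_eq_mul, ← Finset.sum_const]
    refine Finset.sum_congr rfl ?_
    rintro ⟨T, J, β⟩ hp
    obtain ⟨h1, h2, -⟩ := mem_flags.1 hp
    rw [← Finset.card_filter, ← h2, ← Finset.card_sdiff_of_subset h1]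
    congr 1; ext i; simp
  have e2 : (j + 1) * (flags y Q (t + 1) (j + 1) R).card =
      ∑ h ∈ R, ((flags y Q (t + 1) (j + 1) R).filter fun p => h ∈ p.2.1).card := by
    simp_rw [Finset.card_filter]
    rw [Finset.sum_comm, mul_comm, ← smul_eq_mul, ← Finset.sum_const]
    refine Finset.sum_congr rfl ?_
    rintro ⟨T, J, β⟩ hp
    obtain ⟨-, -, h3, -⟩ := mem_flags.1 hp
    obtain ⟨c1, c2, -⟩ := mem_cubes.1 h3
    rw [← Finset.card_filter, ← c2]
    congr 1; ext i
    simp only [Finset.mem_filter]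
    exact ⟨fun hi => ⟨c1 hi, hi⟩, fun hi => hi.2⟩
  rw [e1, e2, ← Finset.sum_add_distrib]
  exact Finset.sum_le_sum fun h hh => card_flags_notMem_le y Q t j R h hh

theorem IsFace.sdiff {d : ℕ} {ι : Type*} [DecidableEq ι]
    {y : ι → EuclideanSpace ℝ (Fin d) × ℝ} (hy : SimpleArr y) {R T K β : Finset ι}
    (hT : T.card ≤ d) (hK : K ⊆ T) (h : IsFace y R T β) : IsFace y R (T \ K) β := by
  obtain ⟨v, hv, hv'⟩ := h
  have hw : ∀ a : ι, ∃ w, a ∈ T → (∀ i ∈ T, i ≠ a → ⟪w, (y i).1⟫ = 0) ∧ ⟪w, (y a).1⟫ = 1 := by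
    intro a
    by_cases ha : a ∈ T
    · obtain ⟨w, h⟩ := exists_dual_direction hy T hT a ha
      exact ⟨w, fun _ => h⟩
    · exact ⟨0, fun h => absurd h ha⟩
  choose w hw using hw
  let u := ∑ a ∈ K, (if a ∈ β then (1 : ℝ) else -1) • w a
  have hu0 : ∀ i ∈ T, i ∉ K → ⟪u, (y i).1⟫ = 0 := by
    intro i hi hiK
    simp only [u, sum_inner, real_inner_smul_left]
    refine Finset.sum_eq_zero fun a ha => ?_
    rw [(hw a (hK ha)).1 i hi (fun e => hiK (e ▸ ha)), mul_zero]
  have hu1 : ∀ i ∈ K, ⟪u, (y i).1⟫ = if i ∈ β then (1 : ℝ) else -1 := by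
    intro i hi
    simp only [u, sum_inner, real_inner_smul_left]
    rw [Finset.sum_eq_single i, (hw i (hK hi)).2, mul_one]
    · intro a ha hai
      rw [(hw a (hK ha)).1 i (hK hi) hai.symm, mul_zero]
    · exact fun h => absurd hi h
  have hev : ∀ᶠ t : ℝ in nhds 0, ∀ i ∈ R \ T, 0 < ev (y i) v * ev (y i) (v + t • u) := by
    rw [Filter.eventually_all_finset]
    intro i hi
    obtain ⟨h1, h2⟩ := Finset.mem_sdiff.1 hi
    have hc : Continuous fun t : ℝ => ev (y i) v * ev (y i) (v + t • u) := by
      have := continuous_ev_right (y i)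
      fun_prop
    refine (isOpen_lt continuous_const hc).mem_nhds ?_
    simp only [Set.mem_ofPred_eq, zero_smul, add_zero]
    exact mul_self_pos.2 (hv' i h1 h2).1
  obtain ⟨t, ht, ht0⟩ := ((hev.filter_mono nhdsWithin_le_nhds).and
    (self_mem_nhdsWithin : Set.Ioi (0 : ℝ) ∈ nhdsWithin 0 (Set.Ioi 0))).exists
  have ht0 : 0 < t := ht0
  refine ⟨v + t • u, fun i hi => ?_, fun i hi hiT => ?_⟩
  · obtain ⟨h1, h2⟩ := Finset.mem_sdiff.1 hi
    rw [ev_add_smul, hv i h1, hu0 i h1 h2]; simp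
  · by_cases hiT' : i ∈ T
    · have hiK : i ∈ K := by by_contra h; exact hiT (Finset.mem_sdiff.2 ⟨hiT', h⟩)
      rw [ev_add_smul, hv i hiT', hu1 i hiK]
      by_cases hb : i ∈ β
      · simp [hb, ht0, ht0.ne']
      · simp [hb, ht0.le, ht0.ne']
    · have := ht i (Finset.mem_sdiff.2 ⟨hi, hiT'⟩)
      obtain ⟨h1, h2⟩ := hv' i hi hiT'
      rw [← h2]
      rcases pos_and_pos_or_neg_and_neg_of_mul_pos this with h | h
      · exact ⟨h.2.ne', by simp [h.1, h.2]⟩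
      · exact ⟨h.2.ne, by simp [h.1.le.not_gt, h.2.le.not_gt]⟩

theorem inner_lt_of_simple_cone {d : ℕ} {ι : Type*} [DecidableEq ι]
    {y : ι → EuclideanSpace ℝ (Fin d) × ℝ} (hy : SimpleArr y) {T K : Finset ι} (hT : T.card = d)
    (s : ι → ℝ) (hs : ∀ a, s a * s a = 1)
    (u v x : EuclideanSpace ℝ (Fin d)) (hv : ∀ i ∈ T, ev (y i) v = 0)
    (hx : ∀ i ∈ T, i ∉ K → ev (y i) x = 0) (hxK : ∀ i ∈ K, 0 ≤ s i * ev (y i) x)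
    (hu : ∀ a ∈ K, ∀ w, (∀ i ∈ T, i ≠ a → ⟪w, (y i).1⟫ = 0) → ⟪w, (y a).1⟫ = 1 →
      0 < s a * ⟪w, u⟫) : ⟪v, u⟫ < ⟪x, u⟫ ∨ x = v := by
  have hw : ∀ a : ι, ∃ w, a ∈ T → (∀ i ∈ T, i ≠ a → ⟪w, (y i).1⟫ = 0) ∧ ⟪w, (y a).1⟫ = 1 := by
    intro a
    by_cases ha : a ∈ T
    · obtain ⟨w, h⟩ := exists_dual_direction hy T hT.le a ha
      exact ⟨w, fun _ => h⟩
    · exact ⟨0, fun h => absurd h ha⟩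
  choose w hw using hw
  have hsub : ∀ i, ev (y i) x - ev (y i) v = ⟪x - v, (y i).1⟫ := by
    intro i; simp only [ev, inner_sub_left]; ring
  have hsum : x - v = ∑ a ∈ T, ev (y a) x • w a := by
    rw [← sub_eq_zero]
    refine eq_zero_of_span_eq_top _ (hy.span_eq_top T hT) _ ?_
    rintro _ ⟨i, hi, rfl⟩
    simp only [inner_sub_left, sum_inner, real_inner_smul_left]
    rw [Finset.sum_eq_single i, (hw i hi).2, mul_one, ← inner_sub_left, ← hsub, hv i hi]
    · ring
    · intro a ha hai
      rw [(hw a ha).1 i hi hai.symm, mul_zero]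
    · exact fun h => absurd hi h
  have hterm : ∀ a ∈ T, 0 ≤ ev (y a) x * ⟪w a, u⟫ := by
    intro a ha
    by_cases haK : a ∈ K
    · have h1 := hu a haK (w a) (hw a ha).1 (hw a ha).2
      have h2 := mul_nonneg (hxK a haK) h1.le
      calc (0 : ℝ) ≤ _ := h2
        _ = (s a * s a) * (ev (y a) x * ⟪w a, u⟫) := by ring
        _ = _ := by rw [hs, one_mul]
    · rw [hx a ha haK, zero_mul]
  have hin : ⟪x, u⟫ - ⟪v, u⟫ = ∑ a ∈ T, ev (y a) x * ⟪w a, u⟫ := by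
    rw [← inner_sub_left, hsum, sum_inner]
    simp only [real_inner_smul_left]
  by_cases h0 : ∃ a ∈ T, 0 < ev (y a) x * ⟪w a, u⟫
  · left
    have := Finset.sum_pos' hterm h0
    linarith
  · right
    push Not at h0
    rw [← sub_eq_zero, hsum]
    refine Finset.sum_eq_zero fun a ha => ?_
    by_cases haK : a ∈ K
    · have h1 := hu a haK (w a) (hw a ha).1 (hw a ha).2
      have h2 : ⟪w a, u⟫ ≠ 0 := by rintro h; rw [h, mul_zero] at h1; exact lt_irrefl _ h1
      have h3 := (mul_eq_zero.1 (le_antisymm (h0 a ha) (hterm a ha))).resolve_right h2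
      rw [h3, zero_smul]
    · rw [hx a ha haK, zero_smul]

theorem card_filter_flags_le {d : ℕ} {ι : Type*} [DecidableEq ι] [Fintype ι]
    {y : ι → EuclideanSpace ℝ (Fin d) × ℝ} (hy : SimpleArr y)
    (Q : Finset (EuclideanSpace ℝ (Fin d))) (c j : ℕ) (R : Finset ι)
    (u : EuclideanSpace ℝ (Fin d)) :
    ((flags y Q d j R).filter fun p => ∃ K ⊆ p.1 \ p.2.1, K.card = c ∧ ∀ a ∈ K, ∀ w,
      (∀ i ∈ p.1, i ≠ a → ⟪w, (y i).1⟫ = 0) → ⟪w, (y a).1⟫ = 1 →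
        0 < (if a ∈ p.2.2 then (1 : ℝ) else -1) * ⟪w, u⟫).card ≤ (flags y Q (d - c) j R).card := by
  have hch : ∀ p : Finset ι × Finset ι × Finset ι, ∃ K : Finset ι,
      (∃ K ⊆ p.1 \ p.2.1, K.card = c ∧ ∀ a ∈ K, ∀ w,
      (∀ i ∈ p.1, i ≠ a → ⟪w, (y i).1⟫ = 0) → ⟪w, (y a).1⟫ = 1 →
        0 < (if a ∈ p.2.2 then (1 : ℝ) else -1) * ⟪w, u⟫) →
      K ⊆ p.1 \ p.2.1 ∧ K.card = c ∧ ∀ a ∈ K, ∀ w,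
      (∀ i ∈ p.1, i ≠ a → ⟪w, (y i).1⟫ = 0) → ⟪w, (y a).1⟫ = 1 →
        0 < (if a ∈ p.2.2 then (1 : ℝ) else -1) * ⟪w, u⟫ := by
    intro p
    by_cases h : ∃ K ⊆ p.1 \ p.2.1, K.card = c ∧ ∀ a ∈ K, ∀ w,
      (∀ i ∈ p.1, i ≠ a → ⟪w, (y i).1⟫ = 0) → ⟪w, (y a).1⟫ = 1 →
        0 < (if a ∈ p.2.2 then (1 : ℝ) else -1) * ⟪w, u⟫
    · obtain ⟨K, h1, h2⟩ := h
      exact ⟨K, fun _ => ⟨h1, h2⟩⟩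
    · exact ⟨∅, fun h' => absurd h' h⟩
  choose K hK using hch
  refine Finset.card_le_card_of_injOn (fun p => (p.1 \ K p, p.2.1, p.2.2)) ?_ ?_
  · rintro ⟨T, J, β⟩ hp
    obtain ⟨hf, hp⟩ := Finset.mem_filter.1 (Finset.mem_coe.1 hp)
    obtain ⟨k1, k2, -⟩ := hK _ hp
    obtain ⟨h1, h2, h3, h4, h5⟩ := mem_flags.1 hf
    have kT : K (T, J, β) ⊆ T := k1.trans Finset.sdiff_subset
    refine Finset.mem_coe.2 (mem_flags.2 ⟨Finset.sdiff_subset.trans h1, ?_, h3, ?_,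
      h5.sdiff hy h2.le kT⟩)
    · rw [Finset.card_sdiff_of_subset kT, h2, k2]
    · intro i hi
      exact Finset.mem_sdiff.2 ⟨h4 hi, fun h => (Finset.mem_sdiff.1 (k1 h)).2 hi⟩
  · rintro ⟨T, J, β⟩ hp ⟨T', J', β'⟩ hp' he
    obtain ⟨hf, hpK⟩ := Finset.mem_filter.1 (Finset.mem_coe.1 hp)
    obtain ⟨hf', hpK'⟩ := Finset.mem_filter.1 (Finset.mem_coe.1 hp')
    simp only [Prod.mk.injEq] at he
    obtain ⟨heT, rfl, rfl⟩ := he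
    have key : ∀ T T' : Finset ι, (T, J, β) ∈ flags y Q d J.card R →
        (T', J, β) ∈ flags y Q d J.card R → ∀ K K' : Finset ι, K ⊆ T → T \ K = T' \ K' →
        (∀ a ∈ K, ∀ w, (∀ i ∈ T, i ≠ a → ⟪w, (y i).1⟫ = 0) → ⟪w, (y a).1⟫ = 1 →
          0 < (if a ∈ β then (1 : ℝ) else -1) * ⟪w, u⟫) → ∀ v v',
        (∀ i ∈ T, ev (y i) v = 0) → (∀ i ∈ T', ev (y i) v' = 0) →
        (∀ i ∈ R, i ∉ T' → ev (y i) v' ≠ 0 ∧ (0 < ev (y i) v' ↔ i ∈ β)) →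
        ⟪v, u⟫ < ⟪v', u⟫ ∨ v' = v := by
      intro T T' hf hf' K K' hKT heT hK v v' hv hv' hs'
      refine inner_lt_of_simple_cone hy (mem_flags.1 hf).2.1 (fun a => if a ∈ β then 1 else -1)
        (fun a => by split_ifs <;> norm_num) u v v' hv (K := K) ?_ ?_ hK
      · intro i hi hiK
        have : i ∈ T' \ K' := heT ▸ Finset.mem_sdiff.2 ⟨hi, hiK⟩
        exact hv' i (Finset.mem_sdiff.1 this).1
      · intro i hi
        by_cases hiT' : i ∈ T'
        · rw [hv' i hiT', mul_zero]
        · have := (hs' i ((mem_flags.1 hf).1 (hKT hi)) hiT').2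
          by_cases hb : i ∈ β
          · simpa [hb] using (this.2 hb).le
          · simpa [hb] using not_lt.1 (fun h => hb (this.1 h))
    have hj : J.card = j := (mem_cubes.1 (mem_flags.1 hf).2.2.1).2.1
    subst hj
    obtain ⟨v, hv, hs⟩ := (mem_flags.1 hf).2.2.2.2
    obtain ⟨v', hv', hs'⟩ := (mem_flags.1 hf').2.2.2.2
    obtain ⟨k1, -, k3⟩ := hK _ hpK
    obtain ⟨k1', -, k3'⟩ := hK _ hpK'
    have hvv : v' = v := by
      rcases key T T' hf hf' _ _ (k1.trans Finset.sdiff_subset) heT k3 v v' hv hv' hs' with h | h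
      · rcases key T' T hf' hf _ _ (k1'.trans Finset.sdiff_subset) heT.symm k3' v' v hv' hv hs
          with h' | h'
        · exact absurd h (not_lt.2 h'.le)
        · exact h'.symm
      · exact h
    subst hvv
    have hTT : T = T' := by
      ext i
      refine ⟨fun hi => ?_, fun hi => ?_⟩
      · by_contra hc
        exact (hs' i ((mem_flags.1 hf).1 hi) hc).1 (hv i hi)
      · by_contra hc
        exact (hs i ((mem_flags.1 hf').1 hi) hc).1 (hv' i hi)
    rw [hTT]

theorem pos_or_neg_of_dual_direction {d : ℕ} {ι : Type*} [DecidableEq ι]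
    {y : ι → EuclideanSpace ℝ (Fin d) × ℝ} (hy : SimpleArr y) {T : Finset ι} (h2 : T.card = d)
    {a : ι} (ha : a ∈ T) {u : EuclideanSpace ℝ (Fin d)}
    (hu : ∀ J : Finset ι, J.card < d → u ∉ Submodule.span ℝ ((fun i => (y i).1) '' J))
    {s : ℝ} (hs0 : s ≠ 0) :
    (∀ w, (∀ i ∈ T, i ≠ a → ⟪w, (y i).1⟫ = 0) → ⟪w, (y a).1⟫ = 1 → 0 < s * ⟪w, u⟫) ∨
    ∀ w, (∀ i ∈ T, i ≠ a → ⟪w, (y i).1⟫ = 0) → ⟪w, (y a).1⟫ = 1 → 0 < s * ⟪w, -u⟫ := by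
  obtain ⟨w, hw0, hw1⟩ := exists_dual_direction hy T h2.le a ha
  have huniq : ∀ w', (∀ i ∈ T, i ≠ a → ⟪w', (y i).1⟫ = 0) → ⟪w', (y a).1⟫ = 1 → w' = w := by
    intro w' e0 e1
    rw [← sub_eq_zero]
    refine eq_zero_of_span_eq_top _ (hy.span_eq_top T h2) _ ?_
    rintro _ ⟨i, hi, rfl⟩
    simp only [inner_sub_left]
    by_cases hia : i = a
    · rw [hia, e1, hw1, sub_self]
    · rw [e0 i hi hia, hw0 i hi hia, sub_self]
  have hne : ⟪w, u⟫ ≠ 0 := by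
    intro h0
    have hmem : u ∈ Submodule.span ℝ ((fun i => (y i).1) '' T) := by
      rw [hy.span_eq_top T h2]; trivial
    rw [← Finset.insert_erase ha, Finset.coe_insert, Set.image_insert_eq,
      Submodule.mem_span_insert] at hmem
    obtain ⟨r, z, hz, hur⟩ := hmem
    have hwz : ⟪w, z⟫ = 0 := by
      have : Submodule.span ℝ ((fun i => (y i).1) '' ((T.erase a : Finset ι) : Set ι)) ≤
          LinearMap.ker (innerSL ℝ w : _ →L[ℝ] ℝ).toLinearMap := by
        refine Submodule.span_le.2 ?_
        rintro _ ⟨i, hi, rfl⟩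
        have hi := Finset.mem_erase.1 (Finset.mem_coe.1 hi)
        simpa using hw0 i hi.2 hi.1
      simpa using this hz
    rw [hur, inner_add_right, real_inner_smul_right, hw1, hwz, mul_one, add_zero] at h0
    rw [h0, zero_smul, zero_add] at hur
    refine hu (T.erase a) ?_ (hur ▸ hz)
    rw [Finset.card_erase_of_mem ha, h2]
    have := Finset.card_pos.2 ⟨a, ha⟩
    omega
  have hs : s * ⟪w, u⟫ ≠ 0 := mul_ne_zero hs0 hne
  rcases lt_or_gt_of_ne hs with h | h
  · right
    intro w' e0 e1
    rw [huniq w' e0 e1, inner_neg_right, mul_neg]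
    linarith
  · left
    intro w' e0 e1
    rwa [huniq w' e0 e1]

theorem card_flags_vertex_le {d : ℕ} {ι : Type*} [DecidableEq ι] [Fintype ι]
    {y : ι → EuclideanSpace ℝ (Fin d) × ℝ} (hy : SimpleArr y)
    (Q : Finset (EuclideanSpace ℝ (Fin d))) (c j : ℕ) (hc : 2 * c ≤ d - j + 1) (R : Finset ι) :
    (flags y Q d j R).card ≤ 2 * (flags y Q (d - c) j R).card := by
  rcases (flags y Q d j R).eq_empty_or_nonempty with he | ⟨⟨T₀, p₀⟩, hp₀⟩
  · simp [he]
  have hT₀ : T₀.card = d := by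
    obtain ⟨J, β⟩ := p₀
    exact (mem_flags.1 hp₀).2.1
  obtain ⟨u, hu⟩ : ∃ u : EuclideanSpace ℝ (Fin d), ∀ J : Finset ι, J.card < d →
      u ∉ Submodule.span ℝ ((fun i => (y i).1) '' J) := by
    obtain ⟨c, -, hu⟩ := exists_generic_objective hy
      ((T₀.equivFinOfCardEq hT₀).symm.toEmbedding.trans (Function.Embedding.subtype _))
    exact ⟨_, hu⟩
  let F : EuclideanSpace ℝ (Fin d) → Finset (Finset ι × Finset ι × Finset ι) := fun u =>
    (flags y Q d j R).filter fun p => ∃ K ⊆ p.1 \ p.2.1, K.card = c ∧ ∀ a ∈ K, ∀ w,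
      (∀ i ∈ p.1, i ≠ a → ⟪w, (y i).1⟫ = 0) → ⟪w, (y a).1⟫ = 1 →
        0 < (if a ∈ p.2.2 then (1 : ℝ) else -1) * ⟪w, u⟫
  have hcov : flags y Q d j R ⊆ F u ∪ F (-u) := by
    rintro ⟨T, J, β⟩ hp
    obtain ⟨h1, h2, h3, h4, h5⟩ := mem_flags.1 hp
    let G := fun (u : EuclideanSpace ℝ (Fin d)) (a : ι) => ∀ w,
      (∀ i ∈ T, i ≠ a → ⟪w, (y i).1⟫ = 0) → ⟪w, (y a).1⟫ = 1 →
        0 < (if a ∈ β then (1 : ℝ) else -1) * ⟪w, u⟫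
    have hor : ∀ a ∈ T, G u a ∨ G (-u) a := fun a ha =>
      pos_or_neg_of_dual_direction hy h2 ha hu (by split_ifs <;> norm_num)
    have hcard : (T \ J).card = d - j := by
      rw [Finset.card_sdiff_of_subset h4, h2, (mem_cubes.1 h3).2.1]
    have hle : (T \ J).card ≤ ((T \ J).filter (G u)).card + ((T \ J).filter (G (-u))).card := by
      refine (Finset.card_le_card ?_).trans (Finset.card_union_le _ _)
      intro a ha
      rw [Finset.mem_union, Finset.mem_filter, Finset.mem_filter]
      rcases hor a (Finset.sdiff_subset ha) with h | h
      · exact Or.inl ⟨ha, h⟩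
      · exact Or.inr ⟨ha, h⟩
    have hcc : c ≤ ((T \ J).filter (G u)).card ∨ c ≤ ((T \ J).filter (G (-u))).card := by omega
    have fin : ∀ u', c ≤ ((T \ J).filter (G u')).card → (T, J, β) ∈ F u' := by
      intro u' h
      obtain ⟨K, hK, hKc⟩ := Finset.exists_subset_card_eq h
      exact Finset.mem_filter.2 ⟨hp, K, hK.trans (Finset.filter_subset _ _), hKc,
        fun a ha => (Finset.mem_filter.1 (hK ha)).2⟩
    exact Finset.mem_union.2 (hcc.imp (fin _) (fin _))
  refine (Finset.card_le_card hcov).trans ((Finset.card_union_le _ _).trans ?_)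
  rw [two_mul]
  exact Nat.add_le_add (card_filter_flags_le hy Q c j R u) (card_filter_flags_le hy Q c j R (-u))

theorem IsFace.exists_endpoint {d : ℕ} {ι : Type*} [DecidableEq ι]
    {y : ι → EuclideanSpace ℝ (Fin d) × ℝ} (hy : SimpleArr y) {R T β : Finset ι}
    (hT : T.card + 1 = d) (hR : d ≤ R.card) (h : IsFace y R T β) :
    ∃ h ∈ R, h ∉ T ∧ IsFace y R (insert h T) β := by
  obtain ⟨x, hx, hx'⟩ := h
  obtain ⟨a, haR, haT⟩ := Finset.exists_mem_notMem_of_card_lt_card (s := T) (t := R) (by omega)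
  obtain ⟨w, hw0, hw1⟩ := exists_dual_direction hy (insert a T)
    (by rw [Finset.card_insert_of_notMem haT]; omega) a (Finset.mem_insert_self _ _)
  have hwT : ∀ i ∈ T, ⟪w, (y i).1⟫ = 0 := fun i hi =>
    hw0 i (Finset.mem_insert_of_mem hi) fun e => haT (e ▸ hi)
  let τ : ι → ℝ := fun i => -ev (y i) x / ⟪w, (y i).1⟫
  let S := R.filter fun i => i ∉ T ∧ ⟪w, (y i).1⟫ ≠ 0
  obtain ⟨h, hS, hmin⟩ := Finset.exists_min_image S (fun i => |τ i|)
    ⟨a, Finset.mem_filter.2 ⟨haR, haT, by rw [hw1]; exact one_ne_zero⟩⟩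
  obtain ⟨hhR, hhT, hhw⟩ := Finset.mem_filter.1 hS
  have hτ : ∀ i ∈ S, ev (y i) x = -(τ i * ⟪w, (y i).1⟫) := fun i hi => by
    have := (Finset.mem_filter.1 hi).2.2
    simp only [τ]; field_simp
  have hz : ∀ i ∈ insert h T, ev (y i) (x + τ h • w) = 0 := by
    intro i hi
    rw [ev_add_smul]
    rcases Finset.mem_insert.1 hi with rfl | hi
    · rw [hτ i hS]; ring
    · rw [hx i hi, hwT i hi]; ring
  refine ⟨h, hhR, hhT, x + τ h • w, hz, fun i hiR hi => ?_⟩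
  rw [Finset.mem_insert, not_or] at hi
  have hne : ev (y i) (x + τ h • w) ≠ 0 := by
    intro h0
    have := hy.2 (insert i (insert h T)) (x + τ h • w) fun l hl => by
      rcases Finset.mem_insert.1 hl with rfl | hl
      · exact h0
      · exact hz l hl
    rw [Finset.card_insert_of_notMem (by simp [hi.1, hi.2]), Finset.card_insert_of_notMem hhT] at this
    omega
  obtain ⟨e1, e2⟩ := hx' i hiR hi.2
  refine ⟨hne, ?_⟩
  rw [← e2]
  have hprod : 0 < ev (y i) x * ev (y i) (x + τ h • w) := by
    refine lt_of_le_of_ne ?_ (mul_ne_zero e1 hne).symm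
    rw [ev_add_smul]
    by_cases hiw : ⟪w, (y i).1⟫ = 0
    · rw [hiw, mul_zero, add_zero]; exact mul_self_nonneg _
    · have hiS : i ∈ S := Finset.mem_filter.2 ⟨hiR, hi.2, hiw⟩
      have h1 := hmin i hiS
      rw [hτ i hiS]
      have h2 : 0 ≤ τ i * (τ i - τ h) := by
        have h3 : τ i * τ h ≤ |τ i| * |τ i| :=
          (le_abs_self _).trans (by rw [abs_mul]; exact mul_le_mul_of_nonneg_left h1 (abs_nonneg _))
        rw [abs_mul_abs_self] at h3
        linarith
      have := mul_nonneg h2 (mul_self_nonneg ⟪w, (y i).1⟫)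
      linarith
  rcases pos_and_pos_or_neg_and_neg_of_mul_pos hprod with h | h
  · simp [h.1, h.2]
  · simp [h.1.le.not_gt, h.2.le.not_gt]

theorem card_flags_edge_le {d : ℕ} {ι : Type*} [DecidableEq ι]
    {y : ι → EuclideanSpace ℝ (Fin d) × ℝ} (hy : SimpleArr y)
    (Q : Finset (EuclideanSpace ℝ (Fin d))) (t j : ℕ) (ht : t + 1 = d) (R : Finset ι)
    (hR : d ≤ R.card) :
    (flags y Q t j R).card ≤ d * (flags y Q d j R).card := by
  have hch : ∀ p : Finset ι × Finset ι × Finset ι, ∃ h, p ∈ flags y Q t j R →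
      h ∈ R ∧ h ∉ p.1 ∧ IsFace y R (insert h p.1) p.2.2 := by
    rintro ⟨T, J, β⟩
    by_cases hp : (T, J, β) ∈ flags y Q t j R
    · obtain ⟨h1, h2, h3, h4, h5⟩ := mem_flags.1 hp
      obtain ⟨h, hh⟩ := h5.exists_endpoint hy (by omega) hR
      exact ⟨h, fun _ => hh⟩
    · obtain ⟨i, -⟩ := Finset.card_pos.1 (show 0 < R.card by omega)
      exact ⟨i, fun h => absurd h hp⟩
  choose g hg using hch
  refine Finset.card_le_mul_card_image_of_maps_to
    (f := fun p => (insert (g p) p.1, p.2.1, p.2.2)) ?_ _ ?_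
  · rintro ⟨T, J, β⟩ hp
    obtain ⟨h1, h2, h3⟩ := hg _ hp
    obtain ⟨e1, e2, e3, e4, e5⟩ := mem_flags.1 hp
    exact mem_flags.2 ⟨Finset.insert_subset h1 e1, by
      rw [Finset.card_insert_of_notMem h2, e2, ht],
      e3, e4.trans (Finset.subset_insert _ _), h3⟩
  · rintro ⟨T', J', β'⟩ hp'
    have hT' : T'.card = d := (mem_flags.1 hp').2.1
    refine (Finset.card_le_card (t := T'.image fun a => (T'.erase a, J', β')) ?_).trans
      (Finset.card_image_le.trans hT'.le)
    rintro ⟨T, J, β⟩ hp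
    obtain ⟨hf, he⟩ := Finset.mem_filter.1 hp
    simp only [Prod.mk.injEq] at he
    obtain ⟨rfl, rfl, rfl⟩ := he
    obtain ⟨-, h2, -⟩ := hg _ hf
    exact Finset.mem_image.2 ⟨g (T, J, β), Finset.mem_insert_self _ _, by
      rw [Finset.erase_insert h2]⟩

theorem card_cells_le {d : ℕ} (hd : 0 < d) {ι : Type*} [DecidableEq ι]
    (y : ι → EuclideanSpace ℝ (Fin d) × ℝ) (Q : Finset (EuclideanSpace ℝ (Fin d)))
    (hQ : ConvexPos Q fun x => x) (R : Finset ι) (hoff : ∀ q ∈ Q, ∀ i ∈ R, ev (y i) q ≠ 0) :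
    (cells y Q R).card ≤ 2 ^ d * (R.card + 1) ^ (d - 1) := by
  obtain ⟨Q', hQ', hinj, himg⟩ := Finset.exists_subset_injOn_image_eq_of_surjOn
    (f := fun q => R.filter fun i => 0 < ev (y i) q) Q (cells y Q R) (by
      intro A hA
      obtain ⟨q, hq, rfl⟩ := Finset.mem_image.1 (Finset.mem_coe.1 hA)
      exact ⟨q, hq, rfl⟩)
  have hQ'c : ConvexPos Q' fun x => x := fun q hq => by
    obtain ⟨φ, hφ⟩ := hQ q (hQ' hq)
    exact ⟨φ, fun q' hq' => hφ q' (hQ' hq')⟩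
  rw [← himg, Finset.card_image_of_injOn hinj]
  have h := ConvexPos.card_le (d - 1) (V := EuclideanSpace ℝ (Fin d)) (by simp; omega) hQ'c R
    (fun i => (innerSL ℝ (y i).1 : _ →L[ℝ] ℝ).toLinearMap) (fun i => (y i).2) ?_ ?_
  · rwa [Nat.sub_add_cancel hd] at h
  · intro q hq i hi
    have := hoff q (hQ' hq) i hi
    simp only [ContinuousLinearMap.coe_coe, innerSL_apply_apply]
    rw [real_inner_comm]
    intro he; exact this (by rw [ev, he, sub_self])
  · intro q hq q' hq' he
    refine hinj hq hq' ?_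
    refine Finset.filter_congr fun i hi => ?_
    have := he i hi
    simp only [ContinuousLinearMap.coe_coe, innerSL_apply_apply] at this
    rw [real_inner_comm, real_inner_comm q' _] at this
    simpa [ev] using this

theorem card_flags_diag_le {d : ℕ} {ι : Type*} [DecidableEq ι]
    (y : ι → EuclideanSpace ℝ (Fin d) × ℝ) (Q : Finset (EuclideanSpace ℝ (Fin d))) (t : ℕ)
    (R : Finset ι) (hoff : ∀ q ∈ Q, ∀ i ∈ R, ev (y i) q ≠ 0) :
    (flags y Q t t R).card ≤ (d + 1).choose t * (cells y Q R).card := by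
  refine le_trans ?_ (card_cubes_le R (cells y Q R) (d + 1) t ?_)
  · refine Finset.card_le_card_of_injOn (fun p => p.2) ?_ ?_
    · rintro ⟨T, J, β⟩ hp
      exact (mem_flags.1 hp).2.2.1
    · have hTJ : ∀ T J β, (T, J, β) ∈ flags y Q t t R → T = J := by
        intro T J β hp
        obtain ⟨-, h2, h3, h4, -⟩ := mem_flags.1 hp
        exact (Finset.eq_of_subset_of_card_le h4 (by rw [h2, (mem_cubes.1 h3).2.1])).symm
      rintro ⟨T, J, β⟩ hp ⟨T', J', β'⟩ hp' he
      simp only [Prod.mk.injEq] at he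
      rw [hTJ _ _ _ hp, hTJ _ _ _ hp', he.1, he.2]
  · intro T hT
    have := card_le_of_shatters_signs y (fun x : EuclideanSpace ℝ (Fin d) => evDual x) R
      (cells y Q R) ?_ T hT
    · simpa using this
    · intro A hA
      obtain ⟨q, hq, rfl⟩ := Finset.mem_image.1 hA
      exact ⟨Finset.filter_subset _ _, q, fun i hi => ⟨hoff q hq i hi, by
        simp only [Finset.mem_filter, hi, true_and]; rfl⟩⟩

theorem le_descFactorial_of_recurrence {ι : Type*} [DecidableEq ι] (z : Finset ι → ℝ) (t : ℕ)
    (b : ℕ → ℝ) (C₀ : ℝ) (hC₀ : 0 ≤ C₀) (hz : ∀ R : Finset ι, R.card = t → z R ≤ C₀)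
    (hrec : ∀ R : Finset ι,
      ((R.card - t : ℕ) : ℝ) * z R ≤ ∑ h ∈ R, z (R.erase h) + b R.card) (r : ℕ) (hr : t ≤ r) :
    ∀ R : Finset ι, R.card = r → z R ≤ (r.descFactorial t : ℝ) *
      (C₀ + ∑ i ∈ Finset.Ioc t r, b i / (i.descFactorial (t + 1) : ℝ)) := by
  induction r, hr using Nat.le_induction with
  | base =>
    intro R hR
    have h1 : (1 : ℝ) ≤ (t.descFactorial t : ℝ) := by
      rw [Nat.descFactorial_self]; exact_mod_cast Nat.factorial_pos t
    rw [Finset.Ioc_self, Finset.sum_empty, add_zero]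
    nlinarith [hz R hR]
  | succ r hr ih =>
    intro R hR
    have h1 := hrec R
    rw [hR] at h1
    have h2 : ∑ h ∈ R, z (R.erase h) ≤ ((r + 1 : ℕ) : ℝ) * ((r.descFactorial t : ℝ) *
        (C₀ + ∑ i ∈ Finset.Ioc t r, b i / (i.descFactorial (t + 1) : ℝ))) := by
      rw [← hR, ← nsmul_eq_mul]
      refine Finset.sum_le_card_nsmul _ _ _ fun h hh => ih _ ?_
      rw [Finset.card_erase_of_mem hh, hR]; rfl
    have e1 : (((r + 1).descFactorial (t + 1) : ℕ) : ℝ) = ((r + 1 : ℕ) : ℝ) * r.descFactorial t := by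
      rw [Nat.succ_descFactorial_succ]; push_cast; ring
    have e2 : (((r + 1).descFactorial (t + 1) : ℕ) : ℝ) =
        ((r + 1 - t : ℕ) : ℝ) * (r + 1).descFactorial t := by
      rw [Nat.descFactorial_succ]; push_cast; ring
    have hpos : (0 : ℝ) < ((r + 1 - t : ℕ) : ℝ) := by
      exact_mod_cast Nat.sub_pos_of_lt (Nat.lt_succ_of_le hr)
    have hpos' : (0 : ℝ) < ((r + 1).descFactorial (t + 1) : ℕ) := by
      have : (r + 1).descFactorial (t + 1) ≠ 0 := fun h => by
        rw [Nat.descFactorial_eq_zero_iff_lt] at h; omega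
      exact_mod_cast Nat.pos_of_ne_zero this
    rw [← mul_assoc, ← e1] at h2
    refine le_of_mul_le_mul_left (h1.trans ?_) hpos
    rw [Finset.sum_Ioc_succ_top hr, ← mul_assoc, ← e2, ← add_assoc, mul_add _ (C₀ + _),
      mul_div_cancel₀ _ hpos'.ne']
    linarith

theorem pow_le_mul_descFactorial {i t : ℕ} (h : t < i) :
    i ^ (t + 1) ≤ (t + 1) ^ (t + 1) * i.descFactorial (t + 1) := by
  refine le_trans ?_ (Nat.mul_le_mul_left _ (Nat.pow_sub_le_descFactorial i (t + 1)))
  rw [← mul_pow]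
  refine Nat.pow_le_pow_left ?_ _
  obtain ⟨s, rfl⟩ := Nat.exists_eq_add_of_lt h
  have : t + s + 1 + 1 - (t + 1) = s + 1 := by omega
  rw [this]; nlinarith

/-- The number of flags of `R` is at most a constant times `r ^ (d - 1) * (log r) ^ p`, uniformly
over arrangements and over point sets in convex position. -/
def FlagBound (d t j p : ℕ) : Prop :=
  ∃ C : ℝ, 0 ≤ C ∧ ∀ (ι : Type) [DecidableEq ι] [Fintype ι]
    (y : ι → EuclideanSpace ℝ (Fin d) × ℝ) (Q : Finset (EuclideanSpace ℝ (Fin d))),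
    SimpleArr y → (∀ q ∈ Q, ∀ i, ev (y i) q ≠ 0) → (ConvexPos Q fun x => x) → ∀ R : Finset ι,
    ((flags y Q t j R).card : ℝ) ≤
      C * ((R.card : ℝ) + 1) ^ (d - 1) * (1 + Real.log ((R.card : ℝ) + 1)) ^ p

theorem one_le_one_add_log (r : ℕ) : (1 : ℝ) ≤ 1 + Real.log ((r : ℝ) + 1) := by
  have := Real.log_nonneg (x := (r : ℝ) + 1) (by have : (0 : ℝ) ≤ r := r.cast_nonneg; linarith)
  linarith

theorem card_flags_le_pow {d : ℕ} {ι : Type*} [DecidableEq ι]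
    (y : ι → EuclideanSpace ℝ (Fin d) × ℝ) (Q : Finset (EuclideanSpace ℝ (Fin d))) (t j : ℕ)
    (R : Finset ι) : (flags y Q t j R).card ≤ 8 ^ R.card := by
  have : flags y Q t j R ⊆ R.powerset ×ˢ R.powerset ×ˢ R.powerset := by
    rintro ⟨T, J, β⟩ h
    obtain ⟨h1, h2, h3, h4, h5⟩ := mem_flags.1 h
    obtain ⟨c1, c2, c3, c4, c5⟩ := mem_cubes.1 h3
    simp [h1, c1, c3]
  refine (Finset.card_le_card this).trans_eq ?_
  rw [Finset.card_product, Finset.card_product, Finset.card_powerset, ← mul_pow, ← mul_pow]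
  norm_num

theorem FlagBound.diag {d : ℕ} (hd : 0 < d) : FlagBound d (d - 1) (d - 1) 0 := by
  refine ⟨((d + 1).choose (d - 1) * 2 ^ d : ℕ), by positivity, ?_⟩
  intro ι _ _ y Q hy hoff hQ R
  have h1 := card_flags_diag_le y Q (d - 1) R fun q hq i _ => hoff q hq i
  have h2 := card_cells_le hd y Q hQ R fun q hq i _ => hoff q hq i
  have h3 := h1.trans (Nat.mul_le_mul_left _ h2)
  rw [pow_zero, mul_one]
  rw [← mul_assoc] at h3
  exact_mod_cast h3

theorem FlagBound.vertex {d j p : ℕ} (c : ℕ) (hc : 2 * c ≤ d - j + 1)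
    (h : FlagBound d (d - c) j p) : FlagBound d d j p := by
  obtain ⟨C, hC, h⟩ := h
  refine ⟨2 * C, by positivity, ?_⟩
  intro ι _ _ y Q hy hoff hQ R
  have h1 : ((flags y Q d j R).card : ℝ) ≤ 2 * (flags y Q (d - c) j R).card := by
    exact_mod_cast card_flags_vertex_le hy Q c j hc R
  have h2 := h ι y Q hy hoff hQ R
  calc _ ≤ _ := h1
    _ ≤ 2 * _ := mul_le_mul_of_nonneg_left h2 (by norm_num)
    _ = _ := by ring

theorem FlagBound.edge {d j p : ℕ} (hd : 0 < d) (h : FlagBound d d j p) :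
    FlagBound d (d - 1) j p := by
  obtain ⟨C, hC, h⟩ := h
  refine ⟨d * C + 8 ^ d, by positivity, ?_⟩
  intro ι _ _ y Q hy hoff hQ R
  have hL := one_le_one_add_log R.card
  have hr : (0 : ℝ) ≤ R.card := R.card.cast_nonneg
  have hX : (1 : ℝ) ≤ ((R.card : ℝ) + 1) ^ (d - 1) * (1 + Real.log ((R.card : ℝ) + 1)) ^ p :=
    one_le_mul_of_one_le_of_one_le (one_le_pow₀ (by linarith)) (one_le_pow₀ hL)
  rw [mul_assoc]
  rcases le_or_gt d R.card with hR | hR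
  · have h1 : ((flags y Q (d - 1) j R).card : ℝ) ≤ d * (flags y Q d j R).card := by
      exact_mod_cast card_flags_edge_le hy Q (d - 1) j (by omega) R hR
    have h2 := h ι y Q hy hoff hQ R
    rw [mul_assoc] at h2
    have h3 : (0 : ℝ) ≤ 8 ^ d := by positivity
    calc _ ≤ _ := h1
      _ ≤ d * _ := mul_le_mul_of_nonneg_left h2 (by positivity)
      _ ≤ _ := by nlinarith
  · have h1 : ((flags y Q (d - 1) j R).card : ℝ) ≤ 8 ^ d := by
      exact_mod_cast (card_flags_le_pow y Q (d - 1) j R).trans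
        (Nat.pow_le_pow_right (by norm_num) hR.le)
    have h3 : (0 : ℝ) ≤ d * C := by positivity
    have h4 : (0 : ℝ) ≤ 8 ^ d := by positivity
    nlinarith

theorem FlagBound.exists_recurrence_bound {d t j p : ℕ}
    (h : FlagBound d (t + 1) (j + 1) p) :
    ∃ B : ℝ, 0 ≤ B ∧ ∀ (ι : Type) [DecidableEq ι] [Fintype ι]
    (y : ι → EuclideanSpace ℝ (Fin d) × ℝ) (Q : Finset (EuclideanSpace ℝ (Fin d))),
    SimpleArr y → (∀ q ∈ Q, ∀ i, ev (y i) q ≠ 0) → (ConvexPos Q fun x => x) → ∀ R : Finset ι,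
    t ≤ R.card → ((flags y Q t j R).card : ℝ) ≤ (R.card : ℝ) ^ t * (8 ^ t +
      B * (1 + Real.log ((R.card : ℝ) + 1)) ^ p *
        ∑ i ∈ Finset.Ioc t R.card, (i : ℝ) ^ (d - 1) / (i : ℝ) ^ (t + 1)) := by
  obtain ⟨C, hC, h⟩ := h
  refine ⟨(j + 1) * C * 2 ^ (d - 1) * (t + 1) ^ (t + 1), by positivity, ?_⟩
  intro ι _ _ y Q hy hoff hQ R hR
  have key := le_descFactorial_of_recurrence (fun R => ((flags y Q t j R).card : ℝ)) t
    (fun r => (j + 1) * (C * ((r : ℝ) + 1) ^ (d - 1) * (1 + Real.log ((r : ℝ) + 1)) ^ p))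
    (8 ^ t) (by positivity) (fun R hR => by
      rw [← hR]; exact_mod_cast card_flags_le_pow y Q R.card j R)
    (fun R => by
      have h1 : ((R.card - t : ℕ) : ℝ) * (flags y Q t j R).card ≤
          ∑ h ∈ R, ((flags y Q t j (R.erase h)).card : ℝ) +
            (j + 1) * (flags y Q (t + 1) (j + 1) R).card := by
        exact_mod_cast flags_recurrence y Q t j R
      refine h1.trans ?_
      have := mul_le_mul_of_nonneg_left (h ι y Q hy hoff hQ R)
        (by positivity : (0 : ℝ) ≤ (j : ℝ) + 1)
      linarith) R.card hR R rfl
  refine key.trans ?_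
  have hF : ((R.card.descFactorial t : ℕ) : ℝ) ≤ (R.card : ℝ) ^ t := by
    exact_mod_cast Nat.descFactorial_le_pow _ _
  have hLR := one_le_one_add_log R.card
  refine mul_le_mul hF ?_ ?_ (by positivity)
  · refine add_le_add_right ?_ _
    rw [Finset.mul_sum]
    refine Finset.sum_le_sum fun i hi => ?_
    obtain ⟨hi1, hi2⟩ := Finset.mem_Ioc.1 hi
    have hi0 : (1 : ℝ) ≤ i := by exact_mod_cast (by omega : 1 ≤ i)
    have hiR : (i : ℝ) ≤ R.card := by exact_mod_cast hi2
    have hdf : ((i : ℝ)) ^ (t + 1) ≤ (t + 1) ^ (t + 1) * (i.descFactorial (t + 1) : ℝ) := by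
      exact_mod_cast pow_le_mul_descFactorial hi1
    have hdf0 : (0 : ℝ) < (i.descFactorial (t + 1) : ℝ) := by
      have : i.descFactorial (t + 1) ≠ 0 := fun h => by
        rw [Nat.descFactorial_eq_zero_iff_lt] at h; omega
      exact_mod_cast Nat.pos_of_ne_zero this
    have hi1' : ((i : ℝ) + 1) ^ (d - 1) ≤ 2 ^ (d - 1) * (i : ℝ) ^ (d - 1) := by
      rw [← mul_pow]; exact pow_le_pow_left₀ (by linarith) (by linarith) _
    have hlog : (1 + Real.log ((i : ℝ) + 1)) ^ p ≤ (1 + Real.log ((R.card : ℝ) + 1)) ^ p := by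
      have := one_le_one_add_log i
      refine pow_le_pow_left₀ (by linarith) ?_ _
      have := Real.log_le_log (x := (i : ℝ) + 1) (by linarith) (by linarith : (i : ℝ) + 1 ≤ R.card + 1)
      linarith
    have hlog0 : 0 ≤ (1 + Real.log ((i : ℝ) + 1)) ^ p :=
      pow_nonneg (by linarith [one_le_one_add_log i]) _
    rw [mul_div_assoc', div_le_div_iff₀ hdf0 (by positivity)]
    calc (j + 1) * (C * ((i : ℝ) + 1) ^ (d - 1) * (1 + Real.log ((i : ℝ) + 1)) ^ p) *
          (i : ℝ) ^ (t + 1)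
        ≤ (j + 1) * (C * (2 ^ (d - 1) * (i : ℝ) ^ (d - 1)) *
          (1 + Real.log ((R.card : ℝ) + 1)) ^ p) *
            ((t + 1) ^ (t + 1) * (i.descFactorial (t + 1) : ℝ)) := by gcongr
      _ = _ := by ring
  · refine add_nonneg (by positivity) (Finset.sum_nonneg fun i _ => ?_)
    have := one_le_one_add_log i
    positivity

theorem FlagBound.of_card_lt {d t j p : ℕ} {C : ℝ} (hC : 0 ≤ C)
    (h : ∀ (ι : Type) [DecidableEq ι] [Fintype ι]
    (y : ι → EuclideanSpace ℝ (Fin d) × ℝ) (Q : Finset (EuclideanSpace ℝ (Fin d))),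
    SimpleArr y → (∀ q ∈ Q, ∀ i, ev (y i) q ≠ 0) → (ConvexPos Q fun x => x) → ∀ R : Finset ι,
    t ≤ R.card → ((flags y Q t j R).card : ℝ) ≤
      C * ((R.card : ℝ) + 1) ^ (d - 1) * (1 + Real.log ((R.card : ℝ) + 1)) ^ p) :
    FlagBound d t j p := by
  refine ⟨C, hC, ?_⟩
  intro ι _ _ y Q hy hoff hQ R
  rcases le_or_gt t R.card with hR | hR
  · exact h ι y Q hy hoff hQ R hR
  · have : flags y Q t j R = ∅ := by
      rw [Finset.eq_empty_iff_forall_notMem]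
      rintro ⟨T, J, β⟩ hp
      obtain ⟨h1, h2, -⟩ := mem_flags.1 hp
      have := Finset.card_le_card h1
      omega
    rw [this]
    have := one_le_one_add_log R.card
    simp only [Finset.card_empty, Nat.cast_zero]
    positivity

theorem FlagBound.lower {d t j p : ℕ} (ht : t + 2 ≤ d) (h : FlagBound d (t + 1) (j + 1) p) :
    FlagBound d t j p := by
  obtain ⟨B, hB, h⟩ := h.exists_recurrence_bound
  refine FlagBound.of_card_lt (C := 8 ^ t + B) (by positivity) ?_
  intro ι _ _ y Q hy hoff hQ R hR
  refine (h ι y Q hy hoff hQ R hR).trans ?_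
  have hL := one_le_pow₀ (one_le_one_add_log R.card) (n := p)
  set r := R.card
  set L := (1 + Real.log ((r : ℝ) + 1)) ^ p
  have hr : (0 : ℝ) ≤ r := r.cast_nonneg
  have hsum : ∑ i ∈ Finset.Ioc t r, (i : ℝ) ^ (d - 1) / (i : ℝ) ^ (t + 1) ≤
      ((r : ℝ) + 1) ^ (d - 1 - t) := by
    have : ∀ i ∈ Finset.Ioc t r, (i : ℝ) ^ (d - 1) / (i : ℝ) ^ (t + 1) ≤
        ((r : ℝ) + 1) ^ (d - 2 - t) := by
      intro i hi
      obtain ⟨hi1, hi2⟩ := Finset.mem_Ioc.1 hi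
      have hi0 : (0 : ℝ) < i := by exact_mod_cast (by omega : 0 < i)
      have hiR : (i : ℝ) ≤ r := by exact_mod_cast hi2
      rw [div_le_iff₀ (by positivity)]
      have e : d - 1 = (d - 2 - t) + (t + 1) := by omega
      rw [e, pow_add]
      gcongr
      linarith
    refine (Finset.sum_le_card_nsmul _ _ _ this).trans ?_
    have e : d - 1 - t = (d - 2 - t) + 1 := by omega
    rw [nsmul_eq_mul, Nat.card_Ioc, e, pow_succ, mul_comm]
    refine mul_le_mul_of_nonneg_left ?_ (by positivity)
    have : ((r - t : ℕ) : ℝ) ≤ r := by exact_mod_cast Nat.sub_le _ _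
    linarith
  have h1 : (r : ℝ) ^ t ≤ ((r : ℝ) + 1) ^ t := pow_le_pow_left₀ hr (by linarith) _
  have h2 : (1 : ℝ) ≤ ((r : ℝ) + 1) ^ (d - 1 - t) := one_le_pow₀ (by linarith)
  have e : ((r : ℝ) + 1) ^ (d - 1) = ((r : ℝ) + 1) ^ t * ((r : ℝ) + 1) ^ (d - 1 - t) := by
    rw [← pow_add]; congr 1; omega
  calc (r : ℝ) ^ t * (8 ^ t + B * L * _)
      ≤ ((r : ℝ) + 1) ^ t * (8 ^ t * (((r : ℝ) + 1) ^ (d - 1 - t) * L) +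
          B * L * ((r : ℝ) + 1) ^ (d - 1 - t)) := by
        refine mul_le_mul h1 (add_le_add ?_ ?_) ?_ (by positivity)
        · exact le_mul_of_one_le_right (by positivity) (one_le_mul_of_one_le_of_one_le h2 hL)
        · exact mul_le_mul_of_nonneg_left hsum (by positivity)
        · refine add_nonneg (by positivity) (mul_nonneg (by positivity) ?_)
          exact Finset.sum_nonneg fun i _ => by positivity
    _ = _ := by rw [e]; ring

theorem FlagBound.lower_log {d j : ℕ} (hd : 0 < d) (h : FlagBound d d (j + 1) 0) :
    FlagBound d (d - 1) j 1 := by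
  obtain ⟨t, rfl⟩ : ∃ t, d = t + 1 := ⟨d - 1, by omega⟩
  rw [Nat.add_sub_cancel]
  obtain ⟨B, hB, h⟩ := h.exists_recurrence_bound
  refine FlagBound.of_card_lt (C := 8 ^ t + B) (by positivity) ?_
  intro ι _ _ y Q hy hoff hQ R hR
  refine (h ι y Q hy hoff hQ R hR).trans ?_
  have hL := one_le_one_add_log R.card
  set r := R.card
  set L := (1 + Real.log ((r : ℝ) + 1))
  have hr : (0 : ℝ) ≤ r := r.cast_nonneg
  have hsum : ∑ i ∈ Finset.Ioc t r, (i : ℝ) ^ (t + 1 - 1) / (i : ℝ) ^ (t + 1) ≤ L := by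
    have h1 : ∑ i ∈ Finset.Ioc t r, (i : ℝ) ^ (t + 1 - 1) / (i : ℝ) ^ (t + 1) ≤
        ∑ i ∈ Finset.Icc 1 r, (i : ℝ)⁻¹ := by
      refine (Finset.sum_le_sum (g := fun i : ℕ => (i : ℝ)⁻¹) fun i hi => ?_).trans
        (Finset.sum_le_sum_of_subset_of_nonneg ?_ fun i _ _ => by positivity)
      · have hi0 : (i : ℝ) ≠ 0 := by
          have := (Finset.mem_Ioc.1 hi).1
          exact_mod_cast (by omega : i ≠ 0)
        rw [Nat.add_sub_cancel, pow_succ]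
        field_simp
        exact le_refl _
      · intro i hi
        rw [Finset.mem_Ioc] at hi
        rw [Finset.mem_Icc]; omega
    have h2 := harmonic_le_one_add_log r
    rw [harmonic_eq_sum_Icc] at h2
    push_cast at h2
    have h3 : Real.log r ≤ Real.log ((r : ℝ) + 1) := by
      rcases Nat.eq_zero_or_pos r with h0 | h0
      · rw [h0]; simp
      · exact Real.log_le_log (by exact_mod_cast h0) (by linarith)
    linarith
  have h1 : (r : ℝ) ^ t ≤ ((r : ℝ) + 1) ^ t := pow_le_pow_left₀ hr (by linarith) _
  rw [Nat.add_sub_cancel] at hsum ⊢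
  rw [pow_zero, pow_one, mul_one]
  calc (r : ℝ) ^ t * (8 ^ t + B * _)
      ≤ ((r : ℝ) + 1) ^ t * (8 ^ t * L + B * L) := by
        refine mul_le_mul h1 (add_le_add ?_ ?_) ?_ (by positivity)
        · exact le_mul_of_one_le_right (by positivity) hL
        · exact mul_le_mul_of_nonneg_left hsum (by positivity)
        · refine add_nonneg (by positivity) (mul_nonneg (by positivity) ?_)
          exact Finset.sum_nonneg fun i _ => by positivity
    _ = _ := by ring

theorem flagBound_gap {d : ℕ} (hd : 0 < d) (m : ℕ) :
    ∀ t, m + 1 ≤ t → t < d → FlagBound d t (t - (m + 1)) 1 := by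
  have down : ∀ m, (m + 1 < d → FlagBound d (d - 1) (d - 1 - (m + 1)) 1) →
      ∀ t, m + 1 ≤ t → t < d → FlagBound d t (t - (m + 1)) 1 := by
    intro m h0
    have : ∀ s t, t + 1 + s = d → m + 1 ≤ t → FlagBound d t (t - (m + 1)) 1 := by
      intro s
      induction s with
      | zero =>
        intro t h1 h2
        have e : t = d - 1 := by omega
        rw [e]
        exact h0 (by omega)
      | succ s ih =>
        intro t h1 h2
        refine FlagBound.lower (by omega) ?_
        have := ih (t + 1) (by omega) (by omega)
        rwa [show t + 1 - (m + 1) = t - (m + 1) + 1 by omega] at this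
    intro t h1 h2
    exact this (d - 1 - t) t (by omega) h1
  induction m with
  | zero =>
    refine down 0 fun h => FlagBound.lower_log hd ?_
    rw [show d - 1 - (0 + 1) + 1 = d - 1 by omega]
    exact FlagBound.vertex 1 (by omega) (FlagBound.diag hd)
  | succ m ih =>
    refine down (m + 1) fun h => FlagBound.edge hd (FlagBound.vertex 2 (by omega) ?_)
    have := ih (d - 2) (by omega) (by omega)
    rwa [show d - 2 - (m + 1) = d - 1 - (m + 1 + 1) by omega] at this

/-- Zone theorem: the cells marked by a set in convex position have `O(r ^ (d - 1) log r)` vertices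
in total. -/
theorem flagBound_vertices {d : ℕ} (hd : 3 ≤ d) : FlagBound d d 0 1 := by
  refine FlagBound.vertex 2 (by omega) ?_
  have := flagBound_gap (d := d) (by omega) (d - 3) (d - 2) (by omega) (by omega)
  rwa [show d - 2 - (d - 3 + 1) = 0 by omega] at this

/-- The probability that a Bernoulli subset of `P` meets `A` exactly in `q`. -/
theorem sum_bernoulli_inter_eq_singleton {α : Type*} [DecidableEq α] (P A : Finset α) (q : α)
    (hq : q ∈ A) (hA : A ⊆ P) (τ : ℝ) :
    ∑ S ∈ P.powerset.filter (fun S => A ∩ S = {q}), τ ^ S.card * (1 - τ) ^ (P \ S).card =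
      τ * (1 - τ) ^ (A.card - 1) := by
  let f : α → ℝ := fun x => if x ∈ A.erase q then 0 else τ
  let g : α → ℝ := fun x => if x = q then 0 else 1 - τ
  have h1 := Finset.prod_add f g P
  have h2 : ∏ x ∈ P, (f x + g x) = τ * (1 - τ) ^ (A.card - 1) := by
    rw [← Finset.prod_subset hA (fun x _ hx => by
      have : x ≠ q := fun h => hx (h ▸ hq)
      simp [f, g, hx, this]), ← Finset.mul_prod_erase A _ hq]
    congr 1
    · simp [f, g]
    · rw [Finset.prod_congr rfl (g := fun _ => 1 - τ), Finset.prod_const,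
        Finset.card_erase_of_mem hq]
      intro x hx
      simp only [f, g, if_pos hx, if_neg (Finset.ne_of_mem_erase hx), zero_add]
  rw [← h2, h1, Finset.sum_filter]
  refine Finset.sum_congr rfl fun S hS => ?_
  split_ifs with h
  · have hqS : q ∈ S := by
      have : q ∈ A ∩ S := by rw [h]; exact Finset.mem_singleton_self q
      exact (Finset.mem_inter.1 this).2
    rw [Finset.prod_congr rfl (g := fun _ => τ), Finset.prod_const,
      Finset.prod_congr rfl (g := fun _ => 1 - τ), Finset.prod_const]
    · intro x hx
      have : x ≠ q := fun e => (Finset.mem_sdiff.1 hx).2 (e ▸ hqS)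
      simp only [g, if_neg this]
    · intro x hx
      have : x ∉ A.erase q := fun e => by
        have h3 : x ∈ A ∩ S := Finset.mem_inter.2 ⟨Finset.mem_of_mem_erase e, hx⟩
        rw [h] at h3
        exact Finset.ne_of_mem_erase e (Finset.mem_singleton.1 h3)
      simp only [f, if_neg this]
  · symm
    by_cases hqS : q ∈ S
    · obtain ⟨x, hx, hxq⟩ : ∃ x ∈ A ∩ S, x ≠ q := by
        by_contra hcon
        push Not at hcon
        exact h (Finset.eq_singleton_iff_unique_mem.2 ⟨Finset.mem_inter.2 ⟨hq, hqS⟩, hcon⟩)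
      obtain ⟨hx1, hx2⟩ := Finset.mem_inter.1 hx
      rw [Finset.prod_eq_zero hx2, zero_mul]
      simp only [f, if_pos (Finset.mem_erase.2 ⟨hxq, hx1⟩)]
    · rw [Finset.prod_eq_zero (s := P \ S) (Finset.mem_sdiff.2 ⟨hA hq, hqS⟩), mul_zero]
      simp [g]

theorem sum_bernoulli_weights {α : Type*} [DecidableEq α] (P : Finset α) (τ : ℝ) :
    ∑ S ∈ P.powerset, τ ^ S.card * (1 - τ) ^ (P \ S).card = 1 := by
  have h1 := Finset.prod_add (fun _ => τ) (fun _ => 1 - τ) P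
  simp only [Finset.prod_const, add_sub_cancel, one_pow] at h1
  exact h1.symm

/-- A set of `k`-shallow points carries a random subset in convex position that hits every set of
`m ≤ k` points with probability at least `m / (8 k)`. -/
theorem exists_random_convexPos {d : ℕ} (P : Finset (EuclideanSpace ℝ (Fin d))) (k : ℕ)
    (hk : 0 < k) (hP : ∀ p ∈ P, IsShallowPt P k p) :
    ∃ (w : Finset (EuclideanSpace ℝ (Fin d)) → ℝ)
      (Q : Finset (EuclideanSpace ℝ (Fin d)) → Finset (EuclideanSpace ℝ (Fin d))),
      (∀ S, 0 ≤ w S) ∧ ∑ S ∈ P.powerset, w S = 1 ∧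
      (∀ S ∈ P.powerset, Q S ⊆ P ∧ ConvexPos (Q S) fun x => x) ∧
      ∀ W ⊆ P, W.card ≤ k →
        (W.card : ℝ) / (8 * k) ≤ ∑ S ∈ P.powerset.filter (fun S => (W ∩ Q S).Nonempty), w S := by
  have hk' : (1 : ℝ) ≤ k := by exact_mod_cast hk
  set τ : ℝ := 1 / (4 * k) with hτ
  have hτ0 : 0 ≤ τ := by positivity
  have hτ1 : τ ≤ 1 := by rw [hτ, div_le_one (by positivity)]; linarith
  have hkτ : k * τ = 1 / 4 := by rw [hτ]; field_simp
  choose! a b ha hmem hcard using hP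
  let h : EuclideanSpace ℝ (Fin d) → Finset (EuclideanSpace ℝ (Fin d)) := fun q =>
    P.filter fun x => x ∈ halfspace (a q) (b q)
  have hh : ∀ q ∈ P, q ∈ h q ∧ (h q).card ≤ k := by
    intro q hq
    refine ⟨Finset.mem_filter.2 ⟨hq, hmem q hq⟩, ?_⟩
    have := hcard q hq
    rwa [← Set.ncard_coe_finset, Finset.coe_filter]
  refine ⟨fun S => τ ^ S.card * (1 - τ) ^ (P \ S).card,
    fun S => S.filter fun q => h q ∩ S = {q}, fun S => ?_, sum_bernoulli_weights P τ, ?_, ?_⟩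
  · exact mul_nonneg (pow_nonneg hτ0 _) (pow_nonneg (by linarith) _)
  · intro S hS
    have hSP := Finset.mem_powerset.1 hS
    refine ⟨(Finset.filter_subset _ _).trans hSP, fun q hq => ?_⟩
    obtain ⟨hq1, hq2⟩ := Finset.mem_filter.1 hq
    refine ⟨(innerSL ℝ (a q)).toLinearMap, fun q' hq' hne => ?_⟩
    have hq's := (Finset.mem_filter.1 hq').1
    have h1 : ⟪q, a q⟫ ≤ b q := hmem q (hSP hq1)
    have h2 : b q < ⟪q', a q⟫ := by
      by_contra hcon
      have : q' ∈ h q ∩ S := Finset.mem_inter.2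
        ⟨Finset.mem_filter.2 ⟨hSP hq's, not_lt.1 hcon⟩, hq's⟩
      rw [hq2] at this
      exact hne (Finset.mem_singleton.1 this)
    have := h1.trans_lt h2
    simpa [real_inner_comm] using this
  · intro W hW hWk
    have hdisj : (W : Set (EuclideanSpace ℝ (Fin d))).PairwiseDisjoint
        fun q => P.powerset.filter fun S => (h q ∪ W) ∩ S = {q} := by
      intro q hq q' hq' hne
      refine Finset.disjoint_left.2 fun S h1 h2 => hne ?_
      have e1 := (Finset.mem_filter.1 h1).2
      have e2 := (Finset.mem_filter.1 h2).2
      have : q ∈ (h q ∪ W) ∩ S := by rw [e1]; simp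
      have hqS := (Finset.mem_inter.1 this).2
      have : q ∈ (h q' ∪ W) ∩ S :=
        Finset.mem_inter.2 ⟨Finset.mem_union_right _ hq, hqS⟩
      rw [e2] at this
      exact Finset.mem_singleton.1 this
    have hsub : (W.biUnion fun q => P.powerset.filter fun S => (h q ∪ W) ∩ S = {q}) ⊆
        P.powerset.filter
          fun S => (W ∩ S.filter fun q => h q ∩ S = {q}).Nonempty := by
      intro S hS
      obtain ⟨q, hq, hS⟩ := Finset.mem_biUnion.1 hS
      obtain ⟨hS1, hS2⟩ := Finset.mem_filter.1 hS
      have hqS : q ∈ S := by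
        have : q ∈ (h q ∪ W) ∩ S := by rw [hS2]; simp
        exact (Finset.mem_inter.1 this).2
      refine Finset.mem_filter.2 ⟨hS1, q, Finset.mem_inter.2 ⟨hq, Finset.mem_filter.2 ⟨hqS, ?_⟩⟩⟩
      refine Finset.Subset.antisymm ?_ ?_
      · rw [← hS2]; exact Finset.inter_subset_inter_right Finset.subset_union_left
      · exact Finset.singleton_subset_iff.2 (Finset.mem_inter.2 ⟨(hh q (hW hq)).1, hqS⟩)
    refine le_trans ?_ (Finset.sum_le_sum_of_subset_of_nonneg hsub fun S _ _ =>
      mul_nonneg (pow_nonneg hτ0 _) (pow_nonneg (by linarith) _))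
    rw [Finset.sum_biUnion hdisj]
    have hterm : ∀ q ∈ W, 1 / (8 * (k : ℝ)) ≤
        ∑ S ∈ P.powerset.filter (fun S => (h q ∪ W) ∩ S = {q}),
          τ ^ S.card * (1 - τ) ^ (P \ S).card := by
      intro q hq
      rw [sum_bernoulli_inter_eq_singleton P _ q (Finset.mem_union_right _ hq)
        (Finset.union_subset (Finset.filter_subset _ _) hW)]
      have hc : (h q ∪ W).card - 1 ≤ 2 * k := by
        have := Finset.card_union_le (h q) W
        have := (hh q (hW hq)).2
        omega
      have h1 : (1 - τ) ^ (2 * k) ≤ (1 - τ) ^ ((h q ∪ W).card - 1) :=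
        pow_le_pow_of_le_one (by linarith) (by linarith) hc
      have h2 := one_add_mul_le_pow (a := -τ) (by linarith) (2 * k)
      have h3 : (1 : ℝ) / 2 ≤ (1 - τ) ^ ((h q ∪ W).card - 1) := by
        refine le_trans ?_ h1
        refine le_trans ?_ (h2.trans_eq (by ring))
        push_cast; linarith
      calc 1 / (8 * (k : ℝ)) = τ * (1 / 2) := by rw [hτ]; field_simp; norm_num
        _ ≤ _ := mul_le_mul_of_nonneg_left h3 hτ0
    calc (W.card : ℝ) / (8 * k) = ∑ q ∈ W, 1 / (8 * (k : ℝ)) := by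
          rw [Finset.sum_const, nsmul_eq_mul]; ring
      _ ≤ _ := Finset.sum_le_sum hterm

theorem sum_le_of_card_filter_le {σ κ : Type*} (Ω : Finset σ) (w : σ → ℝ) (hw : ∀ S, 0 ≤ w S)
    (hw1 : ∑ S ∈ Ω, w S = 1) (T : Finset κ) (E : κ → σ → Prop) [∀ t S, Decidable (E t S)] (p : κ → ℝ)
    (hp : ∀ t ∈ T, p t ≤ ∑ S ∈ Ω.filter (fun S => E t S), w S) (M : ℝ)
    (hM : ∀ S ∈ Ω, ((T.filter fun t => E t S).card : ℝ) ≤ M) : ∑ t ∈ T, p t ≤ M := by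
  calc ∑ t ∈ T, p t ≤ ∑ t ∈ T, ∑ S ∈ Ω, if E t S then w S else 0 :=
        Finset.sum_le_sum fun t ht => (hp t ht).trans_eq (Finset.sum_filter _ _)
    _ = ∑ S ∈ Ω, ∑ t ∈ T, if E t S then w S else 0 := Finset.sum_comm
    _ = ∑ S ∈ Ω, w S * (T.filter fun t => E t S).card := by
        refine Finset.sum_congr rfl fun S _ => ?_
        rw [← Finset.sum_filter, Finset.sum_const, nsmul_eq_mul, mul_comm]
    _ ≤ ∑ S ∈ Ω, w S * M :=
        Finset.sum_le_sum fun S hS => mul_le_mul_of_nonneg_left (hM S hS) (hw S)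
    _ = M := by rw [← Finset.sum_mul, hw1, one_mul]

/-- The points of `P` with the same sign vector on `R` as `p`. -/
def signClass {d : ℕ} {ι : Type*} [DecidableEq ι] (y : ι → EuclideanSpace ℝ (Fin d) × ℝ)
    (P : Finset (EuclideanSpace ℝ (Fin d))) (R A : Finset ι) :
    Finset (EuclideanSpace ℝ (Fin d)) :=
  P.filter fun q => (R.filter fun i => 0 < ev (y i) q) = A

theorem card_light_le {d : ℕ} (hd : 0 < d) {ι : Type*} [DecidableEq ι]
    (y : ι → EuclideanSpace ℝ (Fin d) × ℝ) (P : Finset (EuclideanSpace ℝ (Fin d)))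
    (hoff : ∀ p ∈ P, ∀ i, ev (y i) p ≠ 0) (k : ℕ) (hk : 0 < k)
    (hP : ∀ p ∈ P, IsShallowPt P k p) (R : Finset ι) :
    ((P.filter fun p =>
      (signClass y P R (R.filter fun i => 0 < ev (y i) p)).card ≤ k).card : ℝ) ≤
      8 * k * (2 ^ d * ((R.card : ℝ) + 1) ^ (d - 1)) := by
  obtain ⟨w, Q, hw, hw1, hQ, hhit⟩ := exists_random_convexPos P k hk hP
  have hk' : (0 : ℝ) < k := by exact_mod_cast hk
  set 𝒜 := (cells y P R).filter fun A => (signClass y P R A).card ≤ k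
  have h1 := sum_le_of_card_filter_le P.powerset w hw hw1 𝒜
    (fun A S => (signClass y P R A ∩ Q S).Nonempty)
    (fun A => ((signClass y P R A).card : ℝ) / (8 * k))
    (fun A hA => hhit (signClass y P R A) (Finset.filter_subset _ _) (Finset.mem_filter.1 hA).2)
    (2 ^ d * ((R.card : ℝ) + 1) ^ (d - 1)) (by
      intro S hS
      have h2 : (cells y (Q S) R).card ≤ _ := card_cells_le hd y (Q S) (hQ S hS).2 R
        fun q hq i _ => hoff q ((hQ S hS).1 hq) i
      have h3 : (𝒜.filter fun A => (signClass y P R A ∩ Q S).Nonempty) ⊆ cells y (Q S) R := by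
        intro A hA
        obtain ⟨q, hq⟩ := (Finset.mem_filter.1 hA).2
        obtain ⟨hq1, hq2⟩ := Finset.mem_inter.1 hq
        exact Finset.mem_image.2 ⟨q, hq2, (Finset.mem_filter.1 hq1).2⟩
      exact_mod_cast (Finset.card_le_card h3).trans h2)
  rw [← Finset.sum_div, div_le_iff₀ (by positivity)] at h1
  refine le_trans ?_ (h1.trans_eq (mul_comm _ _))
  have h4 := Finset.card_eq_sum_card_fiberwise
    (s := P.filter fun p => (signClass y P R (R.filter fun i => 0 < ev (y i) p)).card ≤ k)
    (f := fun p => R.filter fun i => 0 < ev (y i) p) (t := 𝒜) (by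
      intro p hp
      obtain ⟨hp1, hp2⟩ := Finset.mem_filter.1 (Finset.mem_coe.1 hp)
      exact Finset.mem_coe.2 (Finset.mem_filter.2 ⟨Finset.mem_image_of_mem _ hp1, hp2⟩))
  rw [h4]
  push_cast
  refine Finset.sum_le_sum fun A _ => ?_
  exact_mod_cast Finset.card_le_card (Finset.filter_subset_filter _ (Finset.filter_subset _ _))

theorem card_heavy_le {d : ℕ} {ι : Type} [Fintype ι] [DecidableEq ι]
    (y : ι → EuclideanSpace ℝ (Fin d) × ℝ)
    (P : Finset (EuclideanSpace ℝ (Fin d)))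
    (hoff : ∀ p ∈ P, ∀ i, ev (y i) p ≠ 0) (k : ℕ) (hk : 0 < k)
    (hP : ∀ p ∈ P, IsShallowPt P k p) (B : EuclideanSpace ℝ (Fin d) → Finset ι)
    (hB : ∀ p ∈ P, (B p).card = d ∧ ∃ v, (∀ i ∈ B p, ev (y i) v = 0) ∧
        ∀ i, i ∉ B p → ev (y i) v ≠ 0 ∧ (0 < ev (y i) v ↔ 0 < ev (y i) p))
    (hinj : Set.InjOn B P) (r : ℕ) (Z : ℝ)
    (hZ : ∀ Q : Finset (EuclideanSpace ℝ (Fin d)), (∀ q ∈ Q, ∀ i, ev (y i) q ≠ 0) →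
      (ConvexPos Q fun x => x) → ∀ U : Finset ι, U.card = r + d →
      ((flags y Q d 0 U).card : ℝ) ≤ Z) :
    (((P ×ˢ Finset.univ.powersetCard r).filter fun x : _ × Finset ι => Disjoint (B x.1) x.2 ∧
      k < (signClass y P x.2 (x.2.filter fun i => 0 < ev (y i) x.1)).card).card : ℝ) ≤
      8 * ((Fintype.card ι).choose (r + d) * Z) := by
  obtain ⟨w, Q, hw, hw1, hQ, hhit⟩ := exists_random_convexPos P k hk hP
  have hk' : (0 : ℝ) < k := by exact_mod_cast hk
  set 𝒬 := (P ×ˢ Finset.univ.powersetCard r).filter fun x : _ × Finset ι =>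
    Disjoint (B x.1) x.2 ∧
      k < (signClass y P x.2 (x.2.filter fun i => 0 < ev (y i) x.1)).card
  have h1 := sum_le_of_card_filter_le P.powerset w hw hw1 𝒬
    (fun x S => ∃ q ∈ Q S, q ∈ signClass y P x.2 (x.2.filter fun i => 0 < ev (y i) x.1))
    (fun _ => (1 : ℝ) / 8)
    (by
      intro x hx
      obtain ⟨hx1, hx2, hx3⟩ := Finset.mem_filter.1 hx
      obtain ⟨W, hW, hWc⟩ := Finset.exists_subset_card_eq hx3.le
      have := hhit W (hW.trans (Finset.filter_subset _ _)) hWc.le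
      rw [hWc] at this
      refine (le_of_eq ?_).trans (this.trans (Finset.sum_le_sum_of_subset_of_nonneg ?_ ?_))
      · field_simp
      · intro S hS
        obtain ⟨hS1, q, hq⟩ := Finset.mem_filter.1 hS
        obtain ⟨hq1, hq2⟩ := Finset.mem_inter.1 hq
        exact Finset.mem_filter.2 ⟨hS1, q, hq2, hW hq1⟩
      · intro S _ _; exact hw S)
    ((Fintype.card ι).choose (r + d) * Z) (by
      intro S hS
      obtain ⟨hQ1, hQ2⟩ := hQ S hS
      have hoffQ : ∀ q ∈ Q S, ∀ i, ev (y i) q ≠ 0 := fun q hq => hoff q (hQ1 hq)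
      have h2 : ((((Finset.univ : Finset ι).powersetCard (r + d)).sigma
          fun U => flags y (Q S) d 0 U).card : ℝ) ≤ (Fintype.card ι).choose (r + d) * Z := by
        rw [Finset.card_sigma]
        push_cast
        refine (Finset.sum_le_card_nsmul _ _ Z fun U hU => hZ _ hoffQ hQ2 U
          (Finset.mem_powersetCard.1 hU).2).trans_eq ?_
        rw [Finset.card_powersetCard, nsmul_eq_mul, Finset.card_univ]
      refine le_trans ?_ h2
      norm_cast
      have hch : ∀ x ∈ 𝒬.filter (fun x => ∃ q ∈ Q S,
          q ∈ signClass y P x.2 (x.2.filter fun i => 0 < ev (y i) x.1)), ∃ q ∈ Q S,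
          q ∈ signClass y P x.2 (x.2.filter fun i => 0 < ev (y i) x.1) :=
        fun x hx => (Finset.mem_filter.1 hx).2
      choose! q hq1 hq2 using hch
      refine Finset.card_le_card_of_injOn (fun x => ⟨x.2 ∪ B x.1, B x.1, ∅,
        (x.2 ∪ B x.1).filter fun i => 0 < ev (y i) (q x)⟩) ?_ ?_
      · intro x hx
        have hx' := Finset.mem_coe.1 hx
        obtain ⟨hx0, -⟩ := Finset.mem_filter.1 hx'
        obtain ⟨hx1, hx2, -⟩ := Finset.mem_filter.1 hx0
        obtain ⟨hxP, hxr⟩ := Finset.mem_product.1 hx1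
        obtain ⟨hBc, v, hv1, hv2⟩ := hB _ hxP
        have hqc := (Finset.mem_filter.1 (hq2 x hx')).2
        refine Finset.mem_coe.2 (Finset.mem_sigma.2 ⟨Finset.mem_powersetCard.2
          ⟨Finset.subset_univ _, ?_⟩, mem_flags.2 ⟨Finset.subset_union_right, hBc,
          mem_cubes.2 ⟨Finset.empty_subset _, rfl, Finset.filter_subset _ _,
          Finset.disjoint_empty_left _, ?_⟩, Finset.empty_subset _, v, hv1, ?_⟩⟩)
        · rw [Finset.card_union_of_disjoint hx2.symm, (Finset.mem_powersetCard.1 hxr).2, hBc]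
        · intro ε hε
          rw [Finset.subset_empty.1 hε, Finset.empty_union]
          exact Finset.mem_image.2 ⟨q x, hq1 x hx', rfl⟩
        · intro i hi hiB
          have hiR : i ∈ x.2 := (Finset.mem_union.1 hi).resolve_right hiB
          refine ⟨(hv2 i hiB).1, (hv2 i hiB).2.trans ?_⟩
          have := Finset.ext_iff.1 hqc i
          simp only [Finset.mem_filter, hiR, true_and] at this
          simp only [Finset.mem_filter, hi, true_and, this]
      · intro x hx x' hx' he
        obtain ⟨hx1, hx2, -⟩ := Finset.mem_filter.1 (Finset.mem_filter.1 (Finset.mem_coe.1 hx)).1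
        obtain ⟨hx'1, hx'2, -⟩ :=
          Finset.mem_filter.1 (Finset.mem_filter.1 (Finset.mem_coe.1 hx')).1
        have hU : x.2 ∪ B x.1 = x'.2 ∪ B x'.1 := congrArg Sigma.fst he
        have hT : B x.1 = B x'.1 := congrArg (fun s => s.2.1) he
        refine Prod.ext (hinj (Finset.mem_product.1 hx1).1 (Finset.mem_product.1 hx'1).1 hT) ?_
        rw [← Finset.union_sdiff_cancel_right hx2.symm, hU, hT,
          Finset.union_sdiff_cancel_right hx'2.symm])
  rw [Finset.sum_const, nsmul_eq_mul] at h1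
  linarith

theorem choose_sub_mul_card_le {d : ℕ} (hd : 3 ≤ d) : ∃ C : ℝ, 0 ≤ C ∧
    ∀ (ι : Type) [Fintype ι] [DecidableEq ι] (y : ι → EuclideanSpace ℝ (Fin d) × ℝ)
      (P : Finset (EuclideanSpace ℝ (Fin d))) (k : ℕ) (B : EuclideanSpace ℝ (Fin d) → Finset ι),
      SimpleArr y → (∀ p ∈ P, ∀ i, ev (y i) p ≠ 0) → 0 < k → (∀ p ∈ P, IsShallowPt P k p) →
      (∀ p ∈ P, (B p).card = d ∧ ∃ v, (∀ i ∈ B p, ev (y i) v = 0) ∧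
        ∀ i, i ∉ B p → ev (y i) v ≠ 0 ∧ (0 < ev (y i) v ↔ 0 < ev (y i) p)) →
      Set.InjOn B P → ∀ r : ℕ,
      (P.card : ℝ) * (Fintype.card ι - d).choose r ≤
        (Fintype.card ι).choose r * (C * k * ((r : ℝ) + 1) ^ (d - 1)) +
        (Fintype.card ι).choose (r + d) * (C * (((r + d : ℕ) : ℝ) + 1) ^ (d - 1) *
          (1 + Real.log (((r + d : ℕ) : ℝ) + 1))) := by
  obtain ⟨Cz, hCz, hz⟩ := flagBound_vertices hd
  refine ⟨8 * 2 ^ d + 8 * Cz, by positivity, ?_⟩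
  intro ι _ _ y P k B hy hoff hk hP hB hinj r
  have hheavy := card_heavy_le y P hoff k hk hP B hB hinj r
    (Cz * (((r + d : ℕ) : ℝ) + 1) ^ (d - 1) * (1 + Real.log (((r + d : ℕ) : ℝ) + 1))) (by
      intro Q hQ1 hQ2 U hU
      have := hz ι y Q hy hQ1 hQ2 U
      rwa [hU, pow_one] at this)
  have hlight : (((P ×ˢ Finset.univ.powersetCard r).filter fun x : _ × Finset ι =>
      (signClass y P x.2 (x.2.filter fun i => 0 < ev (y i) x.1)).card ≤ k).card : ℝ) ≤
      (Fintype.card ι).choose r * (8 * k * (2 ^ d * ((r : ℝ) + 1) ^ (d - 1))) := by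
    have h1 := Finset.card_eq_sum_card_fiberwise
      (s := (P ×ˢ Finset.univ.powersetCard r).filter fun x : _ × Finset ι =>
      (signClass y P x.2 (x.2.filter fun i => 0 < ev (y i) x.1)).card ≤ k)
      (f := Prod.snd) (t := Finset.univ.powersetCard r) (by
        intro x hx
        exact (Finset.mem_product.1 (Finset.mem_filter.1 (Finset.mem_coe.1 hx)).1).2)
    rw [h1]
    push_cast
    refine (Finset.sum_le_card_nsmul _ _ (8 * k * (2 ^ d * ((r : ℝ) + 1) ^ (d - 1)))
      fun R hR => ?_).trans_eq ?_
    · have h2 := card_light_le (by omega) y P hoff k hk hP R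
      rw [(Finset.mem_powersetCard.1 hR).2] at h2
      refine le_trans ?_ h2
      norm_cast
      refine Finset.card_le_card_of_injOn Prod.fst ?_ ?_
      · intro x hx
        obtain ⟨hx1, hx2⟩ := Finset.mem_filter.1 (Finset.mem_coe.1 hx)
        obtain ⟨hx3, hx4⟩ := Finset.mem_filter.1 hx1
        rw [hx2] at hx4
        exact Finset.mem_coe.2 (Finset.mem_filter.2 ⟨(Finset.mem_product.1 hx3).1, hx4⟩)
      · intro x hx x' hx' he
        exact Prod.ext he ((Finset.mem_filter.1 (Finset.mem_coe.1 hx)).2.trans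
          (Finset.mem_filter.1 (Finset.mem_coe.1 hx')).2.symm)
    · rw [Finset.card_powersetCard, nsmul_eq_mul, Finset.card_univ]
  have hall : (P.card : ℝ) * (Fintype.card ι - d).choose r =
      (((P ×ˢ Finset.univ.powersetCard r).filter fun x : _ × Finset ι =>
        Disjoint (B x.1) x.2).card : ℝ) := by
    have h1 := Finset.card_eq_sum_card_fiberwise
      (s := (P ×ˢ Finset.univ.powersetCard r).filter fun x : _ × Finset ι =>
        Disjoint (B x.1) x.2) (f := Prod.fst) (t := P) (by
        intro x hx
        exact (Finset.mem_product.1 (Finset.mem_filter.1 (Finset.mem_coe.1 hx)).1).1)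
    rw [h1, Finset.sum_congr rfl (g := fun _ => (Fintype.card ι - d).choose r)]
    · simp
    · intro p hp
      have e : (Fintype.card ι - d).choose r = ((B p)ᶜ.powersetCard r).card := by
        rw [Finset.card_powersetCard, Finset.card_compl, (hB p hp).1]
      rw [e]
      symm
      refine Finset.card_bij (fun R _ => (p, R)) ?_ ?_ ?_
      · intro R hR
        obtain ⟨hR1, hR2⟩ := Finset.mem_powersetCard.1 hR
        refine Finset.mem_filter.2 ⟨Finset.mem_filter.2 ⟨Finset.mem_product.2 ⟨hp,
          Finset.mem_powersetCard.2 ⟨Finset.subset_univ _, hR2⟩⟩, ?_⟩, rfl⟩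
        exact Finset.disjoint_left.2 fun i hi hi' => Finset.mem_compl.1 (hR1 hi') hi
      · intro R _ R' _ he; exact congrArg Prod.snd he
      · intro x hx
        obtain ⟨hx1, hx2⟩ := Finset.mem_filter.1 hx
        obtain ⟨hx3, hx4⟩ := Finset.mem_filter.1 hx1
        subst hx2
        refine ⟨x.2, Finset.mem_powersetCard.2 ⟨fun i hi => Finset.mem_compl.2 fun hi' =>
          Finset.disjoint_left.1 hx4 hi' hi,
          (Finset.mem_powersetCard.1 (Finset.mem_product.1 hx3).2).2⟩, rfl⟩
  have hcover : (((P ×ˢ Finset.univ.powersetCard r).filter fun x : _ × Finset ι =>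
        Disjoint (B x.1) x.2).card : ℝ) ≤
      ((P ×ˢ Finset.univ.powersetCard r).filter fun x : _ × Finset ι =>
      (signClass y P x.2 (x.2.filter fun i => 0 < ev (y i) x.1)).card ≤ k).card +
      ((P ×ˢ Finset.univ.powersetCard r).filter fun x : _ × Finset ι => Disjoint (B x.1) x.2 ∧
      k < (signClass y P x.2 (x.2.filter fun i => 0 < ev (y i) x.1)).card).card := by
    norm_cast
    refine le_trans (Finset.card_le_card ?_) (Finset.card_union_le _ _)
    intro x hx
    obtain ⟨hx1, hx2⟩ := Finset.mem_filter.1 hx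
    rcases le_or_gt (signClass y P x.2 (x.2.filter fun i => 0 < ev (y i) x.1)).card k with h | h
    · exact Finset.mem_union_left _ (Finset.mem_filter.2 ⟨hx1, h⟩)
    · exact Finset.mem_union_right _ (Finset.mem_filter.2 ⟨hx1, hx2, h⟩)
  rw [hall]
  refine (hcover.trans (add_le_add hlight hheavy)).trans (add_le_add ?_ ?_)
  · refine mul_le_mul_of_nonneg_left ?_ (by positivity)
    have : (0 : ℝ) ≤ Cz * k * ((r : ℝ) + 1) ^ (d - 1) := by positivity
    nlinarith
  · have hL := one_le_one_add_log (r + d)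
    have h0 : (0 : ℝ) ≤ (((r + d : ℕ) : ℝ) + 1) ^ (d - 1) *
      (1 + Real.log (((r + d : ℕ) : ℝ) + 1)) := by positivity
    rw [mul_left_comm]
    refine mul_le_mul_of_nonneg_left ?_ (by positivity)
    have : (0 : ℝ) ≤ 2 ^ d * ((((r + d : ℕ) : ℝ) + 1) ^ (d - 1) *
      (1 + Real.log (((r + d : ℕ) : ℝ) + 1))) := by positivity
    nlinarith

theorem choose_add_mul_pow_le (m r : ℕ) (d : ℕ) :
    m.choose (r + d) * (r + 1) ^ d ≤ m.choose r * m ^ d := by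
  induction d with
  | zero => simp
  | succ d ih =>
    have h := Nat.choose_succ_right_eq m (r + d)
    calc m.choose (r + (d + 1)) * (r + 1) ^ (d + 1)
        = m.choose (r + d + 1) * (r + 1) * (r + 1) ^ d := by rw [← add_assoc]; ring
      _ ≤ m.choose (r + d + 1) * (r + d + 1) * (r + 1) ^ d := by gcongr; omega
      _ = m.choose (r + d) * (r + 1) ^ d * (m - (r + d)) := by rw [h]; ring
      _ ≤ m.choose r * m ^ d * m := Nat.mul_le_mul ih (Nat.sub_le _ _)
      _ = _ := by ring

theorem choose_le_two_mul_choose_sub {m d r : ℕ} (h : 4 * d * r ≤ m) :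
    (m.choose r : ℝ) ≤ 2 * (m - d).choose r := by
  rcases Nat.eq_zero_or_pos r with rfl | hr
  · simp
  rcases Nat.eq_zero_or_pos d with rfl | hd
  · simp; linarith [(m.choose r).cast_nonneg (α := ℝ)]
  have hm : 4 * d ≤ m := le_trans (Nat.le_mul_of_pos_right _ hr) h
  have hm0 : (0 : ℝ) < m := by exact_mod_cast (by omega : 0 < m)
  have hr0 : (0 : ℝ) ≤ r := r.cast_nonneg
  have hmr : (4 : ℝ) * d * r ≤ m := by exact_mod_cast h
  have key : ∀ i ≤ d, (m.choose r : ℝ) * (1 - 2 * i * r / m) ≤ (m - i).choose r := by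
    intro i
    induction i with
    | zero => simp
    | succ i ih =>
      intro hi
      obtain ⟨n, hn⟩ : ∃ n, m - i = n + 1 := ⟨m - i - 1, by omega⟩
      have ih := ih (by omega)
      rw [hn] at ih
      rw [show m - (i + 1) = n by omega]
      have e := Nat.choose_mul_succ_eq n r
      have hrn : r ≤ n + 1 := by
        have : 4 * 1 * r ≤ 4 * d * r := by gcongr; exact hd
        omega
      have e' : (n.choose r : ℝ) * (n + 1) = (n + 1).choose r * (n + 1 - r) := by
        have := congrArg (Nat.cast (R := ℝ)) e
        push_cast [Nat.cast_sub hrn] at this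
        exact this
      have hn2 : (m : ℝ) ≤ 2 * (n + 1) := by exact_mod_cast (by omega : m ≤ 2 * (n + 1))
      have hn0 : (0 : ℝ) < n + 1 := by positivity
      have e2 : (n.choose r : ℝ) = (n + 1).choose r * (1 - r / (n + 1)) := by
        field_simp; linarith
      have hdiv : (r : ℝ) / (n + 1) ≤ 2 * r / m := by
        rw [div_le_div_iff₀ hn0 hm0]; nlinarith
      have hid : ((i : ℝ) + 1) ≤ d := by exact_mod_cast hi
      have h1 : (0 : ℝ) ≤ 1 - 2 * r / m := by
        rw [sub_nonneg, div_le_one hm0]; nlinarith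
      rw [e2]
      have hpos : (0 : ℝ) ≤ 2 * i * r / m * (2 * r / m) := by positivity
      calc (m.choose r : ℝ) * (1 - 2 * (i + 1 : ℕ) * r / m)
          ≤ (m.choose r : ℝ) * ((1 - 2 * i * r / m) * (1 - 2 * r / m)) := by
            refine mul_le_mul_of_nonneg_left ?_ (by positivity)
            push_cast
            have : 2 * ((i : ℝ) + 1) * r / m = 2 * i * r / m + 2 * r / m := by ring
            nlinarith
        _ = (m.choose r : ℝ) * (1 - 2 * i * r / m) * (1 - 2 * r / m) := by ring
        _ ≤ (n + 1).choose r * (1 - 2 * r / m) := mul_le_mul_of_nonneg_right ih h1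
        _ ≤ _ := mul_le_mul_of_nonneg_left (by linarith) (by positivity)
  have := key d le_rfl
  have h2 : 2 * (d : ℝ) * r / m ≤ 1 / 2 := by
    rw [div_le_iff₀ hm0]; linarith
  have h3 : (0 : ℝ) ≤ m.choose r := by positivity
  nlinarith

/-- A set of `k`-shallow points all of whose sign vectors with respect to `m` hyperplanes are
distinct has `O(k y ^ (d - 1) log y)` elements, `y = 1 + m / k ^ (1 / d)`. -/
theorem card_le_of_distinct_signs {d : ℕ} (hd : 3 ≤ d) : ∃ C : ℝ, 0 ≤ C ∧
    ∀ (ι : Type) [Fintype ι] [DecidableEq ι] (y : ι → EuclideanSpace ℝ (Fin d) × ℝ)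
      (box : Fin d ↪ ι) (P : Finset (EuclideanSpace ℝ (Fin d))) (k : ℕ),
      SimpleArr y → (∀ p ∈ P, ∀ i, ev (y i) p ≠ 0) → (∀ p ∈ P, ∀ j, 0 < ev (y (box j)) p) →
      (∀ p ∈ P, ∀ q ∈ P, (∀ i, 0 < ev (y i) p ↔ 0 < ev (y i) q) → p = q) →
      0 < k → (∀ p ∈ P, IsShallowPt P k p) →
      P.card ≤ Fintype.card ι ^ d ∧
      (P.card : ℝ) ≤ C * k * (1 + Fintype.card ι / (k : ℝ) ^ (1 / (d : ℝ))) ^ (d - 1) *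
        (1 + Real.log (1 + Fintype.card ι / (k : ℝ) ^ (1 / (d : ℝ)))) := by
  obtain ⟨C, hC, hcount⟩ := choose_sub_mul_card_le hd
  refine ⟨2 * (C + (4 * d) ^ d * C * (d + 1) ^ (d - 1) * (1 + Real.log (d + 1))), ?_, ?_⟩
  · have := one_le_one_add_log d
    positivity
  intro ι _ _ y box P k hy hoff hbox hsep hk hP
  obtain ⟨B, hB, hBsep⟩ := exists_bottom_map hy box P hoff hbox
  have hinj : Set.InjOn B P := fun p hp q hq he => hsep p hp q hq (hBsep p hp q hq he)
  set m := Fintype.card ι with hm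
  refine ⟨?_, ?_⟩
  · calc P.card ≤ ((Finset.univ : Finset ι).powersetCard d).card :=
          Finset.card_le_card_of_injOn B (fun p hp => Finset.mem_coe.2
            (Finset.mem_powersetCard.2 ⟨Finset.subset_univ _, (hB p hp).1⟩)) hinj
      _ = m.choose d := by rw [Finset.card_powersetCard, Finset.card_univ]
      _ ≤ m ^ d := Nat.choose_le_pow _ _
  have hk' : (1 : ℝ) ≤ k := by exact_mod_cast hk
  have hdR : (3 : ℝ) ≤ d := by exact_mod_cast hd
  set K : ℝ := (k : ℝ) ^ (1 / (d : ℝ)) with hK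
  have hK1 : 1 ≤ K := Real.one_le_rpow hk' (by positivity)
  have hKd : K ^ d = k := by
    rw [hK, ← Real.rpow_natCast, ← Real.rpow_mul (by positivity), one_div,
      inv_mul_cancel₀ (by positivity), Real.rpow_one]
  set Y : ℝ := 1 + m / K with hY
  have hY1 : 1 ≤ Y := by rw [hY, le_add_iff_nonneg_right]; positivity
  set r := ⌊(m : ℝ) / (4 * d * K)⌋₊ with hr
  have hr1 : (r : ℝ) ≤ m / (4 * d * K) := Nat.floor_le (by positivity)
  have hr2 : (m : ℝ) / (4 * d * K) < r + 1 := Nat.lt_floor_add_one _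
  rw [le_div_iff₀ (by positivity)] at hr1
  rw [div_lt_iff₀ (by positivity)] at hr2
  have hr0 : (0 : ℝ) ≤ r := r.cast_nonneg
  have hrm : 4 * d * r ≤ m := by
    have : (4 : ℝ) * d * r ≤ m := by
      refine le_trans ?_ hr1
      have : (0 : ℝ) ≤ 4 * d * r := by positivity
      nlinarith
    exact_mod_cast this
  have hrY : (r : ℝ) + 1 ≤ Y := by
    rw [hY, add_comm, add_le_add_iff_left, le_div_iff₀ (by positivity)]
    refine le_trans ?_ hr1
    have : (0 : ℝ) ≤ r * K := by positivity
    nlinarith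
  have hrdY : ((r + d : ℕ) : ℝ) + 1 ≤ (d + 1) * Y := by push_cast; nlinarith
  have h := hcount ι y P k B hy hoff hk hP hB hinj r
  rw [← hm] at h
  have hc1 := choose_le_two_mul_choose_sub hrm
  have hc0 : (0 : ℝ) < m.choose r := by
    exact_mod_cast Nat.choose_pos (le_trans (Nat.le_mul_of_pos_left _ (by omega)) hrm)
  have hc2 : (m.choose (r + d) : ℝ) ≤ m.choose r * ((4 * d) ^ d * k) := by
    have h1 : (m.choose (r + d) : ℝ) * ((r : ℝ) + 1) ^ d ≤ m.choose r * (m : ℝ) ^ d := by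
      exact_mod_cast choose_add_mul_pow_le m r d
    have h2 : (m : ℝ) ^ d ≤ (4 * d) ^ d * k * ((r : ℝ) + 1) ^ d := by
      rw [← hKd, ← mul_pow, ← mul_pow]
      refine pow_le_pow_left₀ (by positivity) ?_ _
      linarith
    have h3 : (0 : ℝ) < ((r : ℝ) + 1) ^ d := by positivity
    refine le_of_mul_le_mul_right ?_ h3
    nlinarith
  have hL := one_le_one_add_log d
  have hlogY : 0 ≤ Real.log Y := Real.log_nonneg hY1
  have hlog : 1 + Real.log (((r + d : ℕ) : ℝ) + 1) ≤
      (1 + Real.log ((d : ℝ) + 1)) * (1 + Real.log Y) := by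
    have h1 := Real.log_le_log (by positivity) hrdY
    rw [Real.log_mul (by positivity) (by positivity)] at h1
    nlinarith
  have hlog0 := one_le_one_add_log (r + d)
  have hA : C * k * ((r : ℝ) + 1) ^ (d - 1) ≤ C * k * Y ^ (d - 1) * (1 + Real.log Y) := by
    have h1 : ((r : ℝ) + 1) ^ (d - 1) ≤ Y ^ (d - 1) := pow_le_pow_left₀ (by positivity) hrY _
    have h2 : C * k * ((r : ℝ) + 1) ^ (d - 1) ≤ C * k * Y ^ (d - 1) := by gcongr
    refine h2.trans (le_mul_of_one_le_right (by positivity) (by linarith))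
  have hBd : C * (((r + d : ℕ) : ℝ) + 1) ^ (d - 1) * (1 + Real.log (((r + d : ℕ) : ℝ) + 1)) ≤
      C * ((d + 1) ^ (d - 1) * Y ^ (d - 1)) *
        ((1 + Real.log ((d : ℝ) + 1)) * (1 + Real.log Y)) := by
    rw [← mul_pow]
    gcongr
  have hB2 := mul_le_mul hc2 hBd (by positivity) (by positivity)
  have hA2 := mul_le_mul_of_nonneg_left hA hc0.le
  have hN := mul_le_mul_of_nonneg_left hc1 (P.card.cast_nonneg (α := ℝ))
  refine le_of_mul_le_mul_left ?_ hc0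
  calc (m.choose r : ℝ) * P.card = P.card * m.choose r := mul_comm _ _
    _ ≤ P.card * (2 * (m - d).choose r) := hN
    _ = 2 * (P.card * (m - d).choose r) := by ring
    _ ≤ 2 * (m.choose r * (C * k * Y ^ (d - 1) * (1 + Real.log Y)) +
        m.choose r * ((4 * d) ^ d * k) * (C * ((d + 1) ^ (d - 1) * Y ^ (d - 1)) *
        ((1 + Real.log ((d : ℝ) + 1)) * (1 + Real.log Y)))) :=
        mul_le_mul_of_nonneg_left (h.trans (add_le_add hA2 hB2)) (by norm_num)
    _ = _ := by ring

theorem IsShallowPt.mono {d : ℕ} {P P' : Finset (EuclideanSpace ℝ (Fin d))} {k : ℕ}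
    {p : EuclideanSpace ℝ (Fin d)} (h : IsShallowPt P k p) (hP : P' ⊆ P) : IsShallowPt P' k p := by
  obtain ⟨a, b, ha, hp, hc⟩ := h
  exact ⟨a, b, ha, hp, (Set.ncard_le_ncard (Set.inter_subset_inter_left _ (Finset.coe_subset.2 hP))
    (P.finite_toSet.inter_of_left _)).trans hc⟩

theorem card_le_of_shatters_image_pos {d : ℕ} {ι : Type*} [Fintype ι] [DecidableEq ι]
    (y : ι → EuclideanSpace ℝ (Fin d) × ℝ)
    (P : Finset (EuclideanSpace ℝ (Fin d))) (hoff : ∀ i, ∀ p ∈ P, ev (y i) p ≠ 0)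
    (T : Finset ι) (hT : (P.image fun x => Finset.univ.filter fun i => 0 < ev (y i) x).Shatters T) :
    T.card ≤ d + 1 := by
  have h := card_le_of_shatters_signs y evDual Finset.univ _ (by
    intro A hA
    obtain ⟨x, hx, rfl⟩ := Finset.mem_image.1 hA
    refine ⟨Finset.subset_univ _, x, fun i _ => ⟨hoff i x hx, ?_⟩⟩
    rw [Finset.mem_filter]
    exact ⟨fun h => h.2, fun h => ⟨Finset.mem_univ _, h⟩⟩) T hT
  simpa using h

/-- Many pairwise well-separated shallow points cannot exist: bound on the number of points split
by `s` hyperplanes. -/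
theorem card_le_of_many_classes {d : ℕ} (hd : 3 ≤ d) : ∃ C : ℝ, 0 ≤ C ∧
    ∀ (s : ℕ) (y : Fin s → EuclideanSpace ℝ (Fin d) × ℝ) (P : Finset (EuclideanSpace ℝ (Fin d)))
      (k n : ℕ), (∀ i, ∀ p ∈ P, ev (y i) p ≠ 0) → 0 < k → (∀ p ∈ P, IsShallowPt P k p) →
      n ≤ 2 * (P.image fun x => Finset.univ.filter fun i => 0 < ev (y i) x).card →
      (n : ℝ) ≤ 2 * ((s : ℝ) + d) ^ d ∧
      (n : ℝ) ≤ C * k * (1 + ((s : ℝ) + d) / (k : ℝ) ^ (1 / (d : ℝ))) ^ (d - 1) *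
        (1 + Real.log (1 + ((s : ℝ) + d) / (k : ℝ) ^ (1 / (d : ℝ)))) := by
  obtain ⟨C, hC, h⟩ := card_le_of_distinct_signs hd
  refine ⟨2 * C, by positivity, ?_⟩
  intro s y P k n hoff hk hP hn
  obtain ⟨P₁, hP₁, hinj, himg⟩ := Finset.exists_subset_injOn_image_eq_of_surjOn
    (f := fun x => Finset.univ.filter fun i => 0 < ev (y i) x) P
    (P.image fun x => Finset.univ.filter fun i => 0 < ev (y i) x) (by
      intro A hA
      obtain ⟨q, hq, rfl⟩ := Finset.mem_image.1 (Finset.mem_coe.1 hA)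
      exact ⟨q, hq, rfl⟩)
  rw [← himg, Finset.card_image_of_injOn hinj] at hn
  obtain ⟨y', hy', hsgn⟩ := exists_simple_perturbation (ι := Fin s ⊕ Fin d) P
    (Sum.elim y fun _ => (0, -1)) (by
      rintro (i | j) p hp
      · exact hoff i p hp
      · simp [ev])
  have := h (Fin s ⊕ Fin d) y' Function.Embedding.inr P₁ k hy'
    (fun p hp i => (hsgn i p (hP₁ hp)).1)
    (fun p hp j => (hsgn (Sum.inr j) p (hP₁ hp)).2.2 (by simp [ev]))
    (by
      intro p hp q hq hpq
      refine hinj hp hq ?_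
      ext i
      have h1 := (hsgn (Sum.inl i) p (hP₁ hp)).2
      have h2 := (hsgn (Sum.inl i) q (hP₁ hq)).2
      have h3 := hpq (Sum.inl i)
      simp only [Sum.elim_inl] at h1 h2
      simp only [Finset.mem_filter, Finset.mem_univ, true_and]
      rw [← h1, ← h2, h3]) hk (fun p hp => (hP p (hP₁ hp)).mono hP₁)
  rw [Fintype.card_sum, Fintype.card_fin, Fintype.card_fin] at this
  obtain ⟨h1, h2⟩ := this
  push_cast at h2
  have hn' : (n : ℝ) ≤ 2 * P₁.card := by exact_mod_cast hn
  have h1' : (P₁.card : ℝ) ≤ ((s : ℝ) + d) ^ d := by exact_mod_cast h1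
  constructor
  · linarith
  · linarith

theorem false_of_card_bounds {d : ℕ} (hd : 3 ≤ d) {C ε K k z x σ : ℝ} (hC : 0 ≤ C) (hε0 : 0 < ε)
    (hεC : ε * (4 * (1 + C)) = 1) (hK1 : 1 ≤ K) (hKd : K ^ d = k) (hz : 0 < z)
    (hx1 : 1 ≤ x) (hzx' : z ≤ x) (hzx : z ^ (d - 1) * (1 + Real.log x) ^ 2 ≤ x) (hσ : 0 ≤ σ)
    (hsd : σ ≤ ε * z * K) (h1 : x * k ≤ 2 * σ ^ d)
    (h2 : x * k ≤ C * k * (1 + σ / K) ^ (d - 1) * (1 + Real.log (1 + σ / K))) : False := by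
  have hk0 : 0 < k := by rw [← hKd]; positivity
  have hL : 0 ≤ Real.log x := Real.log_nonneg hx1
  set L := 1 + Real.log x with hLdef
  have hL1 : 1 ≤ L := by linarith
  have hsK : σ / K ≤ ε * z := by rwa [div_le_iff₀ (by positivity)]
  have hsd0 : 0 ≤ σ / K := by positivity
  have hε4 : ε ≤ 1 / 4 := by nlinarith
  rcases le_or_gt 1 (ε * z) with hcase | hcase
  · set Y := 1 + σ / K with hY
    have hY0 : 1 ≤ Y := by linarith
    have hY1 : Y ≤ 2 * ε * z := by linarith
    have hlogY : Real.log Y ≤ Real.log x := by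
      refine Real.log_le_log (by linarith) ?_
      nlinarith
    have hYd : Y ^ (d - 1) * L ^ 2 ≤ 2 * ε * x := by
      calc Y ^ (d - 1) * L ^ 2 ≤ (2 * ε * z) ^ (d - 1) * L ^ 2 := by gcongr
        _ = (2 * ε) ^ (d - 1) * (z ^ (d - 1) * L ^ 2) := by rw [mul_pow]; ring
        _ ≤ 2 * ε * x := by
          gcongr
          exact pow_le_of_le_one (by positivity) (by linarith) (by omega)
    have hlL : 1 + Real.log Y ≤ L ^ 2 := by nlinarith
    have h3 : x * k ≤ C * k * (2 * ε * x) := by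
      calc x * k ≤ C * k * Y ^ (d - 1) * (1 + Real.log Y) := h2
        _ ≤ C * k * Y ^ (d - 1) * L ^ 2 := mul_le_mul_of_nonneg_left hlL (by positivity)
        _ = C * k * (Y ^ (d - 1) * L ^ 2) := by ring
        _ ≤ _ := mul_le_mul_of_nonneg_left hYd (by positivity)
    have h4 : 0 < x * k := by positivity
    have h5 : 2 * (C * ε) ≤ 1 / 2 := by nlinarith
    have h6 : C * k * (2 * ε * x) = 2 * (C * ε) * (x * k) := by ring
    nlinarith
  · have h3 : x * k ≤ 2 * (ε * z) ^ d * k := by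
      calc x * k ≤ 2 * σ ^ d := h1
        _ ≤ 2 * (ε * z * K) ^ d := by gcongr
        _ = _ := by rw [mul_pow, hKd]; ring
    have h4 : (ε * z) ^ d ≤ (ε * z) ^ 2 := pow_le_pow_of_le_one (by positivity) hcase.le (by omega)
    have h5 : x ≤ 2 * (ε * z) ^ 2 := by
      refine le_of_mul_le_mul_right (h3.trans ?_) hk0
      exact mul_le_mul_of_nonneg_right (mul_le_mul_of_nonneg_left h4 (by norm_num)) hk0.le
    have h6 : ε * z ≤ 1 / 4 * x := mul_le_mul hε4 hzx' hz.le (by norm_num)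
    have h7 : 0 < ε * z := by positivity
    nlinarith

theorem exists_pair_few_separating {d : ℕ} (hd : 3 ≤ d) : ∃ A : ℝ, 0 < A ∧
    ∀ (κ : Type) [Fintype κ] (y : κ → EuclideanSpace ℝ (Fin d) × ℝ)
      (P : Finset (EuclideanSpace ℝ (Fin d))) (μ : κ → ℝ) (k : ℕ) (z : ℝ),
      (∀ i, ∀ p ∈ P, ev (y i) p ≠ 0) → (∀ h, 0 ≤ μ h) → ∑ h, μ h = 1 → 0 < k → k ≤ P.card →
      2 ≤ P.card → (∀ p ∈ P, IsShallowPt P k p) → 0 < z →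
      z ^ (d - 1) * (1 + Real.log ((P.card : ℝ) / k)) ^ 2 ≤ (P.card : ℝ) / k →
      ∃ p ∈ P, ∃ q ∈ P, p ≠ q ∧
        ∑ h ∈ Finset.univ.filter (fun h => ¬ (0 < ev (y h) p ↔ 0 < ev (y h) q)), μ h ≤
          A / ((k : ℝ) ^ (1 / (d : ℝ)) * z) := by
  obtain ⟨C, hC, hcls⟩ := card_le_of_many_classes hd
  have hdR : (3 : ℝ) ≤ d := by exact_mod_cast hd
  set c : ℝ := 4 * (d + 1) + 1 + d with hc
  set ε : ℝ := 1 / (4 * (1 + C)) with hε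
  have hε0 : 0 < ε := by positivity
  have hεC : ε * (4 * (1 + C)) = 1 := by rw [hε]; field_simp
  refine ⟨c / ε, by positivity, ?_⟩
  intro κ _ y P μ k z hoff hμ hμ1 hk hkn hn hP hz hzx
  set n := P.card with hnP
  have hk' : (1 : ℝ) ≤ k := by exact_mod_cast hk
  set K : ℝ := (k : ℝ) ^ (1 / (d : ℝ)) with hK
  have hK1 : 1 ≤ K := Real.one_le_rpow hk' (by positivity)
  have hKd : K ^ d = k := by
    rw [hK, ← Real.rpow_natCast, ← Real.rpow_mul (by positivity), one_div,
      inv_mul_cancel₀ (by positivity), Real.rpow_one]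
  set x : ℝ := (n : ℝ) / k with hx
  have hnx : (n : ℝ) = x * k := by rw [hx]; field_simp
  have hx1 : 1 ≤ x := by
    rw [hx, one_le_div (by positivity)]; exact_mod_cast hkn
  have hL : 0 ≤ Real.log x := Real.log_nonneg hx1
  set L := 1 + Real.log x with hLdef
  have hL1 : 1 ≤ L := by linarith
  have hzd : z ^ (d - 1) ≤ x := by
    refine le_trans ?_ hzx
    exact le_mul_of_one_le_right (by positivity) (one_le_pow₀ hL1)
  have hzx' : z ≤ x := by
    rcases le_total z 1 with h | h
    · exact h.trans hx1
    · exact (le_self_pow₀ h (by omega)).trans hzd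
  set δ := c / ε / (K * z) with hδ
  have hδ0 : 0 < δ := by positivity
  by_contra hno
  have hcon : ∀ p ∈ P, ∀ q ∈ P, p ≠ q → δ <
      ∑ h ∈ Finset.univ.filter (fun h => ¬ (0 < ev (y h) p ↔ 0 < ev (y h) q)), μ h :=
    fun p hp q hq hpq => not_le.1 fun h => hno ⟨p, hp, q, hq, hpq, h⟩
  have hc0 : 0 < c := by positivity
  have hδ1 : δ < 1 := by
    obtain ⟨p, hp, q, hq, hpq⟩ := Finset.one_lt_card.1 (show 1 < P.card by omega)
    refine (hcon p hp q hq hpq).trans_le ?_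
    rw [← hμ1]
    exact Finset.sum_le_sum_of_subset_of_nonneg (Finset.filter_subset _ _) fun h _ _ => hμ h
  set s := ⌈4 * ((d : ℝ) + 1) / δ⌉₊ with hs
  have hs1 : 4 * ((d : ℝ) + 1) / δ ≤ s := Nat.le_ceil _
  have hs2 : (s : ℝ) < 4 * ((d : ℝ) + 1) / δ + 1 := Nat.ceil_lt_add_one (by positivity)
  obtain ⟨g, hg⟩ := exists_many_classes P μ hμ hμ1 (fun h x => 0 < ev (y h) x) (d + 1) s
    (fun m g T hT => card_le_of_shatters_image_pos (fun i => y (g i)) P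
      (fun i => hoff (g i)) T hT) δ hδ0 (fun p hp q hq hpq => (hcon p hp q hq hpq).le) (by
      rw [div_le_iff₀ hδ0] at hs1
      push_cast; nlinarith)
  obtain ⟨h1, h2⟩ := hcls s (fun i => y (g i)) P k n (fun i => hoff (g i)) hk hP hg
  have hsd : (s : ℝ) + d ≤ ε * z * K := by
    have e : c / δ = ε * z * K := by rw [hδ]; field_simp
    have h3 : 1 ≤ 1 / δ := by rw [le_div_iff₀ hδ0]; linarith
    have h4 : c / δ = 4 * ((d : ℝ) + 1) / δ + 1 / δ + d * (1 / δ) := by rw [hc]; ring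
    have h5 : (d : ℝ) ≤ d * (1 / δ) := le_mul_of_one_le_right (by positivity) h3
    rw [← e, h4]; linarith
  rw [hnx] at h1 h2
  exact false_of_card_bounds hd hC hε0 hεC hK1 hKd hz hx1 hzx' hzx (by positivity) hsd h1 h2

/-- The edges of `E` whose endpoints lie on different sides. -/
def sepEdges {α : Type*} (side : α → Prop) (E : Finset (α × α)) : Finset (α × α) :=
  E.filter fun e => ¬ (side e.1 ↔ side e.2)

/-- Iterated reweighting: if every subset contains a pair separated by few sides, then the points
can be connected by edges such that no side separates many of them. -/
theorem exists_connecting_edges {α κ : Type*} [Fintype κ] [Nonempty κ] (side : κ → α → Prop)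
    (δ : ℕ → ℝ) (n : ℕ) :
    ∀ P : Finset α, P.card = n + 1 →
    (∀ P' ⊆ P, 2 ≤ P'.card → ∀ μ : κ → ℝ, (∀ h, 0 ≤ μ h) → ∑ h, μ h = 1 →
      ∃ p ∈ P', ∃ q ∈ P', p ≠ q ∧
        ∑ h ∈ Finset.univ.filter (fun h => ¬ (side h p ↔ side h q)), μ h ≤ δ P'.card) →
    ∀ w : κ → ℝ, (∀ h, 0 < w h) →
    ∃ E : Finset (α × α), (∀ p ∈ P, ∀ q ∈ P, Relation.EqvGen (fun a b => (a, b) ∈ E) p q) ∧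
      ∑ h, w h * 2 ^ (sepEdges (side h) E).card ≤
        (∑ h, w h) * ∏ i ∈ Finset.range n, (1 + δ (i + 2)) := by
  induction n with
  | zero =>
    intro P hP _ w _
    refine ⟨∅, fun p hp q hq => ?_, by simp [sepEdges]⟩
    rw [Finset.card_le_one.1 hP.le p hp q hq]
    exact Relation.EqvGen.refl q
  | succ n ih =>
    intro P hP hpair w hw
    have hW : 0 < ∑ h, w h := Finset.sum_pos (fun h _ => hw h) Finset.univ_nonempty
    obtain ⟨p, hp, q, hq, hpq, hδ⟩ := hpair P Finset.Subset.rfl (by omega)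
      (fun h => w h / ∑ h, w h) (fun h => div_nonneg (hw h).le hW.le)
      (by rw [← Finset.sum_div, div_self hW.ne'])
    rw [← Finset.sum_div, div_le_iff₀ hW, hP] at hδ
    set w' : κ → ℝ := fun h => w h * if ¬ (side h p ↔ side h q) then 2 else 1 with hw'
    obtain ⟨E, hE1, hE2⟩ := ih (P.erase p) (by rw [Finset.card_erase_of_mem hp, hP]; rfl)
      (fun P' hP' => hpair P' (hP'.trans (Finset.erase_subset _ _))) w' (fun h => by
        have := hw h
        simp only [hw']; split_ifs <;> linarith)
    have hsum : ∑ h, w' h ≤ (∑ h, w h) * (1 + δ (n + 2)) := by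
      have : ∑ h, w' h = ∑ h, w h +
          ∑ h ∈ Finset.univ.filter (fun h => ¬ (side h p ↔ side h q)), w h := by
        rw [Finset.sum_filter, ← Finset.sum_add_distrib]
        refine Finset.sum_congr rfl fun h _ => ?_
        simp only [hw']; split_ifs <;> ring
      rw [this]; linarith
    refine ⟨insert (p, q) E, ?_, ?_⟩
    · have hmono : ∀ a b, Relation.EqvGen (fun a b => (a, b) ∈ E) a b →
          Relation.EqvGen (fun a b => (a, b) ∈ insert (p, q) E) a b := fun a b h =>
        h.mono fun _ _ h => Finset.mem_insert_of_mem h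
      have hall : ∀ a ∈ P, Relation.EqvGen (fun a b => (a, b) ∈ insert (p, q) E) a q := by
        intro a ha
        by_cases hap : a = p
        · subst hap
          exact Relation.EqvGen.rel _ _ (Finset.mem_insert_self _ _)
        · exact hmono _ _ (hE1 a (Finset.mem_erase.2 ⟨hap, ha⟩) q
            (Finset.mem_erase.2 ⟨hpq.symm, hq⟩))
      exact fun a ha b hb => (hall a ha).trans _ _ _ ((hall b hb).symm _ _)
    · have hprod : 0 ≤ ∏ i ∈ Finset.range n, (1 + δ (i + 2)) := by
        by_contra hneg
        push Not at hneg
        have hW' : 0 < ∑ h, w' h := Finset.sum_pos (fun h _ => by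
          have := hw h
          simp only [hw']; split_ifs <;> linarith) Finset.univ_nonempty
        have h0 : 0 ≤ ∑ h, w' h * 2 ^ (sepEdges (side h) E).card :=
          Finset.sum_nonneg fun h _ => mul_nonneg (by
            have := hw h
            simp only [hw']; split_ifs <;> linarith) (by positivity)
        nlinarith
      rw [Finset.prod_range_succ]
      calc ∑ h, w h * 2 ^ (sepEdges (side h) (insert (p, q) E)).card
          ≤ ∑ h, w' h * 2 ^ (sepEdges (side h) E).card := by
            refine Finset.sum_le_sum fun h _ => ?_
            simp only [hw', mul_assoc]
            refine mul_le_mul_of_nonneg_left ?_ (hw h).le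
            unfold sepEdges
            by_cases hs : (side h p ↔ side h q)
            · rw [Finset.filter_insert, if_neg (not_not.2 hs), if_neg (not_not.2 hs), one_mul]
            · rw [Finset.filter_insert, if_pos hs, if_pos hs, ← pow_succ']
              exact pow_le_pow_right₀ (by norm_num) (Finset.card_insert_le _ _)
        _ ≤ _ := hE2
        _ ≤ (∑ h, w h) * (1 + δ (n + 2)) * ∏ i ∈ Finset.range n, (1 + δ (i + 2)) :=
            mul_le_mul_of_nonneg_right hsum hprod
        _ = _ := by ring

theorem exists_connecting_edges_card_le {α κ : Type*} [Fintype κ] [Nonempty κ]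
    (side : κ → α → Prop) (δ : ℕ → ℝ) (hδ0 : ∀ i, 0 ≤ δ i) (n : ℕ) (P : Finset α)
    (hP : P.card = n + 1)
    (hpair : ∀ P' ⊆ P, 2 ≤ P'.card → ∀ μ : κ → ℝ, (∀ h, 0 ≤ μ h) → ∑ h, μ h = 1 →
      ∃ p ∈ P', ∃ q ∈ P', p ≠ q ∧
        ∑ h ∈ Finset.univ.filter (fun h => ¬ (side h p ↔ side h q)), μ h ≤ δ P'.card) :
    ∃ E : Finset (α × α), (∀ p ∈ P, ∀ q ∈ P, Relation.EqvGen (fun a b => (a, b) ∈ E) p q) ∧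
      ∀ h, (sepEdges (side h) E).card * Real.log 2 ≤
        Real.log (Fintype.card κ) + ∑ i ∈ Finset.range n, δ (i + 2) := by
  obtain ⟨E, hE1, hE2⟩ := exists_connecting_edges side δ n P hP hpair (fun _ => 1)
    fun _ => one_pos
  refine ⟨E, hE1, fun h => ?_⟩
  simp only [one_mul, Finset.sum_const, Finset.card_univ, nsmul_eq_mul, mul_one] at hE2
  have h1 : (2 : ℝ) ^ (sepEdges (side h) E).card ≤
      ∑ h, (2 : ℝ) ^ (sepEdges (side h) E).card :=
    Finset.single_le_sum (f := fun h => (2 : ℝ) ^ (sepEdges (side h) E).card)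
      (fun _ _ => by positivity) (Finset.mem_univ h)
  have h2 : ∏ i ∈ Finset.range n, (1 + δ (i + 2)) ≤
      Real.exp (∑ i ∈ Finset.range n, δ (i + 2)) := by
    rw [Real.exp_sum]
    refine Finset.prod_le_prod (fun i _ => ?_) fun i _ => ?_
    · have := hδ0 (i + 2); linarith
    · rw [add_comm]; exact Real.add_one_le_exp _
  have hκ : (0 : ℝ) < Fintype.card κ := by exact_mod_cast Fintype.card_pos
  have h3 := (h1.trans hE2).trans (mul_le_mul_of_nonneg_left h2 hκ.le)
  have h4 := Real.log_le_log (by positivity) h3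
  rwa [Real.log_pow, Real.log_mul hκ.ne' (Real.exp_ne_zero _), Real.log_exp] at h4

/-- The traces on `P` of open halfspaces whose boundary avoids `P`. -/
def traces {d : ℕ} (P : Finset (EuclideanSpace ℝ (Fin d))) :
    Finset (Finset (EuclideanSpace ℝ (Fin d))) :=
  P.powerset.filter fun A => ∃ y : EuclideanSpace ℝ (Fin d) × ℝ,
    (∀ p ∈ P, ev y p ≠ 0) ∧ A = P.filter fun p => 0 < ev y p

theorem card_traces_le {d : ℕ} (P : Finset (EuclideanSpace ℝ (Fin d))) (hP : P.Nonempty) :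
    (traces P).card ≤ (d + 2) * P.card ^ (d + 1) := by
  have hsh : (traces P).shatterer ⊆ (Finset.range (d + 2)).biUnion fun i => P.powersetCard i := by
    intro T hT
    have hT := Finset.mem_shatterer.1 hT
    have hTP : T ⊆ P := by
      obtain ⟨A, hA, hTA⟩ := hT Finset.Subset.rfl
      exact (Finset.inter_eq_left.1 hTA).trans
        (Finset.mem_powerset.1 (Finset.mem_filter.1 hA).1)
    let φ : EuclideanSpace ℝ (Fin d) × ℝ → Module.Dual ℝ (EuclideanSpace ℝ (Fin d) × ℝ) :=
      fun y => (innerSL ℝ y.1).toLinearMap ∘ₗ LinearMap.fst ℝ _ _ - y.2 • LinearMap.snd ℝ _ _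
    have hφ : ∀ y x, φ y (x, 1) = ev y x := fun y x => by
      simp [φ, ev, real_inner_comm]
    have h := card_le_of_shatters_signs (fun x => (x, (1 : ℝ))) φ P (traces P) (by
      intro A hA
      obtain ⟨hA1, y, hy, rfl⟩ := Finset.mem_filter.1 hA
      refine ⟨Finset.filter_subset _ _, y, fun i hi => ?_⟩
      rw [hφ]
      exact ⟨hy i hi, by simp [hi]⟩) T hT
    have hfr : Module.finrank ℝ (EuclideanSpace ℝ (Fin d) × ℝ) = d + 1 := by simp
    rw [hfr] at h
    exact Finset.mem_biUnion.2 ⟨T.card, Finset.mem_range.2 (by omega),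
      Finset.mem_powersetCard.2 ⟨hTP, rfl⟩⟩
  have hn : 0 < P.card := hP.card_pos
  calc (traces P).card ≤ (traces P).shatterer.card := Finset.card_le_card_shatterer _
    _ ≤ _ := Finset.card_le_card hsh
    _ ≤ ∑ i ∈ Finset.range (d + 2), (P.powersetCard i).card := Finset.card_biUnion_le
    _ ≤ ∑ i ∈ Finset.range (d + 2), P.card ^ (d + 1) := by
        refine Finset.sum_le_sum fun i hi => ?_
        rw [Finset.card_powersetCard]
        exact (Nat.choose_le_pow _ _).trans
          (Nat.pow_le_pow_right hn (by have := Finset.mem_range.1 hi; omega))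
    _ = _ := by simp

theorem sum_rpow_neg_le {a : ℝ} (ha0 : 0 ≤ a) (ha : a ≤ 1 / 2) (n : ℕ) :
    ∑ i ∈ Finset.range n, ((i : ℝ) + 2) ^ (-a) ≤ 2 * ((n : ℝ) + 1) ^ (1 - a) := by
  induction n with
  | zero => simp
  | succ n ih =>
    rw [Finset.sum_range_succ]
    push_cast
    set m : ℝ := (n : ℝ) + 2 with hm
    have hm0 : 0 < m := by positivity
    have h1 : ((n : ℝ) + 1) = m * (1 + -(1 / m)) := by rw [hm]; field_simp; ring
    have h2 : ((n : ℝ) + 1) ^ (1 - a) ≤ m ^ (1 - a) - (1 - a) * m ^ (-a) := by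
      have hm1 : 1 / m ≤ 1 := by rw [div_le_one hm0, hm]; linarith [n.cast_nonneg (α := ℝ)]
      rw [h1, Real.mul_rpow hm0.le (by linarith)]
      have h3 := rpow_one_add_le_one_add_mul_self (s := -(1 / m)) (by linarith)
        (p := 1 - a) (by linarith) (by linarith)
      have h4 : m ^ (1 - a) * (1 / m) = m ^ (-a) := by
        rw [show -a = (1 - a) - 1 by ring, Real.rpow_sub_one hm0.ne']; ring
      calc _ ≤ m ^ (1 - a) * (1 + (1 - a) * -(1 / m)) :=
            mul_le_mul_of_nonneg_left h3 (by positivity)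
        _ = m ^ (1 - a) - (1 - a) * (m ^ (1 - a) * (1 / m)) := by ring
        _ = _ := by rw [h4]
    have h5 : 0 ≤ m ^ (-a) := by positivity
    rw [show (n : ℝ) + 1 + 1 = m by rw [hm]; ring]
    nlinarith

theorem one_div_rpow_mul_rpow {d : ℕ} (hd : 3 ≤ d) {K i L : ℝ} (hK : 0 < K) (hi : 0 < i)
    (hL : 0 < L) :
    1 / (K ^ (1 / (d : ℝ)) * (i / K / L ^ 2) ^ (1 / ((d : ℝ) - 1))) =
      K ^ (1 / ((d : ℝ) * ((d : ℝ) - 1))) * L ^ (2 / ((d : ℝ) - 1)) *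
        i ^ (-(1 / ((d : ℝ) - 1))) := by
  have hd' : (3 : ℝ) ≤ d := by exact_mod_cast hd
  have hd0 : (d : ℝ) ≠ 0 := by positivity
  have hd1 : (d : ℝ) - 1 ≠ 0 := by linarith
  obtain ⟨κ, rfl⟩ : ∃ κ, Real.exp κ = K := ⟨_, Real.exp_log hK⟩
  obtain ⟨ι, rfl⟩ : ∃ ι, Real.exp ι = i := ⟨_, Real.exp_log hi⟩
  obtain ⟨l, rfl⟩ : ∃ l, Real.exp l = L := ⟨_, Real.exp_log hL⟩
  rw [← Real.exp_nat_mul]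
  simp only [← Real.exp_mul, ← Real.exp_sub, ← Real.exp_add, one_div (Real.exp _),
    ← Real.exp_neg]
  congr 1
  field_simp
  push_cast
  ring

theorem exists_pair_few_separating_of_subset {d : ℕ} (hd : 3 ≤ d) : ∃ A : ℝ, 0 < A ∧
    ∀ (κ : Type) [Fintype κ] (y : κ → EuclideanSpace ℝ (Fin d) × ℝ)
      (P P' : Finset (EuclideanSpace ℝ (Fin d))) (μ : κ → ℝ) (k : ℕ),
      (∀ i, ∀ p ∈ P, ev (y i) p ≠ 0) → (∀ h, 0 ≤ μ h) → ∑ h, μ h = 1 → 0 < k → k ≤ P.card →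
      (∀ p ∈ P, IsShallowPt P k p) → P' ⊆ P → 2 ≤ P'.card →
      ∃ p ∈ P', ∃ q ∈ P', p ≠ q ∧
        ∑ h ∈ Finset.univ.filter (fun h => ¬ (0 < ev (y h) p ↔ 0 < ev (y h) q)), μ h ≤
          A * ((k : ℝ) ^ (1 / ((d : ℝ) * ((d : ℝ) - 1))) *
            (1 + Real.log ((P.card : ℝ) / k)) ^ (2 / ((d : ℝ) - 1)) *
              (P'.card : ℝ) ^ (-(1 / ((d : ℝ) - 1)))) := by
  obtain ⟨A, hA, hpair⟩ := exists_pair_few_separating hd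
  refine ⟨A, hA, fun κ _ y P P' μ k hoff hμ hμ1 hk hkP hP hP' h2 => ?_⟩
  have hd' : (3 : ℝ) ≤ d := by exact_mod_cast hd
  have hd1 : (0 : ℝ) < (d : ℝ) - 1 := by linarith
  set k' := min k P'.card with hk'
  have hk'0 : 0 < k' := lt_min hk (by omega)
  have hk'R : (0 : ℝ) < k' := by exact_mod_cast hk'0
  have hkR : (0 : ℝ) < k := by exact_mod_cast hk
  have hiR : (0 : ℝ) < P'.card := by exact_mod_cast (by omega : 0 < P'.card)
  have hx1 : 1 ≤ (P'.card : ℝ) / k' := by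
    rw [one_le_div hk'R]; exact_mod_cast min_le_right _ _
  have hx : (P'.card : ℝ) / k' ≤ (P.card : ℝ) / k := by
    rcases le_total k P'.card with h | h
    · rw [hk', min_eq_left h]
      gcongr
    · rw [hk', min_eq_right h, div_self hiR.ne', one_le_div hkR]
      exact_mod_cast hkP
  set L' := 1 + Real.log ((P'.card : ℝ) / k') with hL'
  have hL'1 : 1 ≤ L' := by have := Real.log_nonneg hx1; linarith
  have hL'L : L' ≤ 1 + Real.log ((P.card : ℝ) / k) := by
    have := Real.log_le_log (by positivity) hx; linarith
  have hL'0 : 0 < L' := by linarith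
  have hz : ((P'.card : ℝ) / k' / L' ^ 2) ^ (1 / ((d : ℝ) - 1)) =
      ((P'.card : ℝ) / k' / L' ^ 2) ^ (((d - 1 : ℕ) : ℝ)⁻¹) := by
    rw [Nat.cast_pred (by omega), one_div]
  obtain ⟨p, hp, q, hq, hpq, h⟩ := hpair κ y P' μ k'
    (((P'.card : ℝ) / k' / L' ^ 2) ^ (1 / ((d : ℝ) - 1))) (fun i p hp => hoff i p (hP' hp)) hμ hμ1
    hk'0 (min_le_right _ _) h2 (fun p hp => by
      obtain ⟨a, b, ha, hpa, hcard⟩ := (hP p (hP' hp)).mono hP'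
      refine ⟨a, b, ha, hpa, le_min hcard ?_⟩
      rw [← Set.ncard_coe_finset]
      exact Set.ncard_le_ncard Set.inter_subset_left) (by positivity) (by
      rw [hz, Real.rpow_inv_natCast_pow (by positivity) (by omega), ← hL',
        div_mul_cancel₀ _ (by positivity)])
  refine ⟨p, hp, q, hq, hpq, h.trans ?_⟩
  rw [← mul_one_div, one_div_rpow_mul_rpow hd hk'R hiR hL'0]
  have : (k' : ℝ) ≤ k := by exact_mod_cast min_le_left _ _
  gcongr

/-- The points of `P` can be connected by edges, few of which are separated by any given
hyperplane avoiding `P`. -/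
theorem exists_edges_few_separated {d : ℕ} (hd : 3 ≤ d) : ∃ B : ℝ, 0 < B ∧
    ∀ (P : Finset (EuclideanSpace ℝ (Fin d))) (k : ℕ), 2 ≤ k → (k : ℝ) ≤ (P.card : ℝ) / 2 →
      (∀ p ∈ P, IsShallowPt P k p) →
      ∃ E : Finset ({x // x ∈ P} × {x // x ∈ P}),
        (∀ p q, Relation.EqvGen (fun a b => (a, b) ∈ E) p q) ∧
        ∀ y : EuclideanSpace ℝ (Fin d) × ℝ, (∀ p ∈ P, ev y p ≠ 0) →
          ((sepEdges (fun x : {x // x ∈ P} => 0 < ev y x) E).card : ℝ) ≤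
            B * (P.card : ℝ) ^ (1 - 1 / ((d : ℝ) - 1)) *
              (k : ℝ) ^ (1 / ((d : ℝ) * ((d : ℝ) - 1))) *
              Real.logb 2 ((P.card : ℝ) / k) ^ (2 / ((d : ℝ) - 1)) := by
  obtain ⟨A, hA, hpair⟩ := exists_pair_few_separating_of_subset hd
  have hd' : (3 : ℝ) ≤ d := by exact_mod_cast hd
  have hd1 : (0 : ℝ) < (d : ℝ) - 1 := by linarith
  have hd2 : 1 / ((d : ℝ) - 1) ≤ 1 / 2 := by
    apply one_div_le_one_div_of_le <;> linarith
  set F : ℝ := (3 : ℝ) ^ (2 / ((d : ℝ) - 1)) with hF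
  set c : ℝ := Real.log (d + 2) + (d + 1) * 2 + 2 * A * F with hc
  have hlogd : 0 ≤ Real.log ((d : ℝ) + 2) := Real.log_nonneg (by linarith)
  have hc0 : 0 < c := by positivity
  refine ⟨c / Real.log 2, div_pos hc0 (Real.log_pos (by norm_num)), ?_⟩
  intro P k hk hkn hP
  have hkR : (2 : ℝ) ≤ k := by exact_mod_cast hk
  have hn4 : (4 : ℝ) ≤ P.card := by linarith
  have hn : 4 ≤ P.card := by exact_mod_cast hn4
  have hkn' : k ≤ P.card := by
    have : (k : ℝ) ≤ P.card := by linarith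
    exact_mod_cast this
  have hlog2 : 0 < Real.log 2 := Real.log_pos (by norm_num)
  have hx : 2 ≤ (P.card : ℝ) / k := by rw [le_div_iff₀ (by linarith)]; linarith
  set Λ := Real.logb 2 ((P.card : ℝ) / k) with hΛ
  have hΛ1 : 1 ≤ Λ := by
    rw [hΛ, Real.le_logb_iff_rpow_le (by norm_num) (by linarith), Real.rpow_one]; exact hx
  have hLΛ : 1 + Real.log ((P.card : ℝ) / k) ≤ 3 * Λ := by
    have h1 : Real.log ((P.card : ℝ) / k) = Λ * Real.log 2 := by
      rw [hΛ, Real.logb, div_mul_cancel₀ _ hlog2.ne']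
    have := Real.log_two_lt_d9
    rw [h1]; nlinarith
  have hL0 : 0 ≤ 1 + Real.log ((P.card : ℝ) / k) := by
    have := Real.log_nonneg (show 1 ≤ (P.card : ℝ) / k by linarith); linarith
  set D : ℝ := (k : ℝ) ^ (1 / ((d : ℝ) * ((d : ℝ) - 1))) with hD
  have hD1 : 1 ≤ D := Real.one_le_rpow (by linarith) (by positivity)
  set G : ℝ := Λ ^ (2 / ((d : ℝ) - 1)) with hG
  have hG1 : 1 ≤ G := Real.one_le_rpow hΛ1 (by positivity)
  set N : ℝ := (P.card : ℝ) ^ (1 - 1 / ((d : ℝ) - 1)) with hN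
  have hN1 : 1 ≤ N := Real.one_le_rpow (by linarith) (by linarith)
  have hLG : (1 + Real.log ((P.card : ℝ) / k)) ^ (2 / ((d : ℝ) - 1)) ≤ F * G := by
    rw [hF, hG, ← Real.mul_rpow (by norm_num) (by linarith)]
    gcongr
  set δ : ℕ → ℝ := fun i => A * (D * (F * G) * (i : ℝ) ^ (-(1 / ((d : ℝ) - 1)))) with hδ
  obtain ⟨y, hy⟩ : ∃ y : {S // S ∈ traces P} → EuclideanSpace ℝ (Fin d) × ℝ,
      ∀ S, (∀ p ∈ P, ev (y S) p ≠ 0) ∧ S.1 = P.filter fun p => 0 < ev (y S) p :=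
    ⟨fun S => (Finset.mem_filter.1 S.2).2.choose, fun S => (Finset.mem_filter.1 S.2).2.choose_spec⟩
  have htr : ∀ y : EuclideanSpace ℝ (Fin d) × ℝ, (∀ p ∈ P, ev y p ≠ 0) →
      (P.filter fun p => 0 < ev y p) ∈ traces P := fun y hy =>
    Finset.mem_filter.2 ⟨Finset.mem_powerset.2 (Finset.filter_subset _ _), y, hy, rfl⟩
  have hne : Nonempty {S // S ∈ traces P} := ⟨_, htr (0, -1) fun p _ => by simp [ev]⟩
  obtain ⟨m, hm⟩ : ∃ m, P.card = m + 1 := ⟨P.card - 1, by omega⟩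
  obtain ⟨E, hE1, hE2⟩ := exists_connecting_edges_card_le
    (fun (S : {S // S ∈ traces P}) (x : {x // x ∈ P}) => 0 < ev (y S) x) δ
    (fun i => by simp only [hδ]; positivity) m Finset.univ (by simpa using hm) (by
      intro P' _ h2 μ hμ hμ1
      obtain ⟨p, hp, q, hq, hpq, h⟩ := hpair {S // S ∈ traces P} y P
        (P'.map (Function.Embedding.subtype _)) μ k (fun S => (hy S).1) hμ hμ1 (by omega) hkn' hP
        (fun x hx => by
          obtain ⟨a, _, rfl⟩ := Finset.mem_map.1 hx
          exact a.2) (by simpa using h2)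
      obtain ⟨a, ha, rfl⟩ := Finset.mem_map.1 hp
      obtain ⟨b, hb, rfl⟩ := Finset.mem_map.1 hq
      refine ⟨a, ha, b, hb, fun hab => hpq (by rw [hab]), h.trans ?_⟩
      simp only [hδ, Finset.card_map]
      gcongr)
  refine ⟨E, fun p q => hE1 p (Finset.mem_univ _) q (Finset.mem_univ _), fun z hz => ?_⟩
  have hside : sepEdges (fun x : {x // x ∈ P} => 0 < ev z x) E =
      sepEdges (fun x : {x // x ∈ P} => 0 < ev (y ⟨_, htr z hz⟩) x) E := by
    have hiff : ∀ x : {x // x ∈ P}, 0 < ev z x ↔ 0 < ev (y ⟨_, htr z hz⟩) x := fun x => by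
      have h := Finset.ext_iff.1 (hy ⟨_, htr z hz⟩).2 x
      simpa [x.2] using h
    simp only [hiff]
  have hcard := hE2 ⟨_, htr z hz⟩
  rw [← hside] at hcard
  have hlogκ : Real.log (Fintype.card {S // S ∈ traces P}) ≤
      Real.log (d + 2) + (d + 1) * Real.log P.card := by
    have h1 := card_traces_le P (Finset.card_pos.1 (by omega))
    rw [Fintype.card_coe]
    have h2 : 0 < (traces P).card := by
      rw [← Fintype.card_coe]; exact Fintype.card_pos
    have h3 : ((traces P).card : ℝ) ≤ ((d : ℝ) + 2) * (P.card : ℝ) ^ (d + 1) := by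
      exact_mod_cast h1
    refine (Real.log_le_log (by exact_mod_cast h2) h3).trans_eq ?_
    rw [Real.log_mul (by positivity) (by positivity), Real.log_pow]
    push_cast; ring
  have hlogn : Real.log P.card ≤ 2 * N := by
    have h1 := Real.log_le_rpow_div (x := P.card) (by linarith) (ε := 1 / 2) (by norm_num)
    have h2 : (P.card : ℝ) ^ (1 / 2 : ℝ) ≤ N :=
      Real.rpow_le_rpow_of_exponent_le (by linarith) (by linarith)
    linarith
  have hsum : ∑ i ∈ Finset.range m, δ (i + 2) ≤ 2 * A * F * (N * D * G) := by
    have h1 := sum_rpow_neg_le (a := 1 / ((d : ℝ) - 1)) (by positivity) hd2 m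
    have h2 : ((m : ℝ) + 1) = P.card := by rw [hm]; push_cast; ring
    rw [h2] at h1
    simp only [hδ, ← Finset.mul_sum]
    push_cast
    calc _ ≤ A * (D * (F * G) * (2 * N)) := by gcongr
      _ = _ := by ring
  have hNDG : N ≤ N * D * G := by
    rw [mul_assoc]
    exact le_mul_of_one_le_right (by linarith) (one_le_mul_of_one_le_of_one_le hD1 hG1)
  have hNDG1 : 1 ≤ N * D * G := hN1.trans hNDG
  have hfin : ((sepEdges (fun x : {x // x ∈ P} => 0 < ev z x) E).card : ℝ) * Real.log 2 ≤
      c * (N * D * G) := by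
    have h1 : Real.log ((d : ℝ) + 2) ≤ Real.log (d + 2) * (N * D * G) :=
      le_mul_of_one_le_right hlogd hNDG1
    have h2 : ((d : ℝ) + 1) * Real.log P.card ≤ (d + 1) * (2 * (N * D * G)) := by
      gcongr; linarith
    rw [hc]
    linarith
  rw [← le_div_iff₀ hlog2] at hfin
  exact hfin.trans_eq (by ring)

theorem CrossesSeg.exists_sides {d : ℕ} {a : EuclideanSpace ℝ (Fin d)} {b ε : ℝ}
    {p q : EuclideanSpace ℝ (Fin d)} (h : CrossesSeg a b p q) (hε : 0 < ε)
    (hp : ⟪p, a⟫ - b ≠ 0 → ε < |⟪p, a⟫ - b|) (hq : ⟪q, a⟫ - b ≠ 0 → ε < |⟪q, a⟫ - b|) :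
    ¬ (0 < ev (a, b + ε) p ↔ 0 < ev (a, b + ε) q) ∨
      ¬ (0 < ev (a, b - ε) p ↔ 0 < ev (a, b - ε) q) := by
  obtain ⟨⟨x, hx, s, t, hs, ht, hst, rfl⟩, hnot⟩ := h
  have hx : s * (⟪p, a⟫ - b) + t * (⟪q, a⟫ - b) = 0 := by
    have : ⟪s • p + t • q, a⟫ = b := hx
    rw [inner_add_left, real_inner_smul_left, real_inner_smul_left] at this
    linear_combination this - b * hst
  have h0 : ¬ (⟪p, a⟫ - b = 0 ∧ ⟪q, a⟫ - b = 0) := by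
    rintro ⟨hp0, hq0⟩
    refine hnot ?_
    rintro _ ⟨s, t, hs, ht, hst, rfl⟩
    change ⟪s • p + t • q, a⟫ = b
    rw [inner_add_left, real_inner_smul_left, real_inner_smul_left]
    linear_combination s * hp0 + t * hq0 + b * hst
  simp only [ev]
  set u := ⟪p, a⟫ - b with hu
  set v := ⟪q, a⟫ - b with hv
  rw [show ⟪p, a⟫ - (b + ε) = u - ε by rw [hu]; ring,
    show ⟪q, a⟫ - (b + ε) = v - ε by rw [hv]; ring,
    show ⟪p, a⟫ - (b - ε) = u + ε by rw [hu]; ring,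
    show ⟪q, a⟫ - (b - ε) = v + ε by rw [hv]; ring]
  by_contra hcon
  push Not at hcon
  obtain ⟨h1, h2⟩ := hcon
  have hcases : ∀ r : ℝ, (r ≠ 0 → ε < |r|) → r = 0 ∨ ε < r ∨ r < -ε := fun r hr => by
    by_cases hr0 : r = 0
    · exact Or.inl hr0
    · rcases lt_abs.1 (hr hr0) with h | h
      · exact Or.inr (Or.inl h)
      · exact Or.inr (Or.inr (by linarith))
  rcases hcases u hp with hu0 | hu0 | hu0 <;> rcases hcases v hq with hv0 | hv0 | hv0
  · exact h0 ⟨hu0, hv0⟩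
  · linarith [h1.2 (by linarith)]
  · linarith [h2.1 (by linarith)]
  · linarith [h1.1 (by linarith)]
  · rcases hs.eq_or_lt with hs0 | hs0
    · nlinarith
    · nlinarith
  · linarith [h1.1 (by linarith)]
  · linarith [h2.2 (by linarith)]
  · linarith [h1.2 (by linarith)]
  · rcases hs.eq_or_lt with hs0 | hs0
    · nlinarith
    · nlinarith

theorem exists_pos_lt_abs {ι : Type*} (s : Finset ι) (f : ι → ℝ) :
    ∃ ε : ℝ, 0 < ε ∧ ∀ i ∈ s, f i ≠ 0 → ε < |f i| := by
  have h : ∀ᶠ ε : ℝ in nhdsWithin 0 (Set.Ioi 0), ∀ i ∈ s, f i ≠ 0 → ε < |f i| := by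
    rw [Filter.eventually_all_finset]
    intro i _
    by_cases hi : f i = 0
    · simp [hi]
    · filter_upwards [Ioo_mem_nhdsGT (abs_pos.2 hi)] with ε hε _ using hε.2
  obtain ⟨ε, h1, h2⟩ := (h.and self_mem_nhdsWithin).exists
  exact ⟨ε, h2, h1⟩

/-- Lemma 5.2: spanning tree with small crossing number for a set of
`k`-shallow points, `d ≥ 3`. -/
theorem spanning_tree_shallow_points (d : ℕ) (hd : 3 ≤ d) :
    ∃ C : ℝ, 0 < C ∧
      ∀ (P : Finset (EuclideanSpace ℝ (Fin d))) (n k : ℕ),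
        P.card = n → 2 ≤ k → (k : ℝ) ≤ (n : ℝ) / 2 →
        GenPos P → (∀ p ∈ P, IsShallowPt P k p) →
        ∃ G : SimpleGraph {x // x ∈ P}, G.IsTree ∧
          ∀ (a : EuclideanSpace ℝ (Fin d)) (b : ℝ), a ≠ 0 →
            (({e : Sym2 {x // x ∈ P} | e ∈ G.edgeSet ∧
                ∃ p q : {x // x ∈ P}, e = s(p, q) ∧ CrossesSeg a b ↑p ↑q}.ncard : ℝ)
              ≤ C * (n : ℝ) ^ (1 - 1 / ((d : ℝ) - 1)) *
                  (k : ℝ) ^ (1 / ((d : ℝ) * ((d : ℝ) - 1))) *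
                  Real.logb 2 ((n : ℝ) / k) ^ (2 / ((d : ℝ) - 1))) := by
  obtain ⟨B, hB, hedges⟩ := exists_edges_few_separated hd
  refine ⟨2 * B, by positivity, ?_⟩
  rintro P _ k rfl hk hkn - hP
  obtain ⟨E, hE1, hE2⟩ := hedges P k hk hkn hP
  have hkR : (2 : ℝ) ≤ k := by exact_mod_cast hk
  have hn : 0 < P.card := by
    have : (0 : ℝ) < P.card := by linarith
    exact_mod_cast this
  obtain ⟨p₀, hp₀⟩ := Finset.card_pos.1 hn
  set G₀ : SimpleGraph {x // x ∈ P} := SimpleGraph.fromRel fun a b => (a, b) ∈ E with hG₀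
  have hreach : ∀ p q, Relation.EqvGen (fun a b => (a, b) ∈ E) p q → G₀.Reachable p q := by
    intro p q h
    induction h with
    | rel a b hab =>
      by_cases hne : a = b
      · rw [hne]
      · exact SimpleGraph.Adj.reachable ((SimpleGraph.fromRel_adj _ _ _).2 ⟨hne, Or.inl hab⟩)
    | refl a => rfl
    | symm a b _ ih => exact ih.symm
    | trans a b c _ _ ih1 ih2 => exact ih1.trans ih2
  have hconn : G₀.Connected :=
    { preconnected := fun p q => hreach p q (hE1 p q), nonempty := ⟨⟨p₀, hp₀⟩⟩ }
  obtain ⟨G, hGle, hG⟩ := hconn.exists_isTree_le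
  refine ⟨G, hG, fun a b _ => ?_⟩
  obtain ⟨ε, hε, hεP⟩ := exists_pos_lt_abs P fun p => ⟪p, a⟫ - b
  have hoff : ∀ σ : ℝ, |σ| = ε → ∀ p ∈ P, ev (a, b + σ) p ≠ 0 := by
    intro σ hσ p hp h
    have h1 : ⟪p, a⟫ - b = σ := by simp only [ev] at h; linarith
    have h2 := hεP p hp (by rw [h1]; exact abs_pos.1 (hσ ▸ hε))
    rw [h1, hσ] at h2
    exact lt_irrefl _ h2
  have h1 := hE2 (a, b + ε) (hoff ε (abs_of_pos hε))
  have h2 := hE2 (a, b - ε) (by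
    rw [sub_eq_add_neg]; exact hoff (-ε) (by rw [abs_neg, abs_of_pos hε]))
  set S₁ := sepEdges (fun x : {x // x ∈ P} => 0 < ev (a, b + ε) x) E with hS₁
  set S₂ := sepEdges (fun x : {x // x ∈ P} => 0 < ev (a, b - ε) x) E with hS₂
  have hsub : {e : Sym2 {x // x ∈ P} | e ∈ G.edgeSet ∧
      ∃ p q : {x // x ∈ P}, e = s(p, q) ∧ CrossesSeg a b ↑p ↑q} ⊆
      (((S₁ ∪ S₂).image fun e => s(e.1, e.2) : Finset (Sym2 {x // x ∈ P})) :
        Set (Sym2 {x // x ∈ P})) := by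
    rintro _ ⟨hpq, p, q, rfl, hcross⟩
    have hsep := hcross.exists_sides hε (hεP p p.2) (hεP q q.2)
    have hE : (p, q) ∈ E ∨ (q, p) ∈ E := ((SimpleGraph.fromRel_adj _ _ _).1 (hGle hpq)).2
    rw [Finset.mem_coe, Finset.mem_image]
    rcases hE with hE | hE
    · refine ⟨(p, q), ?_, rfl⟩
      rw [Finset.mem_union, hS₁, hS₂, sepEdges, sepEdges, Finset.mem_filter, Finset.mem_filter]
      exact hsep.imp (fun h => ⟨hE, h⟩) fun h => ⟨hE, h⟩
    · refine ⟨(q, p), ?_, Sym2.eq_swap⟩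
      rw [Finset.mem_union, hS₁, hS₂, sepEdges, sepEdges, Finset.mem_filter, Finset.mem_filter]
      exact hsep.imp (fun h => ⟨hE, fun h' => h h'.symm⟩) fun h => ⟨hE, fun h' => h h'.symm⟩
  have hcard := (Set.ncard_le_ncard hsub (Finset.finite_toSet _)).trans
    ((Set.ncard_coe_finset _).le.trans (Finset.card_image_le.trans (Finset.card_union_le S₁ S₂)))
  have hcardR : (({e : Sym2 {x // x ∈ P} | e ∈ G.edgeSet ∧
      ∃ p q : {x // x ∈ P}, e = s(p, q) ∧ CrossesSeg a b ↑p ↑q}.ncard : ℝ)) ≤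
      S₁.card + S₂.card := by exact_mod_cast hcard
  linarith
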